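/- arXiv:2304.00816 — 3 statements merged into one kernel-verified Lean document; each statement's English description precedes it below -/
import Mathlib

section
/- Fix a nonnegative integer s and δ ∈ {0,1}. Let n be an odd positive integer with n > (2s+4)². Then Φ_n^{−(s+2)} · d_n^{3s+5} · ρ_{n,0} ∈ ℤ. Moreover, for every positive integer n (without parity or size restriction), d_n^{2s+3} · σ_{n,0} ∈ ℤ. -/
open Filter Finset

/-- Pochhammer symbol `(α)_k = α (α+1) ⋯ (α+k-1)` for rational `α`. -/
def poch (α : ℚ) (k : ℕ) : ℚ := ∏ i ∈ Finset.range k, (α + i)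

/-- The rational function
`A_n(t) = 2^{(6s+12)n} (4t+2n)^δ (t+1/4)_n^{s+2} (t+3/4)_n^{s+2} / (t)_{n+1}^{2s+4}`. -/
def Afun (s δ n : ℕ) (t : ℚ) : ℚ :=
  2 ^ ((6 * s + 12) * n) * (4 * t + 2 * n) ^ δ *
    poch (t + 1/4) n ^ (s + 2) * poch (t + 3/4) n ^ (s + 2) / poch t (n + 1) ^ (2 * s + 4)

/-- The rational function `B_n(t) = 2^{(3s+6)n} (t+3/4)_n^{s+2} / (t)_{n+1}^{s+2}`. -/
def Bfun (s n : ℕ) (t : ℚ) : ℚ :=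
  2 ^ ((3 * s + 6) * n) * poch (t + 3/4) n ^ (s + 2) / poch t (n + 1) ^ (s + 2)

/-- `dlcm n = lcm(1, 2, …, n)`. -/
def dlcm (n : ℕ) : ℕ := (Finset.Icc 1 n).lcm id

open scoped Classical in
/-- `Phi n` is the product of all primes `q` with `√(10 n) < q ≤ n` and `{n/q} > 1/2`. -/
noncomputable def Phi (n : ℕ) : ℕ :=
  ∏ q ∈ Finset.Icc 1 n,
    if q.Prime ∧ Real.sqrt (10 * n) < (q : ℝ) ∧ 1/2 < Int.fract ((n : ℝ) / q) then q else 1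

namespace LF

noncomputable def ZR (p : ℕ) [Fact p.Prime] : Subring ℚ := (PadicInt.subring p).comap (Rat.castHom ℚ_[p])

lemma mem_ZR (p : ℕ) [Fact p.Prime] (x : ℚ) : x ∈ ZR p ↔ ‖(x : ℚ_[p])‖ ≤ 1 := Iff.rfl

lemma natdiv_mem_ZR (p : ℕ) [hp : Fact p.Prime] (d : ℕ) (z : ℤ) (hz : z ≠ 0)
    (h : ∀ e : ℕ, (p : ℤ) ^ e ∣ z → (p : ℤ) ^ e ∣ d) : (d : ℚ) / z ∈ ZR p := by
  obtain ⟨e, w, hw, hzw⟩ := (Int.finiteMultiplicity_iff (a := (p : ℤ)) (b := z) |>.2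
    ⟨by simpa using hp.out.ne_one, hz⟩).exists_eq_pow_mul_and_not_dvd |> fun ⟨w, h1, h2⟩ =>
      (⟨_, w, h2, h1⟩ : ∃ e : ℕ, ∃ w : ℤ, ¬ (p : ℤ) ∣ w ∧ z = (p : ℤ) ^ e * w)
  obtain ⟨c, hc⟩ := h e ⟨w, hzw⟩
  have hp0 : (p : ℚ) ≠ 0 := by exact_mod_cast hp.out.ne_zero
  have h1 : (d : ℚ) = (p : ℚ) ^ e * c := by exact_mod_cast hc
  have h2 : (d : ℚ) / z = c / w := by
    rw [h1, hzw]; push_cast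
    rw [mul_div_mul_left _ _ (pow_ne_zero _ hp0)]
  rw [h2, mem_ZR]
  push_cast
  rw [norm_div]
  have h3 : ‖(w : ℚ_[p])‖ = 1 := by
    have := (Padic.norm_intCast_lt_one_iff (p := p) (k := w)).not.2 hw
    exact le_antisymm (Padic.norm_int_le_one w) (not_lt.1 this)
  rw [h3, div_one]
  exact Padic.norm_int_le_one c

lemma inv_mem_ZR (p : ℕ) [hp : Fact p.Prime] (z : ℕ) (hz : ¬ p ∣ z) : (z : ℚ)⁻¹ ∈ ZR p := by
  have := natdiv_mem_ZR p 1 z (by rintro h; apply hz; rw [Int.natCast_eq_zero.1 h]; simp) (by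
    intro e he
    rcases e with _ | e
    · simp
    · exfalso; apply hz
      have : (p : ℤ) ∣ z := (dvd_pow_self _ (by simp)).trans he
      exact_mod_cast this)
  simpa using this

lemma int_of_ZR (x : ℚ) (h : ∀ (p : ℕ) [Fact p.Prime], x ∈ ZR p) : ∃ z : ℤ, x = z := by
  have : x.den = 1 := by
    by_contra hne
    obtain ⟨p, hp, hpd⟩ := Nat.exists_prime_and_dvd hne
    have := Fact.mk hp
    have h1 := (mem_ZR p x).1 (h p)
    have hnum : ¬ (p : ℤ) ∣ x.num := by
      intro hh
      have := Nat.dvd_gcd (Int.natCast_dvd.1 hh) hpd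
      rw [x.reduced] at this
      exact hp.one_lt.ne' (Nat.dvd_one.1 this)
    have h2 : ‖(x.num : ℚ_[p])‖ = 1 :=
      le_antisymm (Padic.norm_int_le_one _) (not_lt.1 (Padic.norm_intCast_lt_one_iff.not.2 hnum))
    have h3 : ‖((x.den : ℤ) : ℚ_[p])‖ < 1 :=
      Padic.norm_intCast_lt_one_iff.2 (by exact_mod_cast hpd)
    have h4 : (x : ℚ_[p]) * ((x.den : ℤ) : ℚ_[p]) = (x.num : ℚ_[p]) := by
      have := Rat.mul_den_eq_num x
      exact_mod_cast congrArg (fun y : ℚ => (y : ℚ_[p])) this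
    have h5 := congrArg norm h4
    rw [norm_mul, h2] at h5
    nlinarith [norm_nonneg (x : ℚ_[p]), norm_nonneg ((x.den : ℤ) : ℚ_[p])]
  exact ⟨x.num, (Rat.coe_int_num_of_den_eq_one this).symm⟩

open PowerSeries in
def PSR (R : Subring ℚ) : Subring (PowerSeries ℚ) where
  carrier := {f | ∀ n, coeff n f ∈ R}
  mul_mem' := by
    intro f g hf hg n
    rw [coeff_mul]
    exact R.sum_mem fun x _ => R.mul_mem (hf _) (hg _)
  one_mem' := by
    intro n; rw [coeff_one]; split_ifs
    exacts [R.one_mem, R.zero_mem]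
  add_mem' := by
    intro f g hf hg n
    rw [map_add]; exact R.add_mem (hf _) (hg _)
  zero_mem' := by intro n; rw [map_zero]; exact R.zero_mem
  neg_mem' := by
    intro f hf n
    rw [map_neg]; exact R.neg_mem (hf _)

open PowerSeries

lemma C_mem_PSR {R : Subring ℚ} {c : ℚ} (hc : c ∈ R) : C c ∈ PSR R := by
  intro n; rw [coeff_C]; split_ifs
  exacts [hc, R.zero_mem]

lemma X_mem_PSR {R : Subring ℚ} : (X : ℚ⟦X⟧) ∈ PSR R := by
  intro n; rw [coeff_X]; split_ifs
  exacts [R.one_mem, R.zero_mem]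

lemma inv_formula (c : ℚ) (hc : c ≠ 0) :
    (X + C c : ℚ⟦X⟧)⁻¹ = C c⁻¹ * rescale (-c⁻¹) (mk 1) := by
  symm
  rw [PowerSeries.eq_inv_iff_mul_eq_one (by simpa using hc)]
  have h := congrArg (rescale (-c⁻¹)) (PowerSeries.mk_one_mul_one_sub_eq_one ℚ)
  rw [map_mul, map_sub, map_one, rescale_X] at h
  have h2 : (X + C c : ℚ⟦X⟧) = C c * (1 - C (-c⁻¹) * X) := by
    have : (C c * C c⁻¹ : ℚ⟦X⟧) = 1 := by rw [← map_mul, mul_inv_cancel₀ hc, map_one]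
    rw [map_neg]
    linear_combination (-X) * this
  have h3 : (C c⁻¹ * C c : ℚ⟦X⟧) = 1 := by rw [← map_mul, inv_mul_cancel₀ hc, map_one]
  rw [h2]
  calc _ = (C c⁻¹ * C c) * ((rescale (-c⁻¹)) (mk 1) * (1 - C (-c⁻¹) * X)) := by ring
    _ = 1 := by rw [h3, h, one_mul]

lemma resc_inv_mem {R : Subring ℚ} (d c : ℚ) (hc : c ≠ 0) (h : d / c ∈ R) :
    rescale d (C c * (X + C c : ℚ⟦X⟧)⁻¹) ∈ PSR R := by
  intro n
  rw [inv_formula c hc, ← mul_assoc, ← map_mul, mul_inv_cancel₀ hc, map_one, one_mul,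
    coeff_rescale, coeff_rescale]
  have : d ^ n * ((-c⁻¹) ^ n * coeff n (mk 1 : ℚ⟦X⟧)) = (-(d / c)) ^ n := by
    rw [coeff_mk, div_eq_mul_inv, ← mul_neg, mul_pow]; simp
  rw [this]
  exact R.pow_mem (R.neg_mem h) n

/-- the coefficient of the inverse power -/
lemma coeff_inv_pow (c : ℚ) (hc : c ≠ 0) (i j : ℕ) (hi : 1 ≤ i) :
    coeff j ((X + C c : ℚ⟦X⟧)⁻¹ ^ i) * (j.factorial) =
      (-1) ^ j * (∏ l ∈ Finset.range j, ((i : ℚ) + l)) / c ^ (i + j) := by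
  obtain ⟨i, rfl⟩ : ∃ i', i = i' + 1 := ⟨i - 1, by omega⟩
  rw [inv_formula c hc, mul_pow, ← map_pow, ← map_pow, PowerSeries.mk_one_pow_eq_mk_choose_add,
    coeff_C_mul, coeff_rescale, coeff_mk]
  have h1 : ((i + j).choose i : ℚ) * j.factorial = ∏ l ∈ Finset.range j, (((i + 1 : ℕ) : ℚ) + l) := by
    have := Nat.ascFactorial_eq_factorial_mul_choose i j
    rw [Nat.choose_symm_add (a := i), mul_comm]
    rw [Nat.ascFactorial_eq_prod_range] at this
    exact_mod_cast this.symm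
  rw [← h1, neg_pow, inv_pow, inv_pow, pow_add c]
  field_simp
  ring

lemma two_pow_prod_dvd (n : ℕ) (a : ℤ) :
    (n.factorial : ℤ) ∣ 2 ^ n * ∏ j ∈ Finset.range n, (4 * (j : ℤ) + a) := by
  have hf : n.factorial ≠ 0 := Nat.factorial_ne_zero n
  set v := n.factorial.factorization 2 with hv
  set m := n.factorial / 2 ^ v with hm
  have hmul : 2 ^ v * m = n.factorial := Nat.ordProj_mul_ordCompl_eq_self _ 2
  have hcop : Nat.Coprime 2 m := Nat.coprime_ordCompl Nat.prime_two hf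
  have hvn : v ≤ n := by
    have : Fact (Nat.Prime 2) := ⟨Nat.prime_two⟩
    have := padicValNat_factorial_le (p := 2) n
    rwa [hv, Nat.factorization_def _ Nat.prime_two]
  have hm0 : m ≠ 0 := by rintro h; rw [h] at hmul; simp at hmul; exact hf hmul.symm
  have hcop4 : IsCoprime (4 : ℤ) (m : ℤ) := by
    have : Nat.Coprime 4 m := by
      have := Nat.Coprime.pow_left 2 hcop
      simpa using this
    exact_mod_cast Nat.isCoprime_iff_coprime.2 this
  obtain ⟨u, w, huw⟩ := hcop4
  -- pick natural b with 4 b ≡ a mod m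
  obtain ⟨b, hb⟩ : ∃ b : ℕ, (m : ℤ) ∣ 4 * (b : ℤ) - a := by
    refine ⟨((u * a) % m).toNat, ?_⟩
    have h0 : 0 ≤ (u * a) % (m : ℤ) := Int.emod_nonneg _ (by exact_mod_cast hm0)
    rw [Int.toNat_of_nonneg h0]
    have h1 := Int.emod_add_mul_ediv (u * a) m
    refine ⟨-(w * a) - 4 * ((u * a) / m), ?_⟩
    linear_combination 4 * h1 + a * huw
  have hmdvd : (m : ℤ) ∣ ∏ j ∈ Finset.range n, (4 * (j : ℤ) + a) := by
    have h1 : (∏ j ∈ Finset.range n, (4 * (j : ℤ) + a)) ≡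
        (∏ j ∈ Finset.range n, (4 * ((b : ℤ) + j))) [ZMOD m] := by
      refine Int.ModEq.prod fun j _ => ?_
      rw [Int.modEq_iff_dvd]
      convert hb using 1; ring
    have h2 : (m : ℤ) ∣ ∏ j ∈ Finset.range n, (4 * ((b : ℤ) + j)) := by
      rw [Finset.prod_mul_distrib]
      refine Dvd.dvd.mul_left ?_ _
      have h3 : n.factorial ∣ b.ascFactorial n := Nat.factorial_dvd_ascFactorial b n
      rw [Nat.ascFactorial_eq_prod_range] at h3
      have h4 : m ∣ n.factorial := ⟨2 ^ v, by rw [← hmul]; ring⟩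
      exact_mod_cast h4.trans h3
    exact (Int.ModEq.dvd_iff h1).2 h2
  have : (n.factorial : ℤ) = 2 ^ v * m := by exact_mod_cast hmul.symm
  rw [this]
  exact mul_dvd_mul (pow_dvd_pow 2 hvn) hmdvd

lemma prod_erase_eq (n k : ℕ) (hk : k ≤ n) :
    ∏ j ∈ (Finset.range (n + 1)).erase k, ((j : ℤ) - k) =
      (-1) ^ k * (k.factorial * (n - k).factorial : ℕ) := by
  have h1 : (Finset.range (n + 1)).erase k =
      Finset.range k ∪ (Finset.range (n - k)).image (fun i => k + 1 + i) := by
    ext x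
    simp only [Finset.mem_erase, Finset.mem_range, Finset.mem_union, Finset.mem_image]
    constructor
    · rintro ⟨h1, h2⟩
      by_cases h : x < k
      · exact Or.inl h
      · exact Or.inr ⟨x - k - 1, by omega, by omega⟩
    · rintro (h | ⟨i, h1, h2⟩) <;> constructor <;> omega
  rw [h1, Finset.prod_union, Finset.prod_image (by intro a _ b _ h; simpa using h)]
  · have e1 : ∏ j ∈ Finset.range k, ((j : ℤ) - k) = (-1) ^ k * k.factorial := by
      rw [← Finset.prod_range_reflect]
      have : ∀ j ∈ Finset.range k, (((k - 1 - j : ℕ) : ℤ) - k) = (-1) * ((j + 1 : ℕ) : ℤ) := by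
        intro j hj
        have := Finset.mem_range.1 hj
        push_cast [Nat.sub_sub, Nat.cast_sub (show 1 + j ≤ k by omega)]
        ring
      rw [Finset.prod_congr rfl this, Finset.prod_mul_distrib, Finset.prod_const, Finset.card_range,
        ← Nat.cast_prod, Finset.prod_range_add_one_eq_factorial]
    have e2 : ∏ j ∈ Finset.range (n - k), (((k + 1 + j : ℕ) : ℤ) - k) = (n - k).factorial := by
      rw [← Finset.prod_range_add_one_eq_factorial, Nat.cast_prod]
      refine Finset.prod_congr rfl fun j _ => ?_
      push_cast; ring
    rw [e1, e2]; push_cast; ring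
  · rw [Finset.disjoint_left]
    intro x hx hx'
    simp only [Finset.mem_range, Finset.mem_image] at hx hx'
    obtain ⟨i, _, h⟩ := hx'
    omega

/-- integer brick value -/
lemma brick_int (n k : ℕ) (r : ℤ) (hk : k ≤ n) :
    ∃ z : ℤ, 2 ^ n * ∏ j ∈ Finset.range n, (4 * ((j : ℤ) - k) + r) =
      z * ∏ j ∈ (Finset.range (n + 1)).erase k, ((j : ℤ) - k) := by
  obtain ⟨z, hz⟩ := two_pow_prod_dvd n (r - 4 * k)
  refine ⟨(-1) ^ k * (z * n.choose k), ?_⟩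
  have h2 : ∏ j ∈ Finset.range n, (4 * ((j : ℤ) - k) + r) =
     ∏ j ∈ Finset.range n, (4 * (j : ℤ) + (r - 4 * k)) :=
    Finset.prod_congr rfl fun j _ => by ring
  rw [h2, hz, prod_erase_eq n k hk, ← Nat.choose_mul_factorial_mul_factorial hk]
  have : ((-1 : ℤ) ^ k) * (-1) ^ k = 1 := by rw [← mul_pow]; simp
  push_cast
  linear_combination (-(z * n.choose k * k.factorial * (n - k).factorial)) * this

lemma q_pow_dvd (q n k k1 l1 : ℕ) (r j0 : ℤ) (hq : 0 < q) (h : (q : ℤ) ∣ 4 * j0 + r)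
    (h1 : -(k : ℤ) ≤ j0 - k1 * q) (h2 : j0 + l1 * q < n - k) :
    (q : ℤ) ^ (k1 + l1 + 1) ∣ ∏ j ∈ Finset.range n, (4 * ((j : ℤ) - k) + r) := by
  let f : ℕ → ℕ := fun i => (j0 + ((i : ℤ) - k1) * q + k).toNat
  have hf : ∀ i, ((f i : ℕ) : ℤ) = j0 + ((i : ℤ) - k1) * q + k := by
    intro i
    refine Int.toNat_of_nonneg ?_
    have : 0 ≤ (i : ℤ) * q := by positivity
    linarith
  have hinj : Set.InjOn f (Finset.range (k1 + l1 + 1)) := by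
    intro a _ b _ hab
    have := congrArg (fun x : ℕ => (x : ℤ)) hab
    simp only [hf] at this
    have h3 : ((a : ℤ) - b) * q = 0 := by linarith
    rcases mul_eq_zero.1 h3 with h4 | h4
    · omega
    · omega
  have hsub : (Finset.range (k1 + l1 + 1)).image f ⊆ Finset.range n := by
    intro x hx
    obtain ⟨i, hi, rfl⟩ := Finset.mem_image.1 hx
    have hi' : i ≤ k1 + l1 := by have := Finset.mem_range.1 hi; omega
    rw [Finset.mem_range]
    have : ((f i : ℕ) : ℤ) < n := by
      rw [hf]
      have : (i : ℤ) * q ≤ (k1 + l1) * q := by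
        have : (i : ℤ) ≤ k1 + l1 := by exact_mod_cast hi'
        exact mul_le_mul_of_nonneg_right this (by positivity)
      linarith
    exact_mod_cast this
  refine dvd_trans ?_ (Finset.prod_dvd_prod_of_subset _ _ _ hsub)
  rw [Finset.prod_image hinj]
  have : (q : ℤ) ^ (k1 + l1 + 1) = ∏ i ∈ Finset.range (k1 + l1 + 1), (q : ℤ) := by simp
  rw [this]
  refine Finset.prod_dvd_prod_of_dvd _ _ fun i _ => ?_
  rw [hf]
  obtain ⟨c, hc⟩ := h
  exact ⟨c + 4 * (i - k1), by linear_combination hc⟩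

lemma val_fact (q k : ℕ) (hq : q.Prime) (hk : k < q ^ 2) : ¬ q ^ (k / q + 1) ∣ k.factorial := by
  have : Fact q.Prime := ⟨hq⟩
  rw [padicValNat_dvd_iff_le (Nat.factorial_ne_zero k),
    padicValNat_factorial (b := 2) (Nat.log_lt_of_lt_pow' (by simp) hk)]
  simp

lemma q_dvd_cancel (q n k : ℕ) (r z : ℤ) (hk : k ≤ n) (hq : q.Prime) (hq2 : 2 < q) (hn : n < q ^ 2)
    (hz : 2 ^ n * ∏ j ∈ Finset.range n, (4 * ((j : ℤ) - k) + r) =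
      z * ∏ j ∈ (Finset.range (n + 1)).erase k, ((j : ℤ) - k))
    (h : (q : ℤ) ^ (k / q + (n - k) / q + 1) ∣ ∏ j ∈ Finset.range n, (4 * ((j : ℤ) - k) + r)) :
    (q : ℤ) ∣ z := by
  have hf : Fact q.Prime := ⟨hq⟩
  by_contra hzq
  have h1 : (q : ℤ) ^ (k / q + (n - k) / q + 1) ∣ z * ((-1) ^ k * (k.factorial * (n - k).factorial : ℕ)) := by
    rw [← prod_erase_eq n k hk, ← hz]; exact h.mul_left _
  have hqp : Prime (q : ℤ) := Nat.prime_iff_prime_int.1 hq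
  have h2 := hqp.pow_dvd_of_dvd_mul_left _ hzq h1
  have h3 : (q : ℤ) ^ (k / q + (n - k) / q + 1) ∣ ((k.factorial * (n - k).factorial : ℕ) : ℤ) := by
    refine h2.trans (Dvd.intro_left ((-1) ^ k) ?_)
    rw [← mul_assoc, ← mul_pow]; simp
  have h4 : q ^ (k / q + (n - k) / q + 1) ∣ k.factorial * (n - k).factorial := by exact_mod_cast h3
  rw [padicValNat_dvd_iff_le (by positivity), padicValNat.mul (by positivity) (by positivity)] at h4
  have h5 := val_fact q k hq (by omega)
  have h6 := val_fact q (n - k) hq (by omega)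
  rw [padicValNat_dvd_iff_le (by positivity)] at h5 h6
  omega

lemma q_dvd_one_of (q n k : ℕ) (z1 z3 : ℤ) (hk : k ≤ n) (hq : q.Prime) (hq2 : 2 < q) (hn : n < q ^ 2)
    (hmod : q < 2 * (n % q))
    (hz1 : 2 ^ n * ∏ j ∈ Finset.range n, (4 * ((j : ℤ) - k) + 1) =
      z1 * ∏ j ∈ (Finset.range (n + 1)).erase k, ((j : ℤ) - k))
    (hz3 : 2 ^ n * ∏ j ∈ Finset.range n, (4 * ((j : ℤ) - k) + 3) =
      z3 * ∏ j ∈ (Finset.range (n + 1)).erase k, ((j : ℤ) - k)) :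
    (q : ℤ) ∣ z1 * z3 := by
  have hq0 : 0 < q := hq.pos
  have ek := Nat.mod_add_div k q
  have el := Nat.mod_add_div (n - k) q
  have hle : n % q ≤ k % q + (n - k) % q := by
    have : n % q = (k % q + (n - k) % q) % q := by
      rw [← Nat.add_mod]; congr 1; omega
    rw [this]; exact Nat.mod_le _ _
  have hodd : q % 2 = 1 := (hq.eq_two_or_odd).resolve_left (by omega)
  set k1 := k / q
  set l1 := (n - k) / q
  set rk := k % q
  set rl := (n - k) % q
  have ek' : (k : ℤ) = rk + k1 * q := by
    have : ((rk + q * k1 : ℕ) : ℤ) = k := by rw [ek]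
    push_cast at this; linarith
  have el' : (n : ℤ) - k = rl + l1 * q := by
    have : ((rl + q * l1 : ℕ) : ℤ) = (n - k : ℕ) := by rw [el]
    push_cast [hk] at this; linarith
  have key : ∀ j0 : ℤ, -(rk : ℤ) ≤ j0 → j0 < rl → ((q : ℤ) ∣ 4 * j0 + 1 ∨ (q : ℤ) ∣ 4 * j0 + 3) →
      (q : ℤ) ∣ z1 * z3 := by
    intro j0 ha hb hor
    rcases hor with h | h
    · exact (q_dvd_cancel q n k 1 z1 hk hq hq2 hn hz1
        (q_pow_dvd q n k k1 l1 1 j0 hq0 h (by linarith) (by linarith))).mul_right _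
    · exact (q_dvd_cancel q n k 3 z3 hk hq hq2 hn hz3
        (q_pow_dvd q n k k1 l1 3 j0 hq0 h (by linarith) (by linarith))).mul_left _
  rcases (by omega : q < 4 * rk ∨ q < 4 * rl) with h | h
  · rcases (by omega : q % 4 = 1 ∨ q % 4 = 3) with h4 | h4
    · refine key (-(((q + 3) / 4 : ℕ) : ℤ)) (by omega) (by omega) (Or.inr ⟨-1, by omega⟩)
    · refine key (-(((q + 1) / 4 : ℕ) : ℤ)) (by omega) (by omega) (Or.inl ⟨-1, by omega⟩)
  · rcases (by omega : q % 4 = 1 ∨ q % 4 = 3) with h4 | h4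
    · refine key (((q / 4 : ℕ) : ℤ)) (by omega) (by omega) (Or.inl ⟨1, by omega⟩)
    · refine key (((q / 4 : ℕ) : ℤ)) (by omega) (by omega) (Or.inr ⟨1, by omega⟩)

/-- Taylor expansion of a polynomial at `t0`, as a power series. -/
noncomputable def tay (t0 : ℚ) : Polynomial ℚ →ₐ[ℚ] ℚ⟦X⟧ := Polynomial.aeval (X + C t0)

lemma tay_lin (t0 c : ℚ) : tay t0 (Polynomial.X + Polynomial.C c) = X + C (c + t0) := by
  rw [map_add, tay, Polynomial.aeval_X, Polynomial.aeval_C, map_add]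
  change X + C t0 + C c = _
  ring

lemma tay_C (t0 c : ℚ) : tay t0 (Polynomial.C c) = C c := by
  rw [tay, Polynomial.aeval_C]; rfl

/-- The polynomial `(t)_{n+1}^M / (t+k)^i`. -/
noncomputable def Tpol (n M i k : ℕ) : Polynomial ℚ :=
  (Polynomial.X + Polynomial.C (k : ℚ)) ^ (M - i) *
    (∏ j ∈ (Finset.range (n + 1)).erase k, (Polynomial.X + Polynomial.C (j : ℚ))) ^ M

lemma poly_identity (n M : ℕ) (N : Polynomial ℚ) (F : ℚ → ℚ) (a : ℕ → ℕ → ℚ)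
    (hF : ∀ t, F t = N.eval t / poch t (n + 1) ^ M)
    (ha : ∀ t : ℚ, (∀ k : ℕ, k ≤ n → t + (k : ℚ) ≠ 0) →
          F t = ∑ i ∈ Finset.Icc 1 M, ∑ k ∈ Finset.range (n + 1), a i k / (t + (k : ℚ)) ^ i) :
    N = ∑ i ∈ Finset.Icc 1 M, ∑ k ∈ Finset.range (n + 1), Polynomial.C (a i k) * Tpol n M i k := by
  refine Polynomial.eq_of_infinite_eval_eq _ _ ((Set.Ioi_infinite (0 : ℚ)).mono ?_)
  intro t ht
  have ht : 0 < t := ht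
  have hne : ∀ k : ℕ, t + (k : ℚ) ≠ 0 := fun k => by positivity
  have h1 := ha t fun k _ => hne k
  have hp : poch t (n + 1) ≠ 0 := Finset.prod_ne_zero_iff.2 fun k _ => hne k
  rw [hF, div_eq_iff (pow_ne_zero _ hp), Finset.sum_mul] at h1
  show N.eval t = Polynomial.eval t _
  rw [h1, Polynomial.eval_finsetSum]
  refine Finset.sum_congr rfl fun i hi => ?_
  rw [Polynomial.eval_finsetSum, Finset.sum_mul]
  refine Finset.sum_congr rfl fun k hk => ?_
  rw [Tpol, Polynomial.eval_mul, Polynomial.eval_mul, Polynomial.eval_pow, Polynomial.eval_pow,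
    Polynomial.eval_prod]
  simp only [Polynomial.eval_add, Polynomial.eval_X, Polynomial.eval_C]
  rw [poch, ← Finset.mul_prod_erase _ _ hk, mul_pow]
  have hiM : i ≤ M := (Finset.mem_Icc.1 hi).2
  have : (t + (k : ℚ)) ^ M = (t + k) ^ i * (t + k) ^ (M - i) := by
    rw [← pow_add]; congr 1; omega
  rw [this]
  have := hne k
  field_simp

lemma vanish (n M s : ℕ) (N : Polynomial ℚ) (a : ℕ → ℕ → ℚ) (t0 : ℚ)
    (hN : N = ∑ i ∈ Finset.Icc 1 M, ∑ k ∈ Finset.range (n + 1), Polynomial.C (a i k) * Tpol n M i k)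
    (hc : ∀ k : ℕ, (k : ℚ) + t0 ≠ 0) (hdvd : (X : ℚ⟦X⟧) ^ (s + 2) ∣ tay t0 N) :
    ∑ i ∈ Finset.Icc 1 M, ∑ k ∈ Finset.range (n + 1),
      poch (i : ℚ) (s + 1) * a i k / ((k : ℚ) + t0) ^ (i + s + 1) = 0 := by
  set I : ℕ → ℚ⟦X⟧ := fun k => (X + C ((k : ℚ) + t0))⁻¹ with hI
  have hmul : ∀ k : ℕ, (X + C ((k : ℚ) + t0)) * I k = 1 := fun k =>
    PowerSeries.mul_inv_cancel _ (by simpa using hc k)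
  have h1 : tay t0 N * (∏ j ∈ Finset.range (n + 1), I j) ^ M =
      ∑ i ∈ Finset.Icc 1 M, ∑ k ∈ Finset.range (n + 1), C (a i k) * I k ^ i := by
    rw [hN, map_sum, Finset.sum_mul]
    refine Finset.sum_congr rfl fun i hi => ?_
    rw [map_sum, Finset.sum_mul]
    refine Finset.sum_congr rfl fun k hk => ?_
    rw [map_mul, tay_C, Tpol, map_mul, map_pow, map_pow, map_prod, tay_lin]
    simp only [tay_lin]
    rw [← Finset.mul_prod_erase _ _ hk, mul_pow]
    have hiM : i ≤ M := (Finset.mem_Icc.1 hi).2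
    have e1 : I k ^ M = I k ^ (M - i) * I k ^ i := by rw [← pow_add]; congr 1; omega
    have e2 : (∏ j ∈ (Finset.range (n + 1)).erase k, (X + C ((j : ℚ) + t0))) ^ M *
        (∏ j ∈ (Finset.range (n + 1)).erase k, I j) ^ M = 1 := by
      rw [← mul_pow, ← Finset.prod_mul_distrib, Finset.prod_eq_one (fun j _ => hmul j), one_pow]
    have e3 : (X + C ((k : ℚ) + t0)) ^ (M - i) * I k ^ (M - i) = 1 := by
      rw [← mul_pow, hmul, one_pow]
    rw [e1]
    calc _ = C (a i k) * I k ^ i * ((X + C ((k : ℚ) + t0)) ^ (M - i) * I k ^ (M - i)) *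
          ((∏ j ∈ (Finset.range (n + 1)).erase k, (X + C ((j : ℚ) + t0))) ^ M *
        (∏ j ∈ (Finset.range (n + 1)).erase k, I j) ^ M) := by ring
      _ = _ := by rw [e2, e3]; ring
  have h2 := (PowerSeries.X_pow_dvd_iff.1 (hdvd.mul_right ((∏ j ∈ Finset.range (n + 1), I j) ^ M)))
    (s + 1) (by omega)
  rw [h1, map_sum] at h2
  have h3 : ∑ i ∈ Finset.Icc 1 M, ∑ k ∈ Finset.range (n + 1),
      poch (i : ℚ) (s + 1) * a i k / ((k : ℚ) + t0) ^ (i + s + 1) =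
      (∑ i ∈ Finset.Icc 1 M, coeff (s + 1) (∑ k ∈ Finset.range (n + 1), C (a i k) * I k ^ i)) *
        ((s + 1).factorial * (-1) ^ (s + 1)) := by
    rw [Finset.sum_mul]
    refine Finset.sum_congr rfl fun i hi => ?_
    rw [map_sum, Finset.sum_mul]
    refine Finset.sum_congr rfl fun k hk => ?_
    rw [coeff_C_mul]
    have h4 := coeff_inv_pow _ (hc k) i (s + 1) (Finset.mem_Icc.1 hi).1
    have h5 : ((-1 : ℚ)) ^ (s + 1) * (-1) ^ (s + 1) = 1 := by rw [← mul_pow]; simp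
    calc poch (i : ℚ) (s + 1) * a i k / ((k : ℚ) + t0) ^ (i + s + 1)
        = a i k * ((-1) ^ (s + 1) * (∏ l ∈ Finset.range (s + 1), ((i : ℚ) + l)) /
            ((k : ℚ) + t0) ^ (i + (s + 1))) * (-1) ^ (s + 1) := by
          rw [poch, add_assoc]
          linear_combination (-(a i k * (∏ l ∈ Finset.range (s + 1), ((i : ℚ) + l)) /
            ((k : ℚ) + t0) ^ (i + (s + 1)))) * h5
      _ = _ := by rw [← h4]; ring
  rw [h3, h2, zero_mul]

/-- the denominator product at `-k0` without the vanishing factor -/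
noncomputable def Dps (n k0 : ℕ) : ℚ⟦X⟧ :=
  ∏ j ∈ (Finset.range (n + 1)).erase k0, (X + C ((j : ℚ) - k0))

lemma Dps_ne (n k0 : ℕ) : constantCoeff (Dps n k0) ≠ 0 := by
  rw [Dps, map_prod]
  refine Finset.prod_ne_zero_iff.2 fun j hj => ?_
  have := Finset.ne_of_mem_erase hj
  simpa [sub_eq_zero] using this

lemma coeff_extract (n M k0 i0 : ℕ) (hk0 : k0 ≤ n) (hi0 : i0 ∈ Finset.Icc 1 M)
    (N : Polynomial ℚ) (a : ℕ → ℕ → ℚ)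
    (hN : N = ∑ i ∈ Finset.Icc 1 M, ∑ k ∈ Finset.range (n + 1), Polynomial.C (a i k) * Tpol n M i k) :
    coeff (M - i0) (tay (-(k0 : ℚ)) N * (Dps n k0)⁻¹ ^ M) = a i0 k0 := by
  have hi0' := Finset.mem_Icc.1 hi0
  have hmem : k0 ∈ Finset.range (n + 1) := Finset.mem_range.2 (by omega)
  have h1 : ∀ i k, k ≠ k0 → k ∈ Finset.range (n + 1) → X ^ M ∣ tay (-(k0 : ℚ)) (Tpol n M i k) := by
    intro i k hk _
    rw [Tpol, map_mul, map_pow, map_pow, map_prod]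
    refine Dvd.dvd.mul_left (pow_dvd_pow_of_dvd ?_ _) _
    have : k0 ∈ (Finset.range (n + 1)).erase k := Finset.mem_erase.2 ⟨hk.symm, hmem⟩
    refine dvd_trans ?_ (Finset.dvd_prod_of_mem _ this)
    rw [tay_lin]; simp
  have h2 : ∀ i, tay (-(k0 : ℚ)) (Tpol n M i k0) = X ^ (M - i) * Dps n k0 ^ M := by
    intro i
    rw [Tpol, map_mul, map_pow, map_pow, map_prod, tay_lin, Dps]
    simp only [tay_lin, sub_eq_add_neg]
    simp
  rw [hN, map_sum, Finset.sum_mul, map_sum, Finset.sum_eq_single i0]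
  · rw [map_sum, Finset.sum_mul, map_sum, Finset.sum_eq_single k0]
    · rw [map_mul (tay _), tay_C, h2, mul_assoc, mul_assoc, ← mul_pow,
        PowerSeries.mul_inv_cancel _ (Dps_ne n k0), one_pow, mul_one, coeff_C_mul, coeff_X_pow]
      simp
    · intro k hk hne
      have h3 : X ^ M ∣ tay (-(k0 : ℚ)) (Polynomial.C (a i0 k) * Tpol n M i0 k) * (Dps n k0)⁻¹ ^ M := by
        rw [map_mul]
        exact ((h1 i0 k hne hk).mul_left _).mul_right _
      exact PowerSeries.X_pow_dvd_iff.1 h3 _ (by omega)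
    · intro h; exact absurd hmem h
  · intro i hi hne
    have hi' := Finset.mem_Icc.1 hi
    rw [map_sum, Finset.sum_mul, map_sum]
    refine Finset.sum_eq_zero fun k hk => ?_
    by_cases hkk : k = k0
    · subst hkk
      rw [map_mul (tay _), tay_C, h2, mul_assoc, mul_assoc, ← mul_pow,
        PowerSeries.mul_inv_cancel _ (Dps_ne n k), one_pow, mul_one, coeff_C_mul, coeff_X_pow,
        if_neg (by omega), mul_zero]
    · have h3 : X ^ M ∣ tay (-(k0 : ℚ)) (Polynomial.C (a i k) * Tpol n M i k) * (Dps n k0)⁻¹ ^ M := by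
        rw [map_mul]
        exact ((h1 i k hkk hk).mul_left _).mul_right _
      exact PowerSeries.X_pow_dvd_iff.1 h3 _ (by omega)
  · intro h; exact absurd hi0 h

/-- numerator polynomial `2^{3n} (t+r/4)_n` -/
noncomputable def Npol (n r : ℕ) : Polynomial ℚ :=
  Polynomial.C (2 ^ (3 * n)) * ∏ j ∈ Finset.range n, (Polynomial.X + Polynomial.C ((r : ℚ) / 4 + j))

/-- brick -/
noncomputable def brick (n r k0 : ℕ) : ℚ⟦X⟧ := tay (-(k0 : ℚ)) (Npol n r) * (Dps n k0)⁻¹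

lemma Npol_eval (n r : ℕ) (t : ℚ) : (Npol n r).eval t = 2 ^ (3 * n) * poch (t + r / 4) n := by
  rw [Npol, Polynomial.eval_mul, Polynomial.eval_prod, poch]
  simp [add_assoc]

lemma Npol_val (n r k : ℕ) (z : ℤ)
    (hz : 2 ^ n * ∏ j ∈ Finset.range n, (4 * ((j : ℤ) - k) + r) =
      z * ∏ j ∈ (Finset.range (n + 1)).erase k, ((j : ℤ) - k)) :
    (Npol n r).eval (-(k : ℚ)) = z * ∏ j ∈ (Finset.range (n + 1)).erase k, ((j : ℚ) - k) := by
  have h : (2 : ℚ) ^ n * ∏ j ∈ Finset.range n, (4 * ((j : ℚ) - k) + r) =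
      z * ∏ j ∈ (Finset.range (n + 1)).erase k, ((j : ℚ) - k) := by exact_mod_cast hz
  rw [← h, Npol_eval, poch]
  have : ∏ j ∈ Finset.range n, (4 * ((j : ℚ) - k) + r) =
      4 ^ n * ∏ j ∈ Finset.range n, (-(k : ℚ) + r / 4 + j) := by
    have h4 : (4 : ℚ) ^ n = ∏ j ∈ Finset.range n, (4 : ℚ) := by simp
    rw [h4, ← Finset.prod_mul_distrib]
    exact Finset.prod_congr rfl fun j _ => by ring
  rw [this, pow_mul, ← mul_assoc, ← mul_pow]
  norm_num

lemma lagrange_brick (n : ℕ) (P : Polynomial ℚ) (hP : P.degree < (n + 1 : ℕ)) (z : ℕ → ℚ)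
    (hz : ∀ k ∈ Finset.range (n + 1),
      P.eval (-(k : ℚ)) = z k * ∏ j ∈ (Finset.range (n + 1)).erase k, ((j : ℚ) - k)) :
    P = ∑ k ∈ Finset.range (n + 1), Polynomial.C (z k) *
      ∏ j ∈ (Finset.range (n + 1)).erase k, (Polynomial.X + Polynomial.C (j : ℚ)) := by
  have h := Lagrange.eq_interpolate (s := Finset.range (n + 1)) (v := fun k : ℕ => -(k : ℚ)) (f := P)
    (by intro a _ b _ h; simpa using h) (by simpa using hP)
  rw [Lagrange.interpolate_apply] at h
  refine h.trans (Finset.sum_congr rfl fun k hk => ?_)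
  rw [Lagrange.basis]
  simp only [Lagrange.basisDivisor]
  rw [Finset.prod_mul_distrib, ← map_prod, ← mul_assoc, ← map_mul, hz k hk, mul_assoc,
    ← Finset.prod_mul_distrib, Finset.prod_eq_one, mul_one]
  · congr 1
    refine Finset.prod_congr rfl fun j _ => ?_
    simp
  · intro j hj
    have : (j : ℚ) - k ≠ 0 := by
      rw [sub_ne_zero]; exact_mod_cast Finset.ne_of_mem_erase hj
    rw [show -(k : ℚ) - -(j : ℚ) = j - k by ring, mul_inv_cancel₀ this]

lemma Npol_degree (n r : ℕ) : (Npol n r).degree < (n + 1 : ℕ) := by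
  rw [Npol, Polynomial.degree_C_mul (by positivity), Polynomial.degree_prod]
  simp only [Polynomial.degree_X_add_C]
  simp
  exact_mod_cast Nat.lt_succ_self n

lemma brick_mem {R : Subring ℚ} (n r k0 : ℕ) (hk0 : k0 ≤ n) (d : ℚ)
    (hd : ∀ e : ℤ, e ≠ 0 → |e| ≤ n → d / e ∈ R) :
    rescale d (brick n r k0) ∈ PSR R := by
  have hmem : k0 ∈ Finset.range (n + 1) := Finset.mem_range.2 (by omega)
  have hex : ∀ k : ℕ, ∃ z : ℤ, k ∈ Finset.range (n + 1) →
      (Npol n r).eval (-(k : ℚ)) = z * ∏ j ∈ (Finset.range (n + 1)).erase k, ((j : ℚ) - k) := by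
    intro k
    by_cases hk : k ≤ n
    · obtain ⟨z, hz⟩ := brick_int n k r hk
      exact ⟨z, fun _ => Npol_val n r k z hz⟩
    · exact ⟨0, fun h => absurd (Finset.mem_range.1 h) (by omega)⟩
  choose z hz using hex
  have hP := lagrange_brick n (Npol n r) (Npol_degree n r) (fun k => (z k : ℚ)) (fun k hk => hz k hk)
  rw [brick, hP, map_sum, Finset.sum_mul, map_sum]
  refine (PSR R).sum_mem fun k hk => ?_
  rw [map_mul (tay _), tay_C, mul_assoc, map_mul]
  have hC : rescale d (C (z k : ℚ)) = C (z k : ℚ) := by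
    ext m; rw [coeff_rescale, coeff_C]; split_ifs with h
    · simp [h]
    · simp
  rw [hC]
  refine (PSR R).mul_mem (C_mem_PSR (intCast_mem R _)) ?_
  rw [map_prod]
  simp only [tay_lin]
  by_cases hkk : k = k0
  · subst hkk
    have : ∏ j ∈ (Finset.range (n + 1)).erase k, (X + C ((j : ℚ) + -(k : ℚ))) = Dps n k := by
      simp only [Dps, sub_eq_add_neg]
    rw [this, PowerSeries.mul_inv_cancel _ (Dps_ne n k), map_one]
    exact (PSR R).one_mem
  · have hkk' : (k : ℚ) - k0 ≠ 0 := by rw [sub_ne_zero]; exact_mod_cast hkk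
    have e1 : ∏ j ∈ (Finset.range (n + 1)).erase k, (X + C ((j : ℚ) + -(k0 : ℚ))) =
        X * ∏ j ∈ ((Finset.range (n + 1)).erase k).erase k0, (X + C ((j : ℚ) - k0)) := by
      rw [← Finset.mul_prod_erase _ _ (Finset.mem_erase.2 ⟨fun h => hkk h.symm, hmem⟩)]
      simp [sub_eq_add_neg]
    have e2 : Dps n k0 = (X + C ((k : ℚ) - k0)) *
        ∏ j ∈ ((Finset.range (n + 1)).erase k).erase k0, (X + C ((j : ℚ) - k0)) := by
      rw [Dps, ← Finset.mul_prod_erase _ _ (Finset.mem_erase.2 ⟨hkk, hk⟩), Finset.erase_right_comm]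
    have hinv : (X + C ((k : ℚ) - k0)) * (X + C ((k : ℚ) - k0) : ℚ⟦X⟧)⁻¹ = 1 :=
      PowerSeries.mul_inv_cancel _ (by simpa using hkk')
    have e3 : (∏ j ∈ (Finset.range (n + 1)).erase k, (X + C ((j : ℚ) + -(k0 : ℚ)))) * (Dps n k0)⁻¹ =
        X * (X + C ((k : ℚ) - k0))⁻¹ := by
      symm
      rw [PowerSeries.eq_mul_inv_iff_mul_eq (Dps_ne n k0), e1, e2]
      linear_combination (X * ∏ j ∈ ((Finset.range (n + 1)).erase k).erase k0, (X + C ((j : ℚ) - k0))) * hinv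
    rw [e3]
    have hdR : d / ((k : ℚ) - k0) ∈ R := by
      have := hd ((k : ℤ) - k0) (by intro h; apply hkk; omega)
        (by have := Finset.mem_range.1 hk; rw [abs_le]; constructor <;> omega)
      push_cast at this; exact this
    have e4 : rescale d (X * (X + C ((k : ℚ) - k0))⁻¹) =
        C (d / ((k : ℚ) - k0)) * X * rescale d (C ((k : ℚ) - k0) * (X + C ((k : ℚ) - k0))⁻¹) := by
      have hC : rescale d (C ((k : ℚ) - k0)) = C ((k : ℚ) - k0) := by
        ext m; rw [coeff_rescale, coeff_C]; split_ifs with h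
        · simp [h]
        · simp
      rw [map_mul, map_mul, hC, rescale_X]
      have : (C d : ℚ⟦X⟧) = C (d / ((k : ℚ) - k0)) * C ((k : ℚ) - k0) := by
        rw [← map_mul, div_mul_cancel₀ _ hkk']
      rw [this]; ring
    rw [e4]
    exact (PSR R).mul_mem ((PSR R).mul_mem (C_mem_PSR hdR) X_mem_PSR)
      (resc_inv_mem d _ hkk' hdR)

lemma resc_C (d c : ℚ) : rescale d (C c) = C c := by
  ext m; rw [coeff_rescale, coeff_C]; split_ifs with h
  · simp [h]
  · simp

lemma brick_factor {R : Subring ℚ} (n r k0 : ℕ) (d : ℚ) (z : ℤ)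
    (hz : 2 ^ n * ∏ j ∈ Finset.range n, (4 * ((j : ℤ) - k0) + r) =
      z * ∏ j ∈ (Finset.range (n + 1)).erase k0, ((j : ℤ) - k0))
    (hne : ∀ j ∈ Finset.range n, (r : ℚ) / 4 + j + -(k0 : ℚ) ≠ 0)
    (hd : ∀ e : ℤ, e ≠ 0 → |e| ≤ n → d / e ∈ R) (hk0 : k0 ≤ n)
    (hc : ∀ j ∈ Finset.range n, d / ((r : ℚ) / 4 + j + -(k0 : ℚ)) ∈ R) :
    ∃ f ∈ PSR R, rescale d (brick n r k0) = C (z : ℚ) * f := by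
  set E := (Finset.range (n + 1)).erase k0 with hE
  set c : ℕ → ℚ := fun j => (r : ℚ) / 4 + j + -(k0 : ℚ) with hcdef
  set e : ℕ → ℚ := fun j => (j : ℚ) - k0 with hedef
  have hene : ∀ j ∈ E, e j ≠ 0 := by
    intro j hj
    have := Finset.ne_of_mem_erase hj
    rw [hedef]; simp only [ne_eq, sub_eq_zero]; exact_mod_cast this
  have hval := Npol_val n r k0 z hz
  have hval' : (2 : ℚ) ^ (3 * n) * ∏ j ∈ Finset.range n, c j = z * ∏ j ∈ E, e j := by
    rw [← hval, Npol_eval, poch]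
    congr 1
    exact Finset.prod_congr rfl fun j _ => by rw [hcdef]; ring
  have h1 : tay (-(k0 : ℚ)) (Npol n r) =
      C ((2 : ℚ) ^ (3 * n) * ∏ j ∈ Finset.range n, c j) *
        ∏ j ∈ Finset.range n, (1 + C (c j)⁻¹ * X) := by
    rw [Npol, map_mul, tay_C, map_prod, map_mul C, map_prod C, mul_assoc, ← Finset.prod_mul_distrib]
    congr 1
    refine Finset.prod_congr rfl fun j hj => ?_
    rw [tay_lin, mul_add, ← mul_assoc, ← map_mul, mul_inv_cancel₀ (hne j hj), map_one]
    ring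
  have h2 : C (∏ j ∈ E, e j) * (Dps n k0)⁻¹ = ∏ j ∈ E, (C (e j) * (X + C (e j))⁻¹) := by
    symm
    rw [PowerSeries.eq_mul_inv_iff_mul_eq (Dps_ne n k0), Dps, ← Finset.prod_mul_distrib, map_prod]
    refine Finset.prod_congr rfl fun j hj => ?_
    rw [mul_assoc, PowerSeries.inv_mul_cancel _ (by simpa using hene j hj), mul_one]
  refine ⟨(∏ j ∈ Finset.range n, rescale d (1 + C (c j)⁻¹ * X)) *
    ∏ j ∈ E, rescale d (C (e j) * (X + C (e j))⁻¹), ?_, ?_⟩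
  · refine (PSR R).mul_mem ((PSR R).prod_mem fun j hj => ?_) ((PSR R).prod_mem fun j hj => ?_)
    · rw [map_add, map_one, map_mul, resc_C, rescale_X, ← mul_assoc, ← map_mul]
      refine (PSR R).add_mem (PSR R).one_mem ((PSR R).mul_mem (C_mem_PSR ?_) X_mem_PSR)
      rw [mul_comm, ← div_eq_mul_inv]
      exact hc j hj
    · refine resc_inv_mem d _ (hene j hj) ?_
      have hj' := Finset.mem_erase.1 hj
      have := hd ((j : ℤ) - k0) (by intro h; apply hj'.1; omega)
        (by have := Finset.mem_range.1 hj'.2; rw [abs_le]; constructor <;> omega)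
      push_cast at this; exact this
  · rw [← map_prod, ← map_prod, ← h2, ← map_mul, ← resc_C d (z : ℚ), ← map_mul, brick, h1, hval']
    congr 1
    rw [map_mul]
    ring

lemma dvd_dlcm (n : ℕ) (e : ℤ) (h0 : e ≠ 0) (h : |e| ≤ n) : e ∣ (dlcm n : ℤ) := by
  have : e.natAbs ∣ dlcm n := by
    refine Finset.dvd_lcm (f := id) (Finset.mem_Icc.2 ⟨?_, ?_⟩)
    · exact Int.natAbs_pos.2 h0
    · have h1 : (e.natAbs : ℤ) ≤ n := by rw [Int.natCast_natAbs]; exact h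
      exact_mod_cast h1
  exact Int.dvd_natCast.2 this

lemma dlcm_div_mem (R : Subring ℚ) (n : ℕ) (e : ℤ) (h0 : e ≠ 0) (h : |e| ≤ n) :
    (dlcm n : ℚ) / e ∈ R := by
  obtain ⟨c, hc⟩ := dvd_dlcm n e h0 h
  have : (dlcm n : ℚ) / e = c := by
    have h1 : (dlcm n : ℚ) = e * c := by exact_mod_cast hc
    rw [h1, mul_div_cancel_left₀]
    exact_mod_cast h0
  rw [this]; exact intCast_mem R c

lemma quarter_div (p : ℕ) [Fact p.Prime] (d : ℕ) (z : ℤ) (x : ℚ) (hx : x = (z : ℚ) / 4) (hz : z ≠ 0)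
    (h : (d : ℚ) / x ∉ ZR p) : ∃ e : ℕ, (p : ℤ) ^ e ∣ z ∧ ¬ (p : ℤ) ^ e ∣ d := by
  by_contra hcon
  push Not at hcon
  have h1 := natdiv_mem_ZR p d z hz hcon
  apply h
  have : (d : ℚ) / x = (4 : ℕ) * ((d : ℚ) / z) := by
    rw [hx]
    have : (z : ℚ) ≠ 0 := by exact_mod_cast hz
    field_simp
    norm_num
  rw [this]
  exact (ZR p).mul_mem (natCast_mem (ZR p) 4) h1

lemma dichotomy (p : ℕ) [Fact p.Prime] (n m : ℕ) :
    (∀ k ∈ Finset.Icc m n, (dlcm n : ℚ) / ((k : ℚ) + (1/4 - m)) ∈ ZR p) ∨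
    (∀ k ∈ Finset.range m, m ≤ n → (dlcm n : ℚ) / ((k : ℚ) + (1/4 - m)) ∈ ZR p) := by
  by_contra hcon
  push Not at hcon
  obtain ⟨⟨k, hk, h1⟩, ⟨l, hl, hmn, h2⟩⟩ := hcon
  have hk' := Finset.mem_Icc.1 hk
  have hl' := Finset.mem_range.1 hl
  obtain ⟨e1, ha1, hb1⟩ := quarter_div p (dlcm n) (4 * ((k : ℤ) - m) + 1) _ (by push_cast; ring)
    (by omega) h1
  obtain ⟨e2, ha2, hb2⟩ := quarter_div p (dlcm n) (4 * ((l : ℤ) - m) + 1) _ (by push_cast; ring)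
    (by omega) h2
  have hmin : ¬ (p : ℤ) ^ (min e1 e2) ∣ (dlcm n : ℤ) := by
    rcases min_choice e1 e2 with h | h <;> rw [h] <;> assumption
  have ha1' : (p : ℤ) ^ (min e1 e2) ∣ 4 * ((k : ℤ) - m) + 1 :=
    (pow_dvd_pow _ (min_le_left _ _)).trans ha1
  have ha2' : (p : ℤ) ^ (min e1 e2) ∣ 4 * ((l : ℤ) - m) + 1 :=
    (pow_dvd_pow _ (min_le_right _ _)).trans ha2
  have hdiff : (p : ℤ) ^ (min e1 e2) ∣ 4 * ((k : ℤ) - l) := by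
    have h3 := dvd_sub ha1' ha2'
    have h4 : 4 * ((k : ℤ) - m) + 1 - (4 * ((l : ℤ) - m) + 1) = 4 * ((k : ℤ) - l) := by ring
    rwa [h4] at h3
  have hcop : IsCoprime ((p : ℤ) ^ (min e1 e2)) 4 := by
    refine IsCoprime.of_isCoprime_of_dvd_left ?_ ha1'
    exact ⟨1, -((k : ℤ) - m), by ring⟩
  exact hmin ((hcop.dvd_of_dvd_mul_left hdiff).trans
    (dvd_dlcm n _ (by omega) (by rw [abs_le]; constructor <;> omega)))

lemma sum_reorg (n : ℕ) (f : ℕ → ℕ → ℚ) :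
    ∑ k ∈ Finset.Icc 1 n, ∑ l ∈ Finset.range k, f k l =
      ∑ m ∈ Finset.Icc 1 n, ∑ k ∈ Finset.Icc m n, f k (k - m) := by
  rw [Finset.sum_sigma', Finset.sum_sigma']
  refine Finset.sum_bij' (fun x _ => ⟨x.1 - x.2, x.1⟩) (fun x _ => ⟨x.2, x.2 - x.1⟩) ?_ ?_ ?_ ?_ ?_
  · rintro ⟨k, l⟩ h
    simp only [Finset.mem_sigma, Finset.mem_Icc, Finset.mem_range] at h ⊢
    omega
  · rintro ⟨m, k⟩ h
    simp only [Finset.mem_sigma, Finset.mem_Icc, Finset.mem_range] at h ⊢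
    omega
  · rintro ⟨k, l⟩ h
    simp only [Finset.mem_sigma, Finset.mem_Icc, Finset.mem_range] at h
    simp only [Sigma.mk.injEq, heq_eq_eq, true_and]
    omega
  · rintro ⟨m, k⟩ h
    simp only [Finset.mem_sigma, Finset.mem_Icc, Finset.mem_range] at h
    simp only [Sigma.mk.injEq, heq_eq_eq, and_true]
    omega
  · rintro ⟨k, l⟩ h
    simp only [Finset.mem_sigma, Finset.mem_Icc, Finset.mem_range] at h
    simp only
    congr 1
    omega

lemma local_sum (p : ℕ) [Fact p.Prime] (n M s : ℕ) (a : ℕ → ℕ → ℚ) (K : ℚ)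
    (hcoef : ∀ i ∈ Finset.Icc 1 M, ∀ k ≤ n, K * ((dlcm n : ℚ) ^ (M - i) * a i k) ∈ ZR p)
    (hvan : ∀ m ∈ Finset.Icc 1 n, ∑ i ∈ Finset.Icc 1 M, ∑ k ∈ Finset.range (n + 1),
      poch (i : ℚ) (s + 1) * a i k / ((k : ℚ) + (1/4 - m)) ^ (i + s + 1) = 0) :
    K * ((dlcm n : ℚ) ^ (M + s + 1) * ((-1 : ℚ) ^ (s + 1) *
      ∑ i ∈ Finset.Icc 1 M, ∑ k ∈ Finset.Icc 1 n, ∑ ℓ ∈ Finset.range k,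
        poch (i : ℚ) (s + 1) * a i k / ((ℓ : ℚ) + 1/4) ^ (i + s + 1))) ∈ ZR p := by
  set d : ℚ := (dlcm n : ℚ) with hd
  have hpoch : ∀ i j : ℕ, poch (i : ℚ) j ∈ ZR p := by
    intro i j
    refine (ZR p).prod_mem fun l _ => (ZR p).add_mem (natCast_mem _ _) (natCast_mem _ _)
  have hterm : ∀ i ∈ Finset.Icc 1 M, ∀ k ≤ n, ∀ x : ℚ, d / x ∈ ZR p →
      K * (d ^ (M + s + 1) * (poch (i : ℚ) (s + 1) * a i k / x ^ (i + s + 1))) ∈ ZR p := by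
    intro i hi k hk x hx
    have hi' := Finset.mem_Icc.1 hi
    have e1 : d ^ (M + s + 1) = d ^ (M - i) * d ^ (i + s + 1) := by
      rw [← pow_add]; congr 1; omega
    have e2 : K * (d ^ (M + s + 1) * (poch (i : ℚ) (s + 1) * a i k / x ^ (i + s + 1))) =
        K * (d ^ (M - i) * a i k) * poch (i : ℚ) (s + 1) * (d / x) ^ (i + s + 1) := by
      rw [e1, div_pow]; ring
    rw [e2]
    exact (ZR p).mul_mem ((ZR p).mul_mem (hcoef i hi k hk) (hpoch _ _)) ((ZR p).pow_mem hx _)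
  have hre : ∑ i ∈ Finset.Icc 1 M, ∑ k ∈ Finset.Icc 1 n, ∑ ℓ ∈ Finset.range k,
        poch (i : ℚ) (s + 1) * a i k / ((ℓ : ℚ) + 1/4) ^ (i + s + 1) =
      ∑ m ∈ Finset.Icc 1 n, ∑ i ∈ Finset.Icc 1 M, ∑ k ∈ Finset.Icc m n,
        poch (i : ℚ) (s + 1) * a i k / ((k : ℚ) + (1/4 - m)) ^ (i + s + 1) := by
    rw [Finset.sum_comm (s := Finset.Icc 1 n)]
    refine Finset.sum_congr rfl fun i _ => ?_
    rw [sum_reorg n (fun k l => poch (i : ℚ) (s + 1) * a i k / ((l : ℚ) + 1/4) ^ (i + s + 1))]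
    refine Finset.sum_congr rfl fun m _ => Finset.sum_congr rfl fun k hk => ?_
    have := (Finset.mem_Icc.1 hk).1
    rw [Nat.cast_sub this]
    congr 2
    ring
  have hpull : ∀ s' : ℕ → Finset ℕ, ∀ f : ℕ → ℕ → ℚ,
      (∀ i ∈ Finset.Icc 1 M, ∀ k ∈ s' i, K * (d ^ (M + s + 1) * f i k) ∈ ZR p) →
      K * (d ^ (M + s + 1) * ∑ i ∈ Finset.Icc 1 M, ∑ k ∈ s' i, f i k) ∈ ZR p := by
    intro s' f h
    rw [Finset.mul_sum, Finset.mul_sum]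
    refine (ZR p).sum_mem fun i hi => ?_
    rw [Finset.mul_sum, Finset.mul_sum]
    exact (ZR p).sum_mem fun k hk => h i hi k hk
  rw [hre]
  have hm : ∀ m ∈ Finset.Icc 1 n, K * (d ^ (M + s + 1) * ∑ i ∈ Finset.Icc 1 M, ∑ k ∈ Finset.Icc m n,
        poch (i : ℚ) (s + 1) * a i k / ((k : ℚ) + (1/4 - m)) ^ (i + s + 1)) ∈ ZR p := by
    intro m hm
    have hm' := Finset.mem_Icc.1 hm
    rcases dichotomy p n m with h | h
    · refine hpull (fun _ => Finset.Icc m n) _ fun i hi k hk => ?_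
      exact hterm i hi k (Finset.mem_Icc.1 hk).2 _ (h k hk)
    · have h0 := hvan m hm
      have hsplit : ∀ g : ℕ → ℚ, ∑ k ∈ Finset.range (n + 1), g k =
          ∑ k ∈ Finset.range m, g k + ∑ k ∈ Finset.Icc m n, g k := by
        intro g
        have : Finset.Icc m n = Finset.Ico m (n + 1) := by ext; simp
        rw [this, Finset.sum_range_add_sum_Ico _ (by omega)]
      simp only [hsplit] at h0
      rw [Finset.sum_add_distrib] at h0
      rw [eq_neg_of_add_eq_zero_right h0, mul_neg, mul_neg]
      refine (ZR p).neg_mem (hpull (fun _ => Finset.range m) _ fun i hi k hk => ?_)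
      have := Finset.mem_range.1 hk
      exact hterm i hi k (by omega) _ (h k hk hm'.2)
  rw [Finset.mul_sum, Finset.mul_sum, Finset.mul_sum]
  refine (ZR p).sum_mem fun m hm1 => ?_
  have : ∀ S : ℚ, K * (d ^ (M + s + 1) * ((-1) ^ (s + 1) * S)) =
      (-1) ^ (s + 1) * (K * (d ^ (M + s + 1) * S)) := fun S => by ring
  rw [this]
  exact (ZR p).mul_mem ((ZR p).pow_mem ((ZR p).neg_mem (ZR p).one_mem) _) (hm m hm1)

lemma X_pow_dvd_Npol (n s m : ℕ) (hm : m ∈ Finset.Icc 1 n) (Y : Polynomial ℚ) :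
    (X : ℚ⟦X⟧) ^ (s + 2) ∣ tay (1/4 - (m : ℚ)) (Y * Npol n 3 ^ (s + 2)) := by
  have hm' := Finset.mem_Icc.1 hm
  rw [map_mul, map_pow]
  refine Dvd.dvd.mul_left (pow_dvd_pow_of_dvd ?_ _) _
  rw [Npol, map_mul, map_prod]
  refine Dvd.dvd.mul_left (dvd_trans ?_ (Finset.dvd_prod_of_mem _
    (Finset.mem_range.2 (show m - 1 < n by omega)))) _
  rw [tay_lin]
  have : ((3 : ℕ) : ℚ) / 4 + ((m - 1 : ℕ) : ℚ) + (1/4 - (m : ℚ)) = 0 := by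
    rw [Nat.cast_sub hm'.1]; push_cast; ring
  rw [this]; simp

lemma quarter_ne (k m : ℕ) : (k : ℚ) + (1/4 - (m : ℚ)) ≠ 0 := by
  intro h
  have h2 : (4 * (k : ℤ) + 1 - 4 * m : ℤ) = 0 := by
    have : (4 * (k : ℚ) + 1 - 4 * m) = 0 := by linarith
    exact_mod_cast this
  omega

/-- numerator for A -/
noncomputable def NA (s δ n : ℕ) : Polynomial ℚ :=
  (Polynomial.C 4 * Polynomial.X + Polynomial.C (2 * (n : ℚ))) ^ δ * Npol n 1 ^ (s + 2) *
    Npol n 3 ^ (s + 2)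

lemma Afun_eq (s δ n : ℕ) (t : ℚ) :
    Afun s δ n t = (NA s δ n).eval t / poch t (n + 1) ^ (2 * s + 4) := by
  rw [Afun, NA, Polynomial.eval_mul, Polynomial.eval_mul, Polynomial.eval_pow, Polynomial.eval_pow,
    Polynomial.eval_pow, Npol_eval, Npol_eval]
  simp only [Polynomial.eval_add, Polynomial.eval_mul, Polynomial.eval_C, Polynomial.eval_X]
  congr 1
  have : (2 : ℚ) ^ ((6 * s + 12) * n) = (2 ^ (3 * n)) ^ (s + 2) * (2 ^ (3 * n)) ^ (s + 2) := by
    rw [← pow_mul, ← pow_add]; congr 1; ring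
  rw [this]
  push_cast
  ring

lemma Bfun_eq (s n : ℕ) (t : ℚ) :
    Bfun s n t = (1 * Npol n 3 ^ (s + 2) : Polynomial ℚ).eval t / poch t (n + 1) ^ (s + 2) := by
  rw [Bfun, one_mul, Polynomial.eval_pow, Npol_eval]
  congr 1
  have : (2 : ℚ) ^ ((3 * s + 6) * n) = (2 ^ (3 * n)) ^ (s + 2) := by
    rw [← pow_mul]; congr 1; ring
  rw [this]
  push_cast
  ring

lemma coeff_mem_of (R : Subring ℚ) (K d : ℚ) (m : ℕ) (F f : ℚ⟦X⟧) (x : ℚ) (h : coeff m F = x)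
    (hf : f ∈ PSR R) (hF : C K * rescale d F = f) : K * (d ^ m * x) ∈ R := by
  have := hf m
  rw [← hF, coeff_C_mul, coeff_rescale, h] at this
  exact this

lemma b_int (R : Subring ℚ) (s n : ℕ) (b : ℕ → ℕ → ℚ)
    (hN : (1 * Npol n 3 ^ (s + 2) : Polynomial ℚ) = ∑ i ∈ Finset.Icc 1 (s + 2),
      ∑ k ∈ Finset.range (n + 1), Polynomial.C (b i k) * Tpol n (s + 2) i k)
    (i : ℕ) (hi : i ∈ Finset.Icc 1 (s + 2)) (k : ℕ) (hk : k ≤ n) :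
    1 * ((dlcm n : ℚ) ^ (s + 2 - i) * b i k) ∈ R := by
  refine coeff_mem_of R 1 (dlcm n) _ _ _ _ (coeff_extract n (s + 2) k i hk hi _ b hN) ?_ rfl
  rw [map_one, one_mul, one_mul, map_pow (tay _), ← mul_pow, map_pow]
  exact (PSR R).pow_mem (brick_mem n 3 k hk _ (fun e h0 h => dlcm_div_mem R n e h0 h)) _

lemma tay_NA (s δ n k : ℕ) : tay (-(k : ℚ)) (NA s δ n) * (Dps n k)⁻¹ ^ (2 * s + 4) =
    (C 4 * X + C (2 * (n : ℚ) - 4 * k)) ^ δ * (brick n 1 k * brick n 3 k) ^ (s + 2) := by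
  have h1 : tay (-(k : ℚ)) (Polynomial.C 4 * Polynomial.X + Polynomial.C (2 * (n : ℚ))) =
      C 4 * X + C (2 * (n : ℚ) - 4 * k) := by
    have h2 : (Polynomial.C 4 * Polynomial.X + Polynomial.C (2 * (n : ℚ)) : Polynomial ℚ) =
        Polynomial.C 4 * (Polynomial.X + Polynomial.C ((n : ℚ) / 2)) := by
      rw [mul_add, ← map_mul]; congr 2; ring
    rw [h2, map_mul, tay_C, tay_lin, mul_add, ← map_mul]
    congr 2; ring
  rw [NA, map_mul, map_mul, map_pow, map_pow, map_pow, h1, brick, brick]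
  ring

lemma a_int (R : Subring ℚ) (s δ n : ℕ) (a : ℕ → ℕ → ℚ) (K : ℚ)
    (hN : NA s δ n = ∑ i ∈ Finset.Icc 1 (2 * s + 4),
      ∑ k ∈ Finset.range (n + 1), Polynomial.C (a i k) * Tpol n (2 * s + 4) i k)
    (hK : ∀ k ≤ n, ∃ f ∈ PSR R, rescale (dlcm n : ℚ) (brick n 1 k * brick n 3 k) = C K * f)
    (hK0 : K ≠ 0)
    (i : ℕ) (hi : i ∈ Finset.Icc 1 (2 * s + 4)) (k : ℕ) (hk : k ≤ n) :
    (K ^ (s + 2))⁻¹ * ((dlcm n : ℚ) ^ (2 * s + 4 - i) * a i k) ∈ R := by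
  obtain ⟨f, hf, hKf⟩ := hK k hk
  refine coeff_mem_of R _ (dlcm n) _ _ ((C 4 * (C (dlcm n : ℚ) * X) + C (2 * (n : ℚ) - 4 * k)) ^ δ *
    f ^ (s + 2)) _ (coeff_extract n (2 * s + 4) k i hk hi _ a hN) ?_ ?_
  · refine (PSR R).mul_mem ((PSR R).pow_mem ((PSR R).add_mem ((PSR R).mul_mem (C_mem_PSR ?_)
      ((PSR R).mul_mem (C_mem_PSR (natCast_mem R _)) X_mem_PSR)) (C_mem_PSR ?_)) _)
      ((PSR R).pow_mem hf _)
    · exact_mod_cast natCast_mem R 4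
    · have := intCast_mem R (2 * (n : ℤ) - 4 * k)
      push_cast at this; exact this
  · rw [tay_NA, map_mul (rescale _), map_pow (rescale _), map_pow (rescale _), hKf, map_add, map_mul (rescale _),
      resc_C, resc_C, rescale_X, mul_pow (C K), ← map_pow C]
    have : (C (K ^ (s + 2))⁻¹ * C (K ^ (s + 2)) : ℚ⟦X⟧) = 1 := by
      rw [← map_mul, inv_mul_cancel₀ (pow_ne_zero _ hK0), map_one]
    linear_combination ((C 4 * (C (dlcm n : ℚ) * X) + C (2 * (n : ℚ) - 4 * k)) ^ δ *
      f ^ (s + 2)) * this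

lemma bricks_one (R : Subring ℚ) (n k : ℕ) (hk : k ≤ n) :
    ∃ f ∈ PSR R, rescale (dlcm n : ℚ) (brick n 1 k * brick n 3 k) = C 1 * f := by
  refine ⟨_, ?_, by rw [map_one, one_mul]⟩
  rw [map_mul]
  exact (PSR R).mul_mem (brick_mem n 1 k hk _ (fun e h0 h => dlcm_div_mem R n e h0 h))
    (brick_mem n 3 k hk _ (fun e h0 h => dlcm_div_mem R n e h0 h))

lemma bricks_q (q : ℕ) [hq : Fact q.Prime] (n k : ℕ) (hk : k ≤ n) (hqn : q ≤ n) (hq2 : 10 * n < q ^ 2)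
    (hmod : q < 2 * (n % q)) :
    ∃ f ∈ PSR (ZR q), rescale (dlcm n : ℚ) (brick n 1 k * brick n 3 k) = C (q : ℚ) * f := by
  obtain ⟨z1, hz1⟩ := brick_int n k 1 hk
  obtain ⟨z3, hz3⟩ := brick_int n k 3 hk
  have hn1 : 1 ≤ n := hq.out.one_lt.le.trans hqn
  have hq3 : 2 < q := by
    by_contra h
    have : q ^ 2 ≤ 2 ^ 2 := Nat.pow_le_pow_left (by omega) 2
    omega
  have hdiv : (q : ℤ) ∣ z1 * z3 := q_dvd_one_of q n k z1 z3 hk hq.out hq3 (by omega) hmod hz1 hz3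
  have hnd : ∀ r : ℕ, r = 1 ∨ r = 3 → ∀ j ∈ Finset.range n,
      (r : ℚ) / 4 + j + -(k : ℚ) ≠ 0 ∧ (dlcm n : ℚ) / ((r : ℚ) / 4 + j + -(k : ℚ)) ∈ ZR q := by
    intro r hr j hj
    have hj' := Finset.mem_range.1 hj
    have hz0 : 4 * ((j : ℤ) - k) + r ≠ 0 := by omega
    have he : (r : ℚ) / 4 + j + -(k : ℚ) = ((4 * ((j : ℤ) - k) + r : ℤ) : ℚ) / 4 := by
      push_cast; ring
    constructor
    · rw [he]
      have : ((4 * ((j : ℤ) - k) + r : ℤ) : ℚ) ≠ 0 := by exact_mod_cast hz0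
      exact div_ne_zero this (by norm_num)
    · by_contra hcon
      obtain ⟨e, h1, h2⟩ := quarter_div q (dlcm n) _ _ he hz0 hcon
      rcases (by omega : e = 0 ∨ e = 1 ∨ 2 ≤ e) with rfl | rfl | h
      · exact h2 (by simp)
      · apply h2
        rw [pow_one]
        refine dvd_dlcm n q (by exact_mod_cast hq.out.ne_zero) (by rw [abs_of_nonneg] <;> omega)
      · have h3 : (q : ℤ) ^ 2 ∣ 4 * ((j : ℤ) - k) + r := (pow_dvd_pow _ h).trans h1
        have h4 := Int.le_of_dvd (abs_pos.2 hz0) ((dvd_abs _ _).2 h3)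
        have h5 : (10 * n : ℤ) < (q : ℤ) ^ 2 := by exact_mod_cast hq2
        have h6 : |4 * ((j : ℤ) - k) + r| ≤ 4 * n + 3 := by
          rw [abs_le]; constructor <;> omega
        omega
  obtain ⟨f1, hf1, e1⟩ := brick_factor (R := ZR q) n 1 k (dlcm n) z1 (by exact_mod_cast hz1)
    (fun j hj => (hnd 1 (Or.inl rfl) j hj).1) (fun e h0 h => dlcm_div_mem _ n e h0 h) hk
    (fun j hj => (hnd 1 (Or.inl rfl) j hj).2)
  obtain ⟨f3, hf3, e3⟩ := brick_factor (R := ZR q) n 3 k (dlcm n) z3 (by exact_mod_cast hz3)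
    (fun j hj => (hnd 3 (Or.inr rfl) j hj).1) (fun e h0 h => dlcm_div_mem _ n e h0 h) hk
    (fun j hj => (hnd 3 (Or.inr rfl) j hj).2)
  obtain ⟨w, hw⟩ := hdiv
  refine ⟨C (w : ℚ) * f1 * f3, (PSR _).mul_mem ((PSR _).mul_mem (C_mem_PSR (intCast_mem _ w)) hf1) hf3, ?_⟩
  rw [map_mul, e1, e3]
  have : (C (z1 : ℚ) * C (z3 : ℚ) : ℚ⟦X⟧) = C (q : ℚ) * C (w : ℚ) := by
    rw [← map_mul, ← map_mul]; congr 1; exact_mod_cast hw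
  linear_combination f1 * f3 * this

lemma phi_local (p : ℕ) [hp : Fact p.Prime] (n : ℕ) :
    (∃ u ∈ ZR p, (Phi n : ℚ)⁻¹ = 1⁻¹ * u) ∨
    (p ≤ n ∧ 10 * n < p ^ 2 ∧ p < 2 * (n % p) ∧ ∃ u ∈ ZR p, (Phi n : ℚ)⁻¹ = (p : ℚ)⁻¹ * u) := by
  classical
  set g : ℕ → ℕ := fun q =>
    if q.Prime ∧ Real.sqrt (10 * n) < (q : ℝ) ∧ 1/2 < Int.fract ((n : ℝ) / q) then q else 1 with hg
  have hPhi : Phi n = ∏ q ∈ Finset.Icc 1 n, g q := by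
    rw [Phi]
  have hgne : ∀ q, q ≠ p → (g q : ℚ)⁻¹ ∈ ZR p := by
    intro q hqp
    refine inv_mem_ZR p _ ?_
    simp only [hg]
    split_ifs with h
    · intro hd; exact hqp ((Nat.prime_dvd_prime_iff_eq hp.out h.1).1 hd).symm
    · intro hd; exact hp.out.one_lt.ne' (Nat.dvd_one.1 hd)
  by_cases hc : p ∈ Finset.Icc 1 n ∧ Real.sqrt (10 * n) < (p : ℝ) ∧ 1/2 < Int.fract ((n : ℝ) / p)
  · right
    obtain ⟨hmem, hs, hfr⟩ := hc
    refine ⟨(Finset.mem_Icc.1 hmem).2, ?_, ?_, ?_⟩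
    · have := (Real.sqrt_lt' (by exact_mod_cast hp.out.pos)).1 hs
      exact_mod_cast this
    · rw [Int.fract_div_natCast_eq_div_natCast_mod,
        lt_div_iff₀ (by exact_mod_cast hp.out.pos)] at hfr
      have : (p : ℝ) < 2 * ((n % p : ℕ) : ℝ) := by linarith
      exact_mod_cast this
    · refine ⟨∏ q ∈ (Finset.Icc 1 n).erase p, (g q : ℚ)⁻¹,
        (ZR p).prod_mem fun q hq => hgne q (Finset.ne_of_mem_erase hq), ?_⟩
      have hgp : g p = p := by simp only [hg]; rw [if_pos ⟨hp.out, hs, hfr⟩]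
      rw [hPhi, ← Finset.mul_prod_erase _ _ hmem, hgp, Finset.prod_inv_distrib]
      push_cast
      rw [mul_inv]
  · left
    refine ⟨∏ q ∈ (Finset.Icc 1 n), (g q : ℚ)⁻¹, (ZR p).prod_mem fun q hq => ?_, ?_⟩
    · by_cases hqp : q = p
      · subst hqp
        have : g q = 1 := by
          simp only [hg]; rw [if_neg]; rintro ⟨_, h2, h3⟩; exact hc ⟨hq, h2, h3⟩
        rw [this]; simpa using (ZR q).one_mem
      · exact hgne q hqp
    · rw [hPhi, Finset.prod_inv_distrib]; push_cast; simp

lemma phi_ne (n : ℕ) : (Phi n : ℚ) ≠ 0 := by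
  classical
  rw [Phi]
  have : (∏ q ∈ Finset.Icc 1 n,
    if q.Prime ∧ Real.sqrt (10 * n) < (q : ℝ) ∧ 1/2 < Int.fract ((n : ℝ) / q) then q else 1) ≠ 0 := by
    refine Finset.prod_ne_zero_iff.2 fun q hq => ?_
    split_ifs with h
    · exact h.1.ne_zero
    · exact one_ne_zero
  exact_mod_cast this

end LF

/-- Integrality of the constant terms `ρ_{n,0}` (for odd `n > (2s+4)²`) and `σ_{n,0}`
(for every positive `n`): `Φ_n^{-(s+2)} d_n^{3s+5} ρ_{n,0} ∈ ℤ` and `d_n^{2s+3} σ_{n,0} ∈ ℤ`. -/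
theorem linear_form_constant_term_integrality (s δ : ℕ) (hδ : δ ≤ 1) :
    (∀ n : ℕ, Odd n → (2 * s + 4) ^ 2 < n →
      ∀ a : ℕ → ℕ → ℚ,
        (∀ t : ℚ, (∀ k : ℕ, k ≤ n → t + (k : ℚ) ≠ 0) →
          Afun s δ n t = ∑ i ∈ Finset.Icc 1 (2 * s + 4), ∑ k ∈ Finset.range (n + 1),
            a i k / (t + (k : ℚ)) ^ i) →
        ∃ z : ℤ, (dlcm n : ℚ) ^ (3 * s + 5) *
            ((-1 : ℚ) ^ (s + 1) * ∑ i ∈ Finset.Icc 1 (2 * s + 4), ∑ k ∈ Finset.Icc 1 n,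
              ∑ ℓ ∈ Finset.range k,
                poch (i : ℚ) (s + 1) * a i k / ((ℓ : ℚ) + 1/4) ^ (i + s + 1)) =
          (Phi n : ℚ) ^ (s + 2) * (z : ℚ)) ∧
    (∀ n : ℕ, 0 < n →
      ∀ b : ℕ → ℕ → ℚ,
        (∀ t : ℚ, (∀ k : ℕ, k ≤ n → t + (k : ℚ) ≠ 0) →
          Bfun s n t = ∑ i ∈ Finset.Icc 1 (s + 2), ∑ k ∈ Finset.range (n + 1),
            b i k / (t + (k : ℚ)) ^ i) →
        ∃ z : ℤ, (dlcm n : ℚ) ^ (2 * s + 3) *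
            ((-1 : ℚ) ^ (s + 1) * ∑ i ∈ Finset.Icc 1 (s + 2), ∑ k ∈ Finset.Icc 1 n,
              ∑ ℓ ∈ Finset.range k,
                poch (i : ℚ) (s + 1) * b i k / ((ℓ : ℚ) + 1/4) ^ (i + s + 1)) = (z : ℚ)) := by
  constructor
  · intro n _ _ a ha
    have hN := LF.poly_identity n (2 * s + 4) (LF.NA s δ n) (Afun s δ n) a (LF.Afun_eq s δ n) ha
    have hvan : ∀ m ∈ Finset.Icc 1 n, ∑ i ∈ Finset.Icc 1 (2 * s + 4), ∑ k ∈ Finset.range (n + 1),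
        poch (i : ℚ) (s + 1) * a i k / ((k : ℚ) + (1/4 - m)) ^ (i + s + 1) = 0 := fun m hm =>
      LF.vanish n _ s _ a (1/4 - (m : ℚ)) hN (fun k => LF.quarter_ne k m)
        (LF.X_pow_dvd_Npol n s m hm _)
    set S : ℚ := (-1 : ℚ) ^ (s + 1) * ∑ i ∈ Finset.Icc 1 (2 * s + 4), ∑ k ∈ Finset.Icc 1 n,
              ∑ ℓ ∈ Finset.range k,
                poch (i : ℚ) (s + 1) * a i k / ((ℓ : ℚ) + 1/4) ^ (i + s + 1) with hS
    obtain ⟨z, hz⟩ := LF.int_of_ZR (((Phi n : ℚ) ^ (s + 2))⁻¹ * ((dlcm n : ℚ) ^ (3 * s + 5) * S)) (by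
      intro p hp
      have main : ∀ K : ℚ, K ≠ 0 → (∀ k ≤ n, ∃ f ∈ LF.PSR (LF.ZR p),
          PowerSeries.rescale (dlcm n : ℚ) (LF.brick n 1 k * LF.brick n 3 k) = PowerSeries.C K * f) →
          (∃ u ∈ LF.ZR p, (Phi n : ℚ)⁻¹ = K⁻¹ * u) →
          ((Phi n : ℚ) ^ (s + 2))⁻¹ * ((dlcm n : ℚ) ^ (3 * s + 5) * S) ∈ LF.ZR p := by
        rintro K hK0 hK ⟨u, hu, hPu⟩
        have h1 := LF.local_sum p n (2 * s + 4) s a (K ^ (s + 2))⁻¹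
          (LF.a_int (LF.ZR p) s δ n a K hN hK hK0) hvan
        rw [← hS, show 2 * s + 4 + s + 1 = 3 * s + 5 by ring] at h1
        have h2 : ((Phi n : ℚ) ^ (s + 2))⁻¹ = u ^ (s + 2) * (K ^ (s + 2))⁻¹ := by
          rw [← inv_pow, hPu, mul_pow, inv_pow, mul_comm]
        rw [h2, mul_assoc]
        exact (LF.ZR p).mul_mem ((LF.ZR p).pow_mem hu _) h1
      rcases LF.phi_local p n with h | ⟨h1, h2, h3, h⟩
      · exact main 1 one_ne_zero (fun k hk => LF.bricks_one _ n k hk) h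
      · exact main p (by exact_mod_cast hp.out.ne_zero)
          (fun k hk => LF.bricks_q p n k hk h1 h2 h3) h)
    refine ⟨z, ?_⟩
    rw [← hz, mul_inv_cancel_left₀ (pow_ne_zero _ (LF.phi_ne n))]
  · intro n _ b hb
    have hN := LF.poly_identity n (s + 2) (1 * LF.Npol n 3 ^ (s + 2)) (Bfun s n) b
      (LF.Bfun_eq s n) hb
    have hvan : ∀ m ∈ Finset.Icc 1 n, ∑ i ∈ Finset.Icc 1 (s + 2), ∑ k ∈ Finset.range (n + 1),
        poch (i : ℚ) (s + 1) * b i k / ((k : ℚ) + (1/4 - m)) ^ (i + s + 1) = 0 := fun m hm =>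
      LF.vanish n _ s _ b (1/4 - (m : ℚ)) hN (fun k => LF.quarter_ne k m)
        (LF.X_pow_dvd_Npol n s m hm _)
    refine LF.int_of_ZR _ ?_
    intro p hp
    have h1 := LF.local_sum p n (s + 2) s b 1 (LF.b_int (LF.ZR p) s n b hN) hvan
    rw [one_mul, show s + 2 + s + 1 = 2 * s + 3 by ring] at h1
    exact h1
end

section
/- Let Φ_n denote the product of all primes q with √(10n) < q ≤ n such that the fractional part of n/q is greater than 1/2. Then (log Φ_n)/n → 2·log 2 − 1 as n → ∞; equivalently, Φ_n = exp((2 log 2 − 1 + o(1))·n). -/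
open Filter Finset

lemma fract_half_iff (n q : ℕ) (hq : 0 < q) :
    1/2 < Int.fract ((n : ℝ) / q) ↔ q < 2 * (n % q) := by
  rw [Int.fract_div_natCast_eq_div_natCast_mod, div_lt_div_iff₀ (by norm_num) (by exact_mod_cast hq)]
  norm_cast
  rw [one_mul, mul_comm]

lemma centralBinom_factorization_large (n q : ℕ) (hn : 1 ≤ n) (hq : q.Prime) (h : 10 * n < q ^ 2) :
    n.centralBinom.factorization q = if q < 2 * (n % q) then 1 else 0 := by
  have hq3 : 3 < q := by nlinarith
  have hodd : q % 2 = 1 := by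
    rcases hq.eq_two_or_odd with h | h
    · omega
    · exact h
  rw [Nat.centralBinom, Nat.factorization_choose hq (b := 2) (by omega)
    (Nat.log_lt_of_lt_pow (by omega) (by omega))]
  have : Finset.Ico 1 2 = {1} := by rfl
  rw [this, Finset.filter_singleton]
  have e : 2 * n - n = n := by omega
  simp only [pow_one, e]
  split_ifs with h1 h2 h2
  · simp
  · omega
  · omega
  · simp

open scoped Classical in
lemma log_Phi (n : ℕ) : Real.log (Phi n) = ∑ q ∈ Finset.Ioc 0 (2 * n),
    if q.Prime ∧ q ≤ n ∧ 10 * n < q ^ 2 ∧ q < 2 * (n % q) then Real.log q else 0 := by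
  rw [Phi, Nat.cast_prod, Real.log_prod]
  · rw [← Finset.sum_subset (s₁ := Finset.Icc 1 n) (s₂ := Finset.Ioc 0 (2 * n))]
    · refine Finset.sum_congr rfl fun q hq => ?_
      rw [Finset.mem_Icc] at hq
      have e1 := fract_half_iff n q hq.1
      have e2 : Real.sqrt (10 * n) < q ↔ 10 * n < q ^ 2 := by
        rw [Real.sqrt_lt' (by exact_mod_cast hq.1)]
        norm_cast
      by_cases h : q.Prime ∧ 10 * n < q ^ 2 ∧ q < 2 * (n % q)
      · rw [if_pos (by rw [e1, e2]; exact h), if_pos ⟨h.1, hq.2, h.2⟩]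
      · rw [if_neg (by rw [e1, e2]; exact h), if_neg (by tauto)]; simp
    · intro q hq
      simp only [Finset.mem_Icc, Finset.mem_Ioc] at *
      omega
    · intro q hq hq'
      simp only [Finset.mem_Icc, Finset.mem_Ioc] at *
      rw [if_neg]
      rintro ⟨_, h, _⟩
      omega
  · intro q hq
    rw [Finset.mem_Icc] at hq
    split_ifs
    · exact_mod_cast (by omega : q ≠ 0)
    · simp

lemma log_cB (n : ℕ) : Real.log n.centralBinom = ∑ q ∈ Finset.Ioc 0 (2 * n),
    n.centralBinom.factorization q * Real.log q := by
  conv_lhs => rw [← Nat.prod_pow_factorization_centralBinom, Nat.cast_prod]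
  rw [Real.log_prod]
  · rw [← Finset.sum_subset (s₁ := Finset.Ioc 0 (2*n))]
    · refine Finset.sum_congr rfl fun q hq => ?_
      push_cast
      rw [Real.log_pow]
    · intro q hq
      simp only [Finset.mem_range, Finset.mem_Ioc] at *
      omega
    · intro q hq hq'
      simp only [Finset.mem_range, Finset.mem_Ioc] at *
      obtain rfl : q = 0 := by omega
      simp
  · intro q hq
    rcases Nat.eq_zero_or_pos q with rfl | h
    · simp
    · positivity

lemma theta_two (n : ℕ) : Chebyshev.theta (2 * n) = ∑ q ∈ Finset.Ioc 0 (2 * n),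
    if q.Prime then Real.log q else 0 := by
  rw [Chebyshev.theta, Finset.sum_filter]
  have : ⌊(2 * n : ℝ)⌋₊ = 2 * n := by exact_mod_cast Nat.floor_natCast (2 * n)
  rw [this]

lemma theta_one' (n : ℕ) : Chebyshev.theta n = ∑ q ∈ Finset.Ioc 0 (2 * n),
    if q.Prime ∧ q ≤ n then Real.log q else 0 := by
  rw [Chebyshev.theta, Finset.sum_filter, Nat.floor_natCast]
  rw [← Finset.sum_subset (s₁ := Finset.Ioc 0 n) (s₂ := Finset.Ioc 0 (2*n))]
  · refine Finset.sum_congr rfl fun q hq => ?_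
    simp only [Finset.mem_Ioc] at hq
    simp [hq.2]
  · intro q hq
    simp only [Finset.mem_Ioc] at *
    omega
  · intro q hq hq'
    simp only [Finset.mem_Ioc] at *
    rw [if_neg]
    omega

lemma Phi_compare (n : ℕ) (hn : 1 ≤ n) :
    |Real.log (Phi n) - (Real.log n.centralBinom - (Chebyshev.theta (2 * n) - Chebyshev.theta n))|
      ≤ Real.sqrt (10 * n) * Real.log (2 * n) := by
  have hL : 0 ≤ Real.log (2 * n) := Real.log_nonneg (by
    have : (1:ℝ) ≤ n := by exact_mod_cast hn
    linarith)
  rw [log_Phi, log_cB, theta_two, theta_one', ← Finset.sum_sub_distrib, ← Finset.sum_sub_distrib,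
    ← Finset.sum_sub_distrib]
  refine (Finset.abs_sum_le_sum_abs _ _).trans ?_
  have key : ∀ q ∈ Finset.Ioc 0 (2 * n), |(if q.Prime ∧ q ≤ n ∧ 10 * n < q ^ 2 ∧ q < 2 * (n % q) then Real.log q else 0) - (n.centralBinom.factorization q * Real.log q - ((if q.Prime then Real.log q else 0) - (if q.Prime ∧ q ≤ n then Real.log q else 0)))| ≤ if q ^ 2 ≤ 10 * n then Real.log (2 * n) else 0 := by
    intro q hq
    rw [Finset.mem_Ioc] at hq
    have hlq : 0 ≤ Real.log q := Real.log_natCast_nonneg q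
    by_cases hp : q.Prime
    swap
    · rw [Nat.factorization_eq_zero_of_not_prime _ hp]
      simp only [hp, false_and, if_false]
      norm_num
      split_ifs
      · exact hL
      · rfl
    by_cases hbig : q ^ 2 ≤ 10 * n
    · rw [if_pos hbig, if_neg (by omega)]
      have h1 : n.centralBinom.factorization q * Real.log q ≤ Real.log (2 * n) := by
        rw [← Real.log_pow]
        apply Real.log_le_log
        · have := hq.1
          positivity
        · exact_mod_cast Nat.pow_factorization_choose_le (p := q) (n := 2 * n) (k := n) (by omega)
      have h2 : Real.log q ≤ Real.log (2 * n) := by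
        apply Real.log_le_log
        · exact_mod_cast hq.1
        · exact_mod_cast hq.2
      have h3 : 0 ≤ n.centralBinom.factorization q * Real.log q := by positivity
      rw [abs_le]
      simp only [hp, true_and, if_true]
      split_ifs <;> constructor <;> linarith
    · rw [if_neg hbig, centralBinom_factorization_large n q hn hp (by omega)]
      simp only [hp, true_and, if_true]
      by_cases hqn : q ≤ n
      · simp only [hqn, true_and, if_true]
        by_cases h : q < 2 * (n % q)
        · rw [if_pos ⟨by omega, h⟩, if_pos h]; simp
        · rw [if_neg (by omega), if_neg h]; simp
      · have : n % q = n := Nat.mod_eq_of_lt (by omega)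
        have hne : q ≠ 2 * n := by
          rintro rfl
          have := (Nat.prime_mul_iff.mp hp)
          rcases this with ⟨_, h⟩ | ⟨_, h⟩
          · subst h; norm_num at hbig
          · omega
        rw [if_neg (by omega), if_neg hqn, this, if_pos (by omega)]; simp
  refine (Finset.sum_le_sum key).trans ?_
  rw [← Finset.sum_filter, Finset.sum_const, nsmul_eq_mul]
  refine mul_le_mul_of_nonneg_right ?_ hL
  have hs : ((Finset.Ioc 0 (2 * n)).filter fun q => q ^ 2 ≤ 10 * n) ⊆ Finset.Ioc 0 ⌊Real.sqrt (10 * n)⌋₊ := by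
    intro q hq
    simp only [Finset.mem_filter, Finset.mem_Ioc] at *
    refine ⟨hq.1.1, Nat.le_floor (Real.le_sqrt_of_sq_le (by exact_mod_cast hq.2))⟩
  calc _ ≤ ((Finset.Ioc 0 ⌊Real.sqrt (10 * n)⌋₊).card : ℝ) := by exact_mod_cast Finset.card_le_card hs
    _ ≤ _ := by
      rw [Nat.card_Ioc, Nat.sub_zero]
      exact Nat.floor_le (Real.sqrt_nonneg _)

lemma log_cB_tendsto : Tendsto (fun n : ℕ => Real.log n.centralBinom / n) atTop (nhds (2 * Real.log 2)) := by
  have h4 : Real.log 4 = 2 * Real.log 2 := by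
    rw [show (4:ℝ) = 2 ^ 2 by norm_num, Real.log_pow]; norm_num
  have hlim : Tendsto (fun n : ℕ => 2 * Real.log 2 - (Real.log 2 / n + Real.log n / n)) atTop (nhds (2 * Real.log 2)) := by
    have h1 : Tendsto (fun n : ℕ => Real.log 2 / (n:ℝ)) atTop (nhds 0) := tendsto_const_div_atTop_nhds_zero_nat _
    have h2 : Tendsto (fun n : ℕ => Real.log n / (n:ℝ)) atTop (nhds 0) :=
      (Real.isLittleO_log_id_atTop.tendsto_div_nhds_zero).comp tendsto_natCast_atTop_atTop
    simpa using tendsto_const_nhds.sub (h1.add h2)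
  refine tendsto_of_tendsto_of_tendsto_of_le_of_le' hlim tendsto_const_nhds ?_ ?_
  · filter_upwards [eventually_ge_atTop 1] with n hn
    have hn' : (0:ℝ) < n := by exact_mod_cast hn
    have hc : (0:ℝ) < n.centralBinom := by exact_mod_cast n.centralBinom_pos
    have h := Nat.four_pow_le_two_mul_self_mul_centralBinom n hn
    have h' : (4:ℝ) ^ n ≤ 2 * n * n.centralBinom := by exact_mod_cast h
    have h'' := Real.log_le_log (by positivity) h'
    rw [Real.log_pow, Real.log_mul (by positivity) hc.ne', Real.log_mul (by norm_num) hn'.ne', h4] at h''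
    rw [le_div_iff₀ hn']
    field_simp
    linarith
  · filter_upwards [eventually_ge_atTop 1] with n hn
    have hn' : (0:ℝ) < n := by exact_mod_cast hn
    have hc : (0:ℝ) < n.centralBinom := by exact_mod_cast n.centralBinom_pos
    have h' : (n.centralBinom : ℝ) ≤ 4 ^ n := by exact_mod_cast n.centralBinom_le_four_pow
    have h'' := Real.log_le_log hc h'
    rw [Real.log_pow, h4] at h''
    rw [div_le_iff₀ hn']
    linarith

lemma err_tendsto : Tendsto (fun n : ℕ => Real.sqrt (10 * n) * Real.log (2 * n) / n) atTop (nhds 0) := by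
  have h : Tendsto (fun x : ℝ => Real.log x / x ^ (1/2:ℝ)) atTop (nhds 0) :=
    (isLittleO_log_rpow_atTop (by norm_num)).tendsto_div_nhds_zero
  have h2 : Tendsto (fun n : ℕ => (2 * n : ℝ)) atTop atTop :=
    tendsto_natCast_atTop_atTop.const_mul_atTop (by norm_num)
  have h3 := (h.comp h2).const_mul (Real.sqrt 20)
  rw [mul_zero] at h3
  refine h3.congr' ?_
  filter_upwards [eventually_ge_atTop 1] with n hn
  have hn' : (0:ℝ) < n := by exact_mod_cast hn
  simp only [Function.comp]
  rw [← Real.sqrt_eq_rpow, show (20:ℝ) = 10 * 2 by norm_num, Real.sqrt_mul (by norm_num), Real.sqrt_mul (by norm_num), Real.sqrt_mul (by norm_num)]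
  have h5 : Real.sqrt n * Real.sqrt n = n := Real.mul_self_sqrt hn'.le
  have h6 : 0 < Real.sqrt n := Real.sqrt_pos.mpr hn'
  have h7 : 0 < Real.sqrt 2 := Real.sqrt_pos.mpr (by norm_num)
  rw [mul_div_assoc', div_eq_div_iff (by positivity) (by positivity)]
  linear_combination (-(Real.sqrt 10 * Real.sqrt 2 * Real.log (2*n))) * h5

theorem Phi_asymptotics_of_PNT (hpnt : Tendsto (fun x : ℝ => Chebyshev.theta x / x) atTop (nhds 1)) :
    Filter.Tendsto (fun n : ℕ => Real.log (Phi n) / n) Filter.atTop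
      (nhds (2 * Real.log 2 - 1)) := by
  have h1 : Tendsto (fun n : ℕ => Chebyshev.theta n / n) atTop (nhds 1) := hpnt.comp tendsto_natCast_atTop_atTop
  have h2 : Tendsto (fun n : ℕ => Chebyshev.theta (2 * n) / (2 * n)) atTop (nhds 1) :=
    hpnt.comp (tendsto_natCast_atTop_atTop.const_mul_atTop (by norm_num : (0:ℝ) < 2))
  have h3 := log_cB_tendsto.sub ((h2.const_mul 2).sub h1)
  have h4 : Tendsto (fun n : ℕ => Real.log (Phi n) / n - (Real.log n.centralBinom / n - (2 * (Chebyshev.theta (2 * n) / (2 * n)) - Chebyshev.theta n / n))) atTop (nhds 0) := by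
    refine squeeze_zero_norm' ?_ err_tendsto
    filter_upwards [eventually_ge_atTop 1] with n hn
    have hn' : (0:ℝ) < n := by exact_mod_cast hn
    have := Phi_compare n hn
    rw [le_div_iff₀ hn', Real.norm_eq_abs]
    have e : ∀ X : ℝ, |X| * n = |X * n| := fun X => by rw [abs_mul, abs_of_pos hn']
    rw [e]
    refine le_of_eq_of_le ?_ this
    congr 1
    field_simp
  have h5 := h4.add h3
  convert h5 using 2
  · ring
  · ring

namespace PNTaux
open MeasureTheory Set Topology

/-- The Fejér kernel. -/
noncomputable def K (x : ℝ) : ℝ := (Real.sinc (x / 2)) ^ 2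

lemma K_cont : Continuous K := by
  unfold K
  exact (Real.continuous_sinc.comp (continuous_id.div_const 2)).pow 2

lemma K_nonneg (x : ℝ) : 0 ≤ K x := sq_nonneg _

lemma K_zero : K 0 = 1 := by simp [K]

lemma K_le (x : ℝ) : K x ≤ 5 * (1 + x ^ 2)⁻¹ := by
  have h1 : K x ≤ 1 := by
    unfold K
    rw [sq_le_one_iff_abs_le_one]
    exact Real.abs_sinc_le_one _
  have h2 : x ^ 2 * K x ≤ 4 := by
    rcases eq_or_ne x 0 with rfl | hx
    · simp
    · unfold K
      rw [Real.sinc_of_ne_zero (by simpa using hx)]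
      have : Real.sin (x / 2) ^ 2 ≤ 1 := Real.sin_sq_le_one _
      rw [div_pow]
      field_simp
      linarith
  rw [← div_eq_mul_inv, le_div_iff₀ (by positivity)]
  linarith

lemma K_integrable : Integrable K := by
  refine (integrable_inv_one_add_sq.const_mul 5).mono' K_cont.aestronglyMeasurable ?_
  refine Eventually.of_forall fun x => ?_
  rw [Real.norm_eq_abs, abs_of_nonneg (K_nonneg x)]
  exact K_le x

lemma K_integral_pos : 0 < ∫ x, K x := 
  integral_pos_of_integrable_nonneg_nonzero (x := 0) K_cont K_integrable K_nonneg (by simp [K_zero])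

lemma K_eq (x : ℝ) : K x = ∫ u in Ioc (0:ℝ) 1, 2 * (1 - u) * Real.cos (u * x) := by
  rw [← intervalIntegral.integral_of_le zero_le_one]
  rcases eq_or_ne x 0 with rfl | hx
  · simp only [mul_zero, Real.cos_zero, mul_one, K_zero]
    rw [intervalIntegral.integral_const_mul, intervalIntegral.integral_sub (by simp) (by simp)]
    simp
    norm_num
  · have hd : ∀ u ∈ uIcc (0:ℝ) 1, HasDerivAt (fun u => 2 * (1 - u) * Real.sin (u * x) / x - 2 * Real.cos (u * x) / x ^ 2) (2 * (1 - u) * Real.cos (u * x)) u := by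
      intro u _
      have h0 : HasDerivAt (fun u : ℝ => u * x) x u := by simpa using (hasDerivAt_id u).mul_const x
      have h1 : HasDerivAt (fun u : ℝ => 2 * (1 - u)) (-2) u := by
        have := ((hasDerivAt_id u).const_sub 1).const_mul 2
        simpa using this
      have h2 := (h1.mul h0.sin).div_const x
      have h3 := (h0.cos.const_mul 2).div_const (x ^ 2)
      convert! h2.sub h3 using 1
      field_simp
      ring
    rw [intervalIntegral.integral_eq_sub_of_hasDerivAt hd (Continuous.intervalIntegrable (by fun_prop) _ _)]
    unfold K
    rw [Real.sinc_of_ne_zero (by simpa using hx)]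
    have : Real.cos x = 1 - 2 * Real.sin (x / 2) ^ 2 := by
      have := Real.cos_sq' (x / 2)
      have h2 := Real.cos_two_mul (x / 2)
      rw [mul_div_cancel₀ x two_ne_zero] at h2
      linarith
    simp [this]
    field_simp
    ring

section
variable (f : ℝ → ℝ) (B : ℝ) (F : ℂ → ℂ)

lemma exp_int (σ : ℝ) (hσ : 0 < σ) : IntegrableOn (fun t : ℝ => Real.exp (-σ * t)) (Ioi 0) := by
  exact exp_neg_integrableOn_Ioi 0 hσ

lemma lap_int (hf : Measurable f) (hB : ∀ t, |f t| ≤ B) (s : ℂ) (hs : 0 < s.re) :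
    IntegrableOn (fun t : ℝ => (f t : ℂ) * Complex.exp (-s * t)) (Ioi 0) := by
  refine ((exp_int s.re hs).const_mul B).mono' ?_ ?_
  · refine Measurable.aestronglyMeasurable ?_
    exact (Complex.measurable_ofReal.comp hf).mul (by fun_prop)
  · refine Eventually.of_forall fun t => ?_
    rw [norm_mul, Complex.norm_real, Complex.norm_exp, Real.norm_eq_abs]
    have : (-s * (t:ℂ)).re = -s.re * t := by simp
    rw [this]
    gcongr
    exact hB t

lemma swap (hf : Measurable f) (hB : ∀ t, |f t| ≤ B)
    (hLap : ∀ s : ℂ, 0 < s.re → ∫ t in Ioi (0:ℝ), (f t : ℂ) * Complex.exp (-s * t) = F s)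
    (σ : ℝ) (hσ : 0 < σ) (l T : ℝ) :
    ∫ t in Ioi (0:ℝ), f t * Real.exp (-σ * t) * K (l * (t - T)) =
    ∫ u in Ioc (0:ℝ) 1, 2 * (1 - u) * (Complex.exp (u * l * T * Complex.I) * F (σ + u * l * Complex.I)).re := by
  have h1 : ∀ t : ℝ, f t * Real.exp (-σ * t) * K (l * (t - T)) =
      ∫ u in Ioc (0:ℝ) 1, f t * Real.exp (-σ * t) * (2 * (1 - u) * Real.cos (u * (l * (t - T)))) := by
    intro t
    rw [K_eq, integral_const_mul]
  simp_rw [h1]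
  rw [integral_integral_swap]
  · refine integral_congr_ae (Eventually.of_forall fun u => ?_)
    have hre : 0 < (σ + u * l * Complex.I : ℂ).re := by simpa using hσ
    simp only
    rw [← hLap _ hre, ← integral_const_mul]
    have hi := (lap_int f B hf hB _ hre).const_mul (Complex.exp (u * l * T * Complex.I))
    have := integral_re hi
    simp only [RCLike.re_eq_complex_re] at this
    rw [← this, ← integral_const_mul]
    refine integral_congr_ae (Eventually.of_forall fun t => ?_)
    have e : Complex.exp (u * l * T * Complex.I) * (f t * Complex.exp (-(σ + u * l * Complex.I) * t))
      = ((f t * Real.exp (-σ * t) : ℝ) : ℂ) * Complex.exp ((-(u * (l * (t - T))) : ℝ) * Complex.I) := by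
      push_cast
      rw [mul_left_comm, ← Complex.exp_add, mul_assoc (f t : ℂ), ← Complex.exp_add]
      congr 2
      ring
    simp only
    rw [e, Complex.re_ofReal_mul, Complex.exp_ofReal_mul_I_re, Real.cos_neg]
    ring
  · have hm : Integrable (fun p : ℝ × ℝ => (B * Real.exp (-σ * p.1)) * (2:ℝ)) ((volume.restrict (Ioi 0)).prod (volume.restrict (Ioc 0 1))) := by
      exact Integrable.mul_prod ((exp_int σ hσ).const_mul B) (integrable_const (2:ℝ))
    refine hm.mono' ?_ ?_
    · refine Measurable.aestronglyMeasurable ?_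
      have : Measurable fun p : ℝ × ℝ => f p.1 := hf.comp measurable_fst
      exact (this.mul (by fun_prop)).mul (by fun_prop)
    · rw [Measure.prod_restrict]
      refine ae_restrict_of_forall_mem (measurableSet_Ioi.prod measurableSet_Ioc) ?_
      rintro ⟨t, u⟩ ⟨_, hu⟩
      simp only [Set.mem_Ioc] at hu
      simp only [Function.uncurry]
      rw [norm_mul, norm_mul, norm_mul, Real.norm_eq_abs, Real.norm_eq_abs, Real.norm_eq_abs, Real.norm_eq_abs, abs_of_pos (Real.exp_pos _)]
      have h3 : |2 * (1 - u)| ≤ 2 := by rw [abs_le]; constructor <;> linarith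
      have h4 := Real.abs_cos_le_one (u * (l * (t - T)))
      have h5 : |2 * (1 - u)| * |Real.cos (u * (l * (t - T)))| ≤ 2 * 1 := by gcongr
      rw [mul_one] at h5
      have hB0 : 0 ≤ B := (abs_nonneg _).trans (hB 0)
      gcongr
      exact hB t

lemma K_comp_int (l : ℝ) (hl : 0 < l) (T : ℝ) : Integrable (fun t => K (l * (t - T))) := by
  exact (K_integrable.comp_mul_left' hl.ne').comp_sub_right T

lemma F_path (hF : ContinuousOn F {s | 0 ≤ s.re}) (l σ : ℝ) (hσ : 0 ≤ σ) :
    Continuous fun u : ℝ => F (σ + u * l * Complex.I) := by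
  refine hF.comp_continuous (by fun_prop) fun u => ?_
  simpa using hσ

lemma limit_id (hf : Measurable f) (hB : ∀ t, |f t| ≤ B)
    (hF : ContinuousOn F {s | 0 ≤ s.re})
    (hLap : ∀ s : ℂ, 0 < s.re → ∫ t in Ioi (0:ℝ), (f t : ℂ) * Complex.exp (-s * t) = F s)
    (l : ℝ) (hl : 0 < l) (T : ℝ) :
    ∫ t in Ioi (0:ℝ), f t * K (l * (t - T)) =
    ∫ u in Ioc (0:ℝ) 1, 2 * (1 - u) * (Complex.exp (u * l * T * Complex.I) * F (u * l * Complex.I)).re := by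
  have hB0 : 0 ≤ B := (abs_nonneg _).trans (hB 0)
  have hL : Tendsto (fun σ : ℝ => ∫ t in Ioi (0:ℝ), f t * Real.exp (-σ * t) * K (l * (t - T))) (𝓝[>] 0)
      (𝓝 (∫ t in Ioi (0:ℝ), f t * K (l * (t - T)))) := by
    refine tendsto_integral_filter_of_dominated_convergence (fun t => B * K (l * (t - T))) ?_ ?_ ?_ ?_
    · refine Eventually.of_forall fun σ => Measurable.aestronglyMeasurable ?_
      have := K_cont.measurable
      exact (hf.mul (by fun_prop)).mul (by fun_prop)
    · filter_upwards [self_mem_nhdsWithin] with σ hσ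
      refine ae_restrict_of_forall_mem measurableSet_Ioi fun t ht => ?_
      rw [norm_mul, norm_mul, Real.norm_eq_abs, Real.norm_eq_abs, Real.norm_eq_abs, abs_of_pos (Real.exp_pos _), abs_of_nonneg (K_nonneg _)]
      have h1 : Real.exp (-σ * t) ≤ 1 := by
        rw [Real.exp_le_one_iff]
        have : 0 < σ * t := mul_pos hσ ht
        linarith
      have h2 : |f t| * Real.exp (-σ * t) ≤ B * 1 := by
        gcongr
        exact hB t
      rw [mul_one] at h2
      exact mul_le_mul_of_nonneg_right h2 (K_nonneg _)
    · exact ((K_comp_int l hl T).const_mul B).integrableOn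
    · refine Eventually.of_forall fun t => ?_
      have : Continuous fun σ : ℝ => f t * Real.exp (-σ * t) * K (l * (t - T)) := by fun_prop
      have h := (this.tendsto 0).mono_left (nhdsWithin_le_nhds (s := Ioi 0))
      simpa using h
  have hcpt : IsCompact (Icc (0:ℝ) 1 ×ℂ Icc (0:ℝ) l) := isCompact_Icc.reProdIm isCompact_Icc
  obtain ⟨M, hM⟩ := hcpt.exists_bound_of_continuousOn (hF.mono (by
    intro s hs
    rw [Complex.mem_reProdIm] at hs
    exact hs.1.1))
  have hR : Tendsto (fun σ : ℝ => ∫ u in Ioc (0:ℝ) 1, 2 * (1 - u) * (Complex.exp (u * l * T * Complex.I) * F (σ + u * l * Complex.I)).re) (𝓝[>] 0)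
      (𝓝 (∫ u in Ioc (0:ℝ) 1, 2 * (1 - u) * (Complex.exp (u * l * T * Complex.I) * F (u * l * Complex.I)).re)) := by
    refine tendsto_integral_filter_of_dominated_convergence (fun _ => 2 * M) ?_ ?_ ?_ ?_
    · filter_upwards [self_mem_nhdsWithin] with σ hσ
      have := F_path F hF l σ (le_of_lt hσ)
      refine Continuous.aestronglyMeasurable ?_
      exact (by fun_prop : Continuous fun u : ℝ => 2 * (1 - u)).mul (Complex.continuous_re.comp
        ((by fun_prop : Continuous fun u : ℝ => Complex.exp (u * l * T * Complex.I)).mul this))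
    · filter_upwards [Ioo_mem_nhdsGT (zero_lt_one' ℝ)] with σ hσ
      refine ae_restrict_of_forall_mem measurableSet_Ioc fun u hu => ?_
      rw [norm_mul]
      have h3 : ‖2 * (1 - u)‖ ≤ 2 := by rw [Real.norm_eq_abs, abs_le]; constructor <;> linarith [hu.1, hu.2]
      have h4 : ‖(Complex.exp (u * l * T * Complex.I) * F (σ + u * l * Complex.I)).re‖ ≤ M := by
        refine (Complex.abs_re_le_norm _).trans ?_
        have : (u * l * T * Complex.I : ℂ) = ((u * l * T : ℝ) : ℂ) * Complex.I := by push_cast; ring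
        rw [norm_mul, this, Complex.norm_exp_ofReal_mul_I, one_mul]
        apply hM
        rw [Complex.mem_reProdIm]
        simp
        refine ⟨⟨hσ.1.le, hσ.2.le⟩, by have := hu.1; positivity, ?_⟩
        nlinarith [hu.2]
      gcongr
    · exact integrable_const _
    · refine ae_restrict_of_forall_mem measurableSet_Ioc fun u hu => ?_
      have h1 : Tendsto (fun σ : ℝ => F (σ + u * l * Complex.I)) (𝓝[>] 0) (𝓝 (F (u * l * Complex.I))) := by
        have h2 : ContinuousWithinAt F {s | 0 ≤ s.re} (u * l * Complex.I) := hF _ (by simp)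
        refine h2.tendsto.comp ?_
        refine tendsto_nhdsWithin_iff.mpr ⟨?_, ?_⟩
        · have : Continuous fun σ : ℝ => (σ + u * l * Complex.I : ℂ) := by fun_prop
          have h := (this.tendsto 0).mono_left (nhdsWithin_le_nhds (s := Ioi 0))
          simpa using h
        · filter_upwards [self_mem_nhdsWithin] with σ hσ
          have : 0 < σ := hσ
          simpa using this.le
      exact ((Complex.continuous_re.tendsto _).comp (h1.const_mul _)).const_mul _
  refine tendsto_nhds_unique hL (hR.congr' ?_)
  filter_upwards [self_mem_nhdsWithin] with σ hσ
  exact (swap f B F hf hB hLap σ hσ l T).symm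

lemma tauber (hf : Measurable f) (hB : ∀ t, |f t| ≤ B)
    (hF : ContinuousOn F {s | 0 ≤ s.re})
    (hLap : ∀ s : ℂ, 0 < s.re → ∫ t in Ioi (0:ℝ), (f t : ℂ) * Complex.exp (-s * t) = F s)
    (l : ℝ) (hl : 0 < l) :
    Tendsto (fun T => ∫ t in Ioi (0:ℝ), f t * K (l * (t - T))) atTop (𝓝 0) := by
  simp_rw [limit_id f B F hf hB hF hLap l hl]
  have h := Real.tendsto_integral_exp_smul_cocompact
    (indicator (Ioc (0:ℝ) 1) fun u : ℝ => (2 * (1 - u) : ℂ) * F (u * l * Complex.I))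
  have hT : Tendsto (fun T : ℝ => -(l / (2 * Real.pi)) * T) atTop (cocompact ℝ) := by
    refine Tendsto.mono_right ?_ atBot_le_cocompact
    refine tendsto_id.const_mul_atTop_of_neg ?_
    have := Real.pi_pos
    have : 0 < l / (2 * Real.pi) := by positivity
    linarith
  have h2 := (Complex.continuous_re.tendsto _).comp (h.comp hT)
  rw [Complex.zero_re] at h2
  refine h2.congr fun T => ?_
  simp only [Function.comp]
  have e : (fun v : ℝ => Real.fourierChar (-(v * (-(l / (2 * Real.pi)) * T))) • indicator (Ioc (0:ℝ) 1) (fun u : ℝ => (2 * (1 - u) : ℂ) * F (u * l * Complex.I)) v)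
     = indicator (Ioc (0:ℝ) 1) (fun u : ℝ => (2 * (1 - u) : ℂ) * (Complex.exp (u * l * T * Complex.I) * F (u * l * Complex.I))) := by
    ext v
    by_cases hv : v ∈ Ioc (0:ℝ) 1
    · rw [indicator_of_mem hv, indicator_of_mem hv, Circle.smul_def, Real.fourierChar_apply, smul_eq_mul]
      have : ((2 * Real.pi * -(v * (-(l / (2 * Real.pi)) * T)) : ℝ) : ℂ) * Complex.I = v * l * T * Complex.I := by
        have e1 : (2 * Real.pi * -(v * (-(l / (2 * Real.pi)) * T)) : ℝ) = v * l * T := by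
          have := Real.pi_pos
          field_simp
        rw [e1]; push_cast; ring
      rw [this]; ring
    · rw [indicator_of_notMem hv, indicator_of_notMem hv, smul_zero]
  rw [e, integral_indicator measurableSet_Ioc]
  have hc : Continuous fun u : ℝ => F (u * l * Complex.I) := by
    simpa using F_path F hF l 0 le_rfl
  have hi : IntegrableOn (fun u : ℝ => (2 * (1 - u) : ℂ) * (Complex.exp (u * l * T * Complex.I) * F (u * l * Complex.I))) (Ioc 0 1) := by
    refine Continuous.integrableOn_Ioc ?_
    exact (by fun_prop : Continuous fun u : ℝ => (2 * (1 - u) : ℂ)).mul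
        ((by fun_prop : Continuous fun u : ℝ => Complex.exp (u * l * T * Complex.I)).mul hc)
  have := integral_re hi
  simp only [RCLike.re_eq_complex_re] at this
  rw [← this]
  refine integral_congr_ae (Eventually.of_forall fun u => ?_)
  have e3 : (2 * (1 - u) : ℂ) = ((2 * (1 - u) : ℝ) : ℂ) := by push_cast; ring
  simp only
  rw [e3, Complex.re_ofReal_mul]
end


lemma K_tail (δ : ℝ) (hδ : 0 < δ) : ∃ R > 0, ∫ s, indicator {s | R < |s|} K s < δ := by
  have h : Tendsto (fun R : ℝ => ∫ s, indicator {s | R < |s|} K s) atTop (𝓝 (∫ _ : ℝ, (0:ℝ))) := by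
    refine tendsto_integral_filter_of_dominated_convergence K ?_ ?_ K_integrable ?_
    · refine Eventually.of_forall fun R => ?_
      exact (K_cont.measurable.indicator (measurableSet_lt measurable_const (by fun_prop))).aestronglyMeasurable
    · refine Eventually.of_forall fun R => Eventually.of_forall fun s => ?_
      refine (norm_indicator_le_norm_self _ _).trans ?_
      rw [Real.norm_eq_abs, abs_of_nonneg (K_nonneg s)]
    · refine Eventually.of_forall fun s => ?_
      refine tendsto_const_nhds.congr' ?_
      filter_upwards [eventually_ge_atTop |s|] with R hR
      rw [indicator_of_notMem]
      simpa using hR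
  rw [integral_zero] at h
  obtain ⟨R, h1, h2⟩ := ((h.eventually (gt_mem_nhds hδ)).and (eventually_gt_atTop 0)).exists
  exact ⟨R, h2, h1⟩

lemma hits (f : ℝ → ℝ) (B : ℝ) (hf : Measurable f) (hB : ∀ t, |f t| ≤ B)
    (h : ∀ l : ℝ, 0 < l → Tendsto (fun T => ∫ t, f t * K (l * (t - T))) atTop (𝓝 0))
    (ε η : ℝ) (hε : 0 < ε) (hη : 0 < η) :
    ∀ᶠ T in atTop, ∃ t ∈ Icc T (T + η), f t < ε := by
  have hB0 : 0 ≤ B := (abs_nonneg _).trans (hB 0)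
  set c := ∫ x, K x with hc
  have hcpos : 0 < c := K_integral_pos
  obtain ⟨R, hR, hRt⟩ := K_tail (ε * c / (2 * (ε + B))) (by positivity)
  set l := 2 * R / η with hl
  have hlpos : 0 < l := by positivity
  have hT : Tendsto (fun T : ℝ => T + η / 2) atTop atTop := tendsto_atTop_add_const_right _ _ tendsto_id
  have hh := ((h l hlpos).comp hT).eventually (gt_mem_nhds (show (0:ℝ) < l⁻¹ * (ε * c / 2) by positivity))
  filter_upwards [hh] with T hTlt
  by_contra! hcon
  simp only [Function.comp] at hTlt
  set G : ℝ → ℝ := fun s => ε * K s - (ε + B) * indicator {s | R < |s|} K s with hG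
  have hKi : Integrable (indicator {s | R < |s|} K) :=
    K_integrable.indicator (measurableSet_lt measurable_const (by fun_prop))
  have hGi : Integrable G := (K_integrable.const_mul ε).sub (hKi.const_mul (ε + B))
  have hGv : ε * c / 2 < ∫ s, G s := by
    rw [hG, integral_sub (K_integrable.const_mul ε) (hKi.const_mul (ε + B)), integral_const_mul, integral_const_mul, ← hc]
    have : (ε + B) * ∫ s, indicator {s | R < |s|} K s < (ε + B) * (ε * c / (2 * (ε + B))) := by
      gcongr
    have e : (ε + B) * (ε * c / (2 * (ε + B))) = ε * c / 2 := by
      field_simp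
    linarith
  have hGc : ∫ t, G (l * (t - (T + η / 2))) = l⁻¹ * ∫ s, G s := by
    rw [integral_sub_right_eq_self (fun t => G (l * t)), Measure.integral_comp_mul_left, abs_of_pos (by positivity), smul_eq_mul]
  have hGci : Integrable fun t => G (l * (t - (T + η / 2))) :=
    (hGi.comp_mul_left' hlpos.ne').comp_sub_right _
  have hle : ∫ t, G (l * (t - (T + η / 2))) ≤ ∫ t, f t * K (l * (t - (T + η / 2))) := by
    refine integral_mono hGci ?_ ?_
    · refine ((K_comp_int l hlpos (T + η / 2)).const_mul B).mono' ?_ ?_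
      · have := K_cont.measurable
        exact (hf.mul (by fun_prop)).aestronglyMeasurable
      · refine Eventually.of_forall fun t => ?_
        rw [norm_mul, Real.norm_eq_abs, Real.norm_eq_abs, abs_of_nonneg (K_nonneg _)]
        exact mul_le_mul_of_nonneg_right (hB t) (K_nonneg _)
    · intro t
      simp only [hG]
      have hK := K_nonneg (l * (t - (T + η / 2)))
      by_cases ht : R < |l * (t - (T + η / 2))|
      · rw [indicator_of_mem (by exact ht)]
        have := (abs_le.mp (hB t)).1
        nlinarith
      · rw [indicator_of_notMem (by exact ht)]
        rw [not_lt, abs_mul, abs_of_pos hlpos, hl, div_mul_eq_mul_div, div_le_iff₀ hη] at ht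
        have h2 : |t - (T + η / 2)| ≤ η / 2 := by nlinarith
        rw [abs_le] at h2
        have := hcon t ⟨by linarith, by linarith⟩
        nlinarith
  have : l⁻¹ * (ε * c / 2) < l⁻¹ * ∫ s, G s := by gcongr
  linarith

open Chebyshev ArithmeticFunction

noncomputable def fψ (t : ℝ) : ℝ := if 0 < t then psi (Real.exp t) * Real.exp (-t) - 1 else 0

lemma fψ_meas : Measurable fψ := by
  unfold fψ
  refine Measurable.ite measurableSet_Ioi ?_ measurable_const
  have := psi_mono.measurable
  fun_prop

lemma fψ_bound (t : ℝ) : |fψ t| ≤ Real.log 4 + 5 := by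
  have h4 : 0 < Real.log 4 := Real.log_pos (by norm_num)
  unfold fψ
  split_ifs with h
  · have h1 := psi_le_const_mul_self (Real.exp_pos t).le
    have h2 := psi_nonneg (Real.exp t)
    have h3 : psi (Real.exp t) * Real.exp (-t) ≤ Real.log 4 + 4 := by
      rw [Real.exp_neg, ← div_eq_mul_inv, div_le_iff₀ (Real.exp_pos t)]
      exact h1
    have h5 : 0 ≤ psi (Real.exp t) * Real.exp (-t) := by positivity
    rw [abs_le]; constructor <;> linarith
  · simp; linarith

noncomputable def A (s : ℂ) : ℂ := vonMangoldt.LFunctionResidueClassAux (q := 1) 1 s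

lemma A_cont : ContinuousOn A {s | 1 ≤ s.re} := vonMangoldt.continuousOn_LFunctionResidueClassAux _

lemma A_eq (s : ℂ) (hs : 1 < s.re) : A s = LSeries (fun n => ((vonMangoldt n : ℝ) : ℂ)) s - 1 / (s - 1) := by
  have := vonMangoldt.eqOn_LFunctionResidueClassAux (q := 1) (a := 1) isUnit_one hs
  rw [A, this]
  have e : ∀ n : ℕ, vonMangoldt.residueClass (1 : ZMod 1) n = vonMangoldt n := by
    intro n
    rw [vonMangoldt.residueClass, indicator_of_mem]
    exact Subsingleton.elim _ _
  simp [e]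

noncomputable def F (s : ℂ) : ℂ := (A (1 + s) - 1) / (1 + s)

lemma F_cont : ContinuousOn F {s | 0 ≤ s.re} := by
  unfold F
  refine ContinuousOn.div (ContinuousOn.sub (A_cont.comp (by fun_prop) ?_) continuousOn_const) (by fun_prop) ?_
  · intro s hs
    have : 0 ≤ s.re := hs
    simpa using this
  · intro s hs h
    have h0 : 0 ≤ s.re := hs
    have := congrArg Complex.re h
    simp at this
    linarith

lemma exp_image : Set.image Real.exp (Set.Ioi (0:ℝ)) = Set.Ioi (1:ℝ) := by
  ext x
  constructor
  · rintro ⟨t, ht, rfl⟩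
    exact Real.one_lt_exp_iff.mpr ht
  · intro hx
    have hx' : 1 < x := hx
    exact ⟨Real.log x, Real.log_pos hx, Real.exp_log (by linarith)⟩

lemma psi_sum (x : ℝ) : (∑ k ∈ Finset.Icc 1 ⌊x⌋₊, ((vonMangoldt k : ℝ) : ℂ)) = (psi x : ℂ) := by
  rw [psi]
  push_cast
  rfl

lemma laplace (s : ℂ) (hs : 0 < s.re) :
    ∫ t in Ioi (0:ℝ), (fψ t : ℂ) * Complex.exp (-s * t) = F s := by
  have hw : (1:ℝ) < (1 + s).re := by simpa using hs
  have hO : (fun n : ℕ => ∑ k ∈ Finset.Icc 1 n, vonMangoldt k) =O[atTop] fun n : ℕ => (n : ℝ) ^ (1:ℝ) := by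
    refine Asymptotics.IsBigO.of_bound (Real.log 4 + 4) (Eventually.of_forall fun n => ?_)
    have h1 := psi_le_const_mul_self (x := n) (by positivity)
    have h2 := psi_nonneg n
    have e : ∑ k ∈ Finset.Icc 1 n, vonMangoldt k = psi n := by
      rw [psi, Nat.floor_natCast]; rfl
    rw [e, Real.rpow_one, Real.norm_eq_abs, Real.norm_eq_abs, abs_of_nonneg h2, abs_of_nonneg (by positivity)]
    exact h1
  have hL := LSeries_eq_mul_integral_of_nonneg (fun n => vonMangoldt n) zero_le_one hw hO (fun n => vonMangoldt_nonneg)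
  simp_rw [psi_sum] at hL
  rw [← exp_image, integral_image_eq_integral_abs_deriv_smul measurableSet_Ioi (fun x _ => (Real.hasDerivAt_exp x).hasDerivWithinAt) Real.exp_injective.injOn] at hL
  have e1 : ∀ t : ℝ, |Real.exp t| • ((psi (Real.exp t) : ℂ) * (Real.exp t : ℂ) ^ (-(1 + s + 1))) =
      (psi (Real.exp t) * Real.exp (-t) : ℝ) * Complex.exp (-s * t) := by
    intro t
    rw [abs_of_pos (Real.exp_pos t), Complex.real_smul, Complex.cpow_def_of_ne_zero (by simp), ← Complex.ofReal_log (Real.exp_pos t).le, Real.log_exp]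
    push_cast
    rw [mul_left_comm, ← Complex.exp_add, mul_assoc, ← Complex.exp_add]
    congr 2
    ring
  simp_rw [e1] at hL
  have hexp : IntegrableOn (fun t : ℝ => Complex.exp (-s * t)) (Ioi 0) :=
    integrableOn_exp_mul_complex_Ioi (by simpa using hs) 0
  have hexpv : ∫ t in Ioi (0:ℝ), Complex.exp (-s * t) = 1 / s := by
    rw [integral_exp_mul_complex_Ioi (by simpa using hs)]
    simp
  have hfi : IntegrableOn (fun t : ℝ => (fψ t : ℂ) * Complex.exp (-s * t)) (Ioi 0) := by
    refine hexp.bdd_mul (c := Real.log 4 + 5) ?_ ?_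
    · exact (Complex.measurable_ofReal.comp fψ_meas).aestronglyMeasurable
    · refine Eventually.of_forall fun t => ?_
      rw [Complex.norm_real]
      exact fψ_bound t
  have e2 : ∫ t in Ioi (0:ℝ), ((psi (Real.exp t) * Real.exp (-t) : ℝ) : ℂ) * Complex.exp (-s * t) =
      (∫ t in Ioi (0:ℝ), (fψ t : ℂ) * Complex.exp (-s * t)) + 1 / s := by
    rw [← hexpv, ← integral_add hfi hexp]
    refine setIntegral_congr_fun measurableSet_Ioi fun t ht => ?_
    have ht' : 0 < t := ht
    simp only [fψ, if_pos ht']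
    push_cast
    ring
  rw [e2] at hL
  have hA := A_eq (1 + s) hw
  rw [hL] at hA
  have hs0 : s ≠ 0 := by rintro rfl; simp at hs
  have hs1 : 1 + s ≠ 0 := by intro h; rw [h] at hw; simp at hw; linarith
  rw [F, hA]
  simp only [add_sub_cancel_left]
  field_simp
  ring

lemma psi_tendsto : Tendsto (fun x : ℝ => psi x / x) atTop (𝓝 1) := by
  have h0 : ∀ l : ℝ, 0 < l → Tendsto (fun T => ∫ t, fψ t * K (l * (t - T))) atTop (𝓝 0) := by
    intro l hl
    refine (tauber fψ _ F fψ_meas fψ_bound F_cont laplace l hl).congr fun T => ?_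
    refine setIntegral_eq_integral_of_forall_compl_eq_zero fun t ht => ?_
    have : ¬ 0 < t := ht
    simp [fψ, this]
  have h0' : ∀ l : ℝ, 0 < l → Tendsto (fun T => ∫ t, -fψ t * K (l * (t - T))) atTop (𝓝 0) := by
    intro l hl
    have := (h0 l hl).neg
    rw [neg_zero] at this
    refine this.congr fun T => ?_
    rw [← integral_neg]
    simp
  have hlog : Tendsto (fun t : ℝ => psi (Real.exp t) * Real.exp (-t)) atTop (𝓝 1) := by
    have hup : ∀ δ > (0:ℝ), ∀ᶠ T in atTop, psi (Real.exp T) * Real.exp (-T) ≤ (1 + δ) * Real.exp δ := by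
      intro δ hδ
      filter_upwards [hits fψ _ fψ_meas fψ_bound h0 δ δ hδ hδ, eventually_gt_atTop 0] with T ⟨t, ht, hft⟩ hT
      have htpos : 0 < t := hT.trans_le ht.1
      simp only [fψ, if_pos htpos] at hft
      have h1 : psi (Real.exp T) ≤ psi (Real.exp t) := psi_mono (Real.exp_le_exp.mpr ht.1)
      have h2 : Real.exp (-T) ≤ Real.exp (-t) * Real.exp δ := by
        rw [← Real.exp_add, Real.exp_le_exp]; linarith [ht.2]
      calc psi (Real.exp T) * Real.exp (-T) ≤ psi (Real.exp t) * (Real.exp (-t) * Real.exp δ) :=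
            mul_le_mul h1 h2 (Real.exp_pos _).le (psi_nonneg _)
        _ = (psi (Real.exp t) * Real.exp (-t)) * Real.exp δ := by ring
        _ ≤ _ := by
          refine mul_le_mul_of_nonneg_right ?_ (Real.exp_pos _).le
          linarith
    have hlo : ∀ δ > (0:ℝ), ∀ᶠ T in atTop, (1 - δ) * Real.exp (-δ) ≤ psi (Real.exp T) * Real.exp (-T) := by
      intro δ hδ
      have hT : Tendsto (fun T : ℝ => T - δ) atTop atTop := tendsto_atTop_add_const_right _ _ tendsto_id
      have hh := hT.eventually (hits (fun t => -fψ t) _ fψ_meas.neg (fun t => by rw [abs_neg]; exact fψ_bound t) h0' δ δ hδ hδ)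
      filter_upwards [hh, eventually_gt_atTop δ] with T ⟨t, ht, hft⟩ hT
      have htpos : 0 < t := by linarith [ht.1]
      simp only [fψ, if_pos htpos] at hft
      have htT : t ≤ T := by linarith [ht.2]
      have h1 : psi (Real.exp t) ≤ psi (Real.exp T) := psi_mono (Real.exp_le_exp.mpr htT)
      have h2 : Real.exp (-t) * Real.exp (-δ) ≤ Real.exp (-T) := by
        rw [← Real.exp_add, Real.exp_le_exp]; linarith [ht.1]
      calc (1 - δ) * Real.exp (-δ) ≤ (psi (Real.exp t) * Real.exp (-t)) * Real.exp (-δ) := by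
            refine mul_le_mul_of_nonneg_right ?_ (Real.exp_pos _).le
            linarith
        _ = psi (Real.exp t) * (Real.exp (-t) * Real.exp (-δ)) := by ring
        _ ≤ psi (Real.exp T) * Real.exp (-T) :=
          mul_le_mul h1 h2 (by positivity) (psi_nonneg _)
    have c1 : Tendsto (fun δ : ℝ => (1 + δ) * Real.exp δ) (𝓝[>] 0) (𝓝 1) := by
      have : Continuous (fun δ : ℝ => (1 + δ) * Real.exp δ) := by fun_prop
      simpa using (this.tendsto 0).mono_left (nhdsWithin_le_nhds (s := Ioi 0))
    have c2 : Tendsto (fun δ : ℝ => (1 - δ) * Real.exp (-δ)) (𝓝[>] 0) (𝓝 1) := by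
      have : Continuous (fun δ : ℝ => (1 - δ) * Real.exp (-δ)) := by fun_prop
      simpa using (this.tendsto 0).mono_left (nhdsWithin_le_nhds (s := Ioi 0))
    refine tendsto_order.mpr ⟨fun a ha => ?_, fun a ha => ?_⟩
    · obtain ⟨δ, h1, h2⟩ := ((c2.eventually (lt_mem_nhds ha)).and self_mem_nhdsWithin).exists
      filter_upwards [hlo δ h2] with T hT
      exact h1.trans_le hT
    · obtain ⟨δ, h1, h2⟩ := ((c1.eventually (gt_mem_nhds ha)).and self_mem_nhdsWithin).exists
      filter_upwards [hup δ h2] with T hT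
      exact hT.trans_lt h1
  refine (hlog.comp Real.tendsto_log_atTop).congr' ?_
  filter_upwards [eventually_gt_atTop 0] with x hx
  simp only [Function.comp]
  rw [Real.exp_neg, Real.exp_log hx, div_eq_mul_inv]

lemma theta_tendsto : Tendsto (fun x : ℝ => theta x / x) atTop (𝓝 1) := by
  have h : Tendsto (fun x : ℝ => (psi - theta) x / x) atTop (𝓝 0) := by
    refine (isBigO_psi_sub_theta_sqrt.trans_isLittleO ?_).tendsto_div_nhds_zero
    refine Asymptotics.isLittleO_of_tendsto' ?_ ?_
    · filter_upwards [eventually_gt_atTop (0:ℝ)] with x hx h0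
      exact absurd h0 hx.ne'
    · refine Real.tendsto_sqrt_atTop.inv_tendsto_atTop.congr fun x => ?_
      simp only [Pi.inv_apply]
      rw [Real.sqrt_div_self', one_div]
  have h2 := psi_tendsto.sub h
  rw [sub_zero] at h2
  refine h2.congr fun x => ?_
  simp only [Pi.sub_apply]
  ring

end PNTaux

/-- Asymptotics of `Φ_n`: `(log Φ_n)/n → 2 log 2 - 1` as `n → ∞`. -/
theorem Phi_asymptotics :
    Filter.Tendsto (fun n : ℕ => Real.log (Phi n) / n) Filter.atTop
      (nhds (2 * Real.log 2 - 1)) := by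
  exact Phi_asymptotics_of_PNT PNTaux.theta_tendsto
end

section
/- Fix a nonnegative integer s and δ ∈ {0,1}. Let m ≥ 2 be an integer and n = 2^m − 1, and let S_n ∈ ℚ₂ be the Volkenborn integral of A_n^{(s)}(t + 1/4), i.e. S_n = lim_{M→∞} 2^{−M} · ∑_{k=0}^{2^M−1} A_n^{(s)}(k + 1/4), the limit taken in ℚ₂ (each value A_n^{(s)}(k+1/4) is a rational number viewed in ℚ₂). Then this limit exists, S_n ≠ 0, and v₂(Φ_n^{−(s+2)} · d_n^{3s+5} · S_n) = (10s+20)·n + (s+2)·m + 2s + v₂((s+2)!) + 2; equivalently, v₂(S_n) = (10s+20)·n − (2s+3)·m + 5s + v₂((s+2)!) + 7. -/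
open Filter Finset

/-- Pochhammer symbol `(α)_k = α (α+1) ⋯ (α+k-1)` for real `α`. -/
noncomputable def pochR (α : ℝ) (k : ℕ) : ℝ := ∏ i ∈ Finset.range k, (α + i)

/-- The rational function
`A_n(t) = 2^{(6s+12)n} (4t+2n)^δ (t+1/4)_n^{s+2} (t+3/4)_n^{s+2} / (t)_{n+1}^{2s+4}`,
as a function of a real variable. -/
noncomputable def ARealfun (s δ n : ℕ) (t : ℝ) : ℝ :=
  2 ^ ((6 * s + 12) * n) * (4 * t + 2 * n) ^ δ *
    pochR (t + 1/4) n ^ (s + 2) * pochR (t + 3/4) n ^ (s + 2) / pochR t (n + 1) ^ (2 * s + 4)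

namespace Volk

open PowerSeries

/-- The linear power series `a + b (k + X)`. -/
noncomputable def lin (R : Type) [CommRing R] (a b k : ℕ) : R⟦X⟧ :=
  C ((a : R) + b * k) + C (b : R) * X

noncomputable def numS (R : Type) [CommRing R] (s δ n k : ℕ) : R⟦X⟧ :=
  lin R (1 + 2 * n) 4 k ^ δ * (∏ i ∈ range n, lin R (1 + 2 * i) 2 k) ^ (s + 2) *
    (∏ i ∈ range n, lin R (1 + i) 1 k) ^ (s + 2)

noncomputable def denS (R : Type) [CommRing R] (n k : ℕ) : R⟦X⟧ :=
  ∏ i ∈ range (n + 1), lin R (1 + 4 * i) 4 k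

theorem map_lin {R S : Type} [CommRing R] [CommRing S] (f : R →+* S) (a b k : ℕ) :
    PowerSeries.map f (lin R a b k) = lin S a b k := by
  simp [lin]

theorem map_numS {R S : Type} [CommRing R] [CommRing S] (f : R →+* S) (s δ n k : ℕ) :
    PowerSeries.map f (numS R s δ n k) = numS S s δ n k := by
  simp only [numS, map_mul, map_pow, map_prod, map_lin]

theorem map_denS {R S : Type} [CommRing R] [CommRing S] (f : R →+* S) (n k : ℕ) :
    PowerSeries.map f (denS R n k) = denS S n k := by
  simp only [denS, map_prod, map_lin]

theorem denS_const {K : Type} [Field K] [CharZero K] (n k : ℕ) :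
    constantCoeff (denS K n k) ≠ 0 := by
  simp only [denS, map_prod]
  rw [Finset.prod_ne_zero_iff]
  intro i _
  simp only [lin, map_add, map_mul, constantCoeff_C, constantCoeff_X, mul_zero, add_zero]
  norm_cast
  omega

theorem denS_ne {K : Type} [Field K] [CharZero K] (n k : ℕ) : denS K n k ≠ 0 := by
  intro h
  exact denS_const (K := K) n k (by rw [h]; simp)

/-- The rational Taylor series (up to a power of two). -/
noncomputable def GQ (s δ n k : ℕ) : ℚ⟦X⟧ :=
  numS ℚ s δ n k * (denS ℚ n k ^ (2 * s + 4))⁻¹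

theorem GQ_map {K : Type} [Field K] [CharZero K] (f : ℚ →+* K) (s δ n k : ℕ) (φ : K⟦X⟧)
    (h : φ * denS K n k ^ (2 * s + 4) = numS K s δ n k) :
    PowerSeries.map f (GQ s δ n k) = φ := by
  have h1 : GQ s δ n k * denS ℚ n k ^ (2 * s + 4) = numS ℚ s δ n k := by
    rw [GQ, mul_assoc, PowerSeries.inv_mul_cancel, mul_one]
    rw [map_pow]
    exact pow_ne_zero _ (denS_const n k)
  have h2 := congrArg (PowerSeries.map f) h1
  rw [map_mul, map_pow, map_denS, map_numS, ← h] at h2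
  exact mul_right_cancel₀ (pow_ne_zero _ (denS_ne n k)) h2

/-- `φ` is the Taylor series of `f` at `x`. -/
def TS (f : ℝ → ℝ) (x : ℝ) (φ : ℝ⟦X⟧) : Prop :=
  (∀ n : ℕ, ContDiffAt ℝ n f x) ∧ ∀ i : ℕ, iteratedDeriv i f x = i.factorial * coeff i φ

theorem TS.mul {f g : ℝ → ℝ} {x : ℝ} {φ ψ : ℝ⟦X⟧} (hf : TS f x φ) (hg : TS g x ψ) :
    TS (f * g) x (φ * ψ) := by
  refine ⟨fun n => (hf.1 n).mul (hg.1 n), fun i => ?_⟩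
  rw [iteratedDeriv_mul (hf.1 i) (hg.1 i), coeff_mul,
    Finset.Nat.sum_antidiagonal_eq_sum_range_succ_mk, Finset.mul_sum]
  refine Finset.sum_congr rfl fun j hj => ?_
  rw [hf.2, hg.2]
  have hj' : j ≤ i := by simpa [Nat.lt_succ_iff] using hj
  have := Nat.choose_mul_factorial_mul_factorial hj'
  rw [← this]
  push_cast
  ring

theorem TS.const (c x : ℝ) : TS (fun _ => c) x (C c) := by
  refine ⟨fun n => contDiffAt_const, fun i => ?_⟩
  rcases i with _ | i
  · simp
  · simp [iteratedDeriv_const]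

theorem TS.pow {f : ℝ → ℝ} {x : ℝ} {φ : ℝ⟦X⟧} (hf : TS f x φ) (n : ℕ) :
    TS (f ^ n) x (φ ^ n) := by
  induction n with
  | zero =>
    have h := TS.const 1 x
    rw [map_one] at h
    simp only [pow_zero, Finset.range_zero, Finset.prod_empty]
    exact h
  | succ n ih => rw [pow_succ, pow_succ]; exact ih.mul hf

theorem TS.prod {f : ℕ → ℝ → ℝ} {x : ℝ} {φ : ℕ → ℝ⟦X⟧} (hf : ∀ i, TS (f i) x (φ i)) (n : ℕ) :
    TS (∏ i ∈ range n, f i) x (∏ i ∈ range n, φ i) := by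
  induction n with
  | zero =>
    have h := TS.const 1 x
    rw [map_one] at h
    simp only [pow_zero, Finset.range_zero, Finset.prod_empty]
    exact h
  | succ n ih => rw [Finset.prod_range_succ, Finset.prod_range_succ]; exact ih.mul (hf n)

theorem TS.lin (a b k : ℕ) :
    TS (fun t : ℝ => a + b * (t - 1/4)) (k + 1/4) (lin ℝ a b k) := by
  refine ⟨fun n => by fun_prop, fun i => ?_⟩
  have hd : deriv (fun t : ℝ => (a : ℝ) + b * (t - 1/4)) = fun _ => (b : ℝ) := by
    funext t
    have : HasDerivAt (fun t : ℝ => (a : ℝ) + b * (t - 1/4)) (b * 1) t :=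
      (((hasDerivAt_id t).sub_const _).const_mul _).const_add _
    simp
  rcases i with _ | i
  · simp [Volk.lin]
  · rw [iteratedDeriv_succ', hd]
    rcases i with _ | i
    · simp only [Volk.lin, map_add (coeff _), coeff_C_mul, coeff_C, coeff_X]
      simp
    · simp only [Volk.lin, map_add (coeff _), coeff_C_mul, coeff_C, coeff_X]
      simp [iteratedDeriv_const]

theorem TS.unique {f : ℝ → ℝ} {x : ℝ} {φ ψ : ℝ⟦X⟧} (hf : TS f x φ) (hg : TS f x ψ) : φ = ψ := by
  ext i
  have := (hf.2 i).symm.trans (hg.2 i)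
  exact mul_left_cancel₀ (by positivity) this

theorem TS.self {f : ℝ → ℝ} {x : ℝ} (hf : ∀ n : ℕ, ContDiffAt ℝ n f x) :
    TS f x (PowerSeries.mk fun i => iteratedDeriv i f x / i.factorial) := by
  refine ⟨hf, fun i => ?_⟩
  rw [coeff_mk]
  field_simp

theorem TS.congr {f g : ℝ → ℝ} {x : ℝ} {φ : ℝ⟦X⟧} (hf : TS f x φ) (h : f =ᶠ[nhds x] g) :
    TS g x φ :=
  ⟨fun n => (hf.1 n).congr_of_eventuallyEq h.symm, fun i => by
    rw [← hf.2 i]; exact (h.iteratedDeriv_eq i).symm⟩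

theorem pow_mul_prod (c : ℝ) (n : ℕ) (f : ℕ → ℝ) :
    c ^ n * ∏ i ∈ range n, f i = ∏ i ∈ range n, c * f i := by
  rw [Finset.prod_mul_distrib, Finset.prod_const, Finset.card_range]

theorem real_identity (s δ n : ℕ) (t : ℝ) (ht : 0 < t) :
    ARealfun s δ n t * (∏ i ∈ range (n + 1), (((1 + 4 * i : ℕ) : ℝ) + (4 : ℕ) * (t - 1/4)))
        ^ (2 * s + 4) =
      2 ^ ((s + 2) * (9 * n + 4)) *
        ((((1 + 2 * n : ℕ) : ℝ) + (4 : ℕ) * (t - 1/4)) ^ δ *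
        (∏ i ∈ range n, (((1 + 2 * i : ℕ) : ℝ) + (2 : ℕ) * (t - 1/4))) ^ (s + 2) *
        (∏ i ∈ range n, (((1 + i : ℕ) : ℝ) + (1 : ℕ) * (t - 1/4))) ^ (s + 2)) := by
  have h1 : ∏ i ∈ range (n + 1), (((1 + 4 * i : ℕ) : ℝ) + (4 : ℕ) * (t - 1/4)) =
      4 ^ (n + 1) * pochR t (n + 1) := by
    rw [pochR, pow_mul_prod]
    refine Finset.prod_congr rfl fun i _ => ?_
    push_cast; ring
  have h2 : ∏ i ∈ range n, (((1 + 2 * i : ℕ) : ℝ) + (2 : ℕ) * (t - 1/4)) =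
      2 ^ n * pochR (t + 1/4) n := by
    rw [pochR, pow_mul_prod]
    refine Finset.prod_congr rfl fun i _ => ?_
    push_cast; ring
  have h3 : ∏ i ∈ range n, (((1 + i : ℕ) : ℝ) + (1 : ℕ) * (t - 1/4)) =
      pochR (t + 3/4) n := by
    rw [pochR]
    refine Finset.prod_congr rfl fun i _ => ?_
    push_cast; ring
  have h4 : (((1 + 2 * n : ℕ) : ℝ) + (4 : ℕ) * (t - 1/4)) = 4 * t + 2 * n := by
    push_cast; ring
  have hp : pochR t (n + 1) ≠ 0 := by
    rw [pochR, Finset.prod_ne_zero_iff]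
    intro i _
    positivity
  rw [h1, h2, h3, h4, ARealfun, mul_pow, mul_pow]
  rw [div_mul_eq_mul_div, div_eq_iff (pow_ne_zero _ hp)]
  have e : (2 : ℝ) ^ ((6 * s + 12) * n) * (4 ^ (n + 1)) ^ (2 * s + 4) =
      2 ^ ((s + 2) * (9 * n + 4)) * (2 ^ n) ^ (s + 2) := by
    rw [show (4 : ℝ) = 2 ^ 2 by norm_num]
    simp only [← pow_mul, ← pow_add]
    congr 1
    ring
  linear_combination ((4 * t + 2 * n) ^ δ * pochR (t + 1/4) n ^ (s + 2) *
    pochR (t + 3/4) n ^ (s + 2) * pochR t (n + 1) ^ (2 * s + 4)) * e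

theorem real_side (s δ n k i : ℕ) :
    iteratedDeriv i (ARealfun s δ n) ((k : ℝ) + 1/4) =
      ((i.factorial * 2 ^ ((s + 2) * (9 * n + 4)) * coeff i (GQ s δ n k) : ℚ) : ℝ) := by
  set x : ℝ := (k : ℝ) + 1/4 with hx
  have hx0 : 0 < x := by positivity
  have hA : ∀ N : ℕ, ContDiffAt ℝ N (ARealfun s δ n) x := by
    intro N
    have hp : ∀ (c : ℝ) (j : ℕ), ContDiffAt ℝ N (fun t => pochR (t + c) j) x := by
      intro c j
      unfold pochR
      apply ContDiff.contDiffAt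
      apply contDiff_prod
      intro i _
      fun_prop
    have hp0 : ContDiffAt ℝ N (fun t => pochR t (n + 1)) x := by
      simpa using hp 0 (n + 1)
    unfold ARealfun
    refine ContDiffAt.div ?_ (hp0.pow _) ?_
    · exact ((ContDiff.contDiffAt (by fun_prop)).mul ((hp _ _).pow _)).mul ((hp _ _).pow _)
    · apply pow_ne_zero
      rw [pochR, Finset.prod_ne_zero_iff]
      intro i _
      positivity
  have hS := TS.self hA
  set φ := PowerSeries.mk fun i => iteratedDeriv i (ARealfun s δ n) x / i.factorial with hφ
  have hD := (TS.prod (fun i => TS.lin (1 + 4 * i) 4 k) (n + 1)).pow (2 * s + 4)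
  have hN := ((TS.const (2 ^ ((s + 2) * (9 * n + 4))) x).mul
    ((((TS.lin (1 + 2 * n) 4 k).pow δ).mul
    ((TS.prod (fun i => TS.lin (1 + 2 * i) 2 k) n).pow (s + 2))).mul
    ((TS.prod (fun i => TS.lin (1 + i) 1 k) n).pow (s + 2))))
  have hM := hS.mul hD
  have hM' := hM.congr (g := _) (by
    filter_upwards [lt_mem_nhds hx0] with t ht
    have := real_identity s δ n t ht
    simp only [Pi.mul_apply, Pi.pow_apply, Finset.prod_apply]
    exact this)
  have hN' := hN.congr (g := fun t => 2 ^ ((s + 2) * (9 * n + 4)) *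
        ((((1 + 2 * n : ℕ) : ℝ) + (4 : ℕ) * (t - 1/4)) ^ δ *
        (∏ i ∈ range n, (((1 + 2 * i : ℕ) : ℝ) + (2 : ℕ) * (t - 1/4))) ^ (s + 2) *
        (∏ i ∈ range n, (((1 + i : ℕ) : ℝ) + (1 : ℕ) * (t - 1/4))) ^ (s + 2))) (by
    filter_upwards with t
    simp only [Pi.mul_apply, Pi.pow_apply, Finset.prod_apply])
  have key := hM'.unique hN'
  have h2 : (2 : ℝ) ^ ((s + 2) * (9 * n + 4)) ≠ 0 := by positivity
  have key2 : (C ((2 : ℝ) ^ ((s + 2) * (9 * n + 4)))⁻¹ * φ) * denS ℝ n k ^ (2 * s + 4) =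
      numS ℝ s δ n k := by
    rw [mul_assoc]
    change C ((2 : ℝ) ^ ((s + 2) * (9 * n + 4)))⁻¹ * (φ * (∏ i ∈ range (n + 1), _) ^ (2 * s + 4)) = _
    rw [key, ← mul_assoc, ← map_mul, inv_mul_cancel₀ h2, map_one, one_mul]
    rfl
  have h3 := GQ_map (algebraMap ℚ ℝ) s δ n k _ key2
  have h4 := congrArg (coeff i) h3
  rw [coeff_map, coeff_C_mul, hφ, coeff_mk] at h4
  have h5 : (algebraMap ℚ ℝ) (coeff i (GQ s δ n k)) = ((coeff i (GQ s δ n k) : ℚ) : ℝ) := rfl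
  rw [h5] at h4
  push_cast
  rw [h4]
  field_simp

end Volk
namespace Volk

open PowerSeries

/-- First order Taylor expansion with quadratic error term. -/
def T2 (f : ℕ → ℤ_[2]⟦X⟧) : Prop :=
  ∀ y h : ℕ, C ((h : ℤ_[2]) ^ 2) ∣ f (y + h) - f y - C (h : ℤ_[2]) * d⁄dX ℤ_[2] (f y)

theorem T2_lin (a b : ℕ) : T2 (fun y => lin ℤ_[2] a b y) := by
  intro y h
  have : lin ℤ_[2] a b (y + h) - lin ℤ_[2] a b y - C (h : ℤ_[2]) * d⁄dX ℤ_[2] (lin ℤ_[2] a b y)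
      = 0 := by
    simp only [lin, map_add, map_mul, Derivation.leibniz, derivative_C, derivative_X]
    push_cast
    simp only [map_add, map_mul, smul_eq_mul]
    ring
  rw [this]
  exact dvd_zero _

theorem T2.mul {f g : ℕ → ℤ_[2]⟦X⟧} (hf : T2 f) (hg : T2 g) : T2 (fun y => f y * g y) := by
  intro y h
  obtain ⟨u, hu⟩ := hf y h
  obtain ⟨v, hv⟩ := hg y h
  rw [map_pow] at hu hv ⊢
  have e1 : f (y + h) = f y + C (h : ℤ_[2]) * d⁄dX ℤ_[2] (f y) + C (h : ℤ_[2]) ^ 2 * u := by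
    linear_combination hu
  have e2 : g (y + h) = g y + C (h : ℤ_[2]) * d⁄dX ℤ_[2] (g y) + C (h : ℤ_[2]) ^ 2 * v := by
    linear_combination hv
  refine ⟨d⁄dX ℤ_[2] (f y) * d⁄dX ℤ_[2] (g y) + u * g (y + h) + v * f y
    + C (h : ℤ_[2]) * v * d⁄dX ℤ_[2] (f y), ?_⟩
  simp only [Derivation.leibniz, smul_eq_mul, e1, e2]
  ring

theorem T2.one : T2 (fun _ => 1) := by
  intro y h
  simp

theorem T2.pow {f : ℕ → ℤ_[2]⟦X⟧} (hf : T2 f) (n : ℕ) : T2 (fun y => f y ^ n) := by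
  induction n with
  | zero => simpa using T2.one
  | succ n ih => simp only [pow_succ]; exact ih.mul hf

theorem T2.prod {f : ℕ → ℕ → ℤ_[2]⟦X⟧} (hf : ∀ i, T2 (f i)) (n : ℕ) :
    T2 (fun y => ∏ i ∈ range n, f i y) := by
  induction n with
  | zero => simpa using T2.one
  | succ n ih => simp only [Finset.prod_range_succ]; exact ih.mul (hf n)

theorem T2.inv {f g : ℕ → ℤ_[2]⟦X⟧} (hf : T2 f) (h1 : ∀ y, g y * f y = 1) : T2 g := by
  intro y h
  obtain ⟨u, hu⟩ := hf y h
  rw [map_pow] at hu ⊢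
  have e1 : f (y + h) = f y + C (h : ℤ_[2]) * d⁄dX ℤ_[2] (f y) + C (h : ℤ_[2]) ^ 2 * u := by
    linear_combination hu
  have e3 : g y * d⁄dX ℤ_[2] (f y) + f y * d⁄dX ℤ_[2] (g y) = 0 := by
    have := congrArg (d⁄dX ℤ_[2]) (h1 y)
    simpa [Derivation.leibniz, smul_eq_mul] using this
  have e4 := h1 (y + h)
  have e5 := h1 y
  set a := f y
  set b := g y
  set a' := d⁄dX ℤ_[2] a
  set b' := d⁄dX ℤ_[2] b
  set H := C (h : ℤ_[2])
  have key : (g (y + h) - b - H * b') * f (y + h) =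
      - (H ^ 2 * (b' * a' + (b + H * b') * u)) := by
    rw [sub_mul, sub_mul, e4, e1]
    linear_combination -e5 - H * e3
  refine ⟨-(b' * a' + (b + H * b') * u) * g (y + h), ?_⟩
  calc g (y + h) - b - H * b' = ((g (y + h) - b - H * b') * f (y + h)) * g (y + h) := by
        linear_combination -(g (y + h) - b - H * b') * e4
    _ = _ := by rw [key]; ring

theorem T2.coeff_lip {f : ℕ → ℤ_[2]⟦X⟧} (hf : T2 f) (i y h : ℕ) :
    (h : ℤ_[2]) ∣ coeff i (f (y + h)) - coeff i (f y) := by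
  obtain ⟨u, hu⟩ := hf y h
  have := congrArg (coeff i) hu
  rw [map_sub, map_sub, coeff_C_mul, coeff_C_mul] at this
  exact ⟨coeff i (d⁄dX ℤ_[2] (f y)) + h * coeff i u, by linear_combination this⟩

theorem T2.coeff_quad {f : ℕ → ℤ_[2]⟦X⟧} (hf : T2 f) (i y h : ℕ) :
    (h : ℤ_[2]) ^ 2 ∣ coeff i (f (y + h)) - coeff i (f y) - h * (coeff (i + 1) (f y) * (i + 1)) := by
  obtain ⟨u, hu⟩ := hf y h
  have := congrArg (coeff i) hu
  rw [map_sub, map_sub, coeff_C_mul, coeff_C_mul, coeff_derivative] at this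
  exact ⟨_, this⟩

theorem sum_double (g : ℕ → ℤ_[2]) (M : ℕ) :
    ∑ y ∈ range (2 ^ (M + 1)), g y =
      2 * ∑ y ∈ range (2 ^ M), g y + ∑ y ∈ range (2 ^ M), (g (y + 2 ^ M) - g y) := by
  rw [pow_succ, mul_two, Finset.sum_range_add, Finset.sum_sub_distrib]
  simp only [add_comm (2 ^ M)]
  ring

theorem avg2 (g : ℕ → ℤ_[2]) (hg : ∀ y h : ℕ, 2 * (h : ℤ_[2]) ∣ g (y + h) - g y) (M : ℕ) :
    (2 : ℤ_[2]) ^ M ∣ ∑ y ∈ range (2 ^ M), g y := by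
  induction M with
  | zero => simp
  | succ M ih =>
    rw [sum_double]
    refine dvd_add ?_ (Finset.dvd_sum fun y _ => ?_)
    · rw [pow_succ, mul_comm]
      exact mul_dvd_mul_left _ ih
    · have := hg y (2 ^ M)
      rw [pow_succ, mul_comm]
      push_cast at this
      exact this

theorem avg4 (g : ℕ → ℤ_[2]) (hg : ∀ y h : ℕ, 4 * (h : ℤ_[2]) ∣ g (y + h) - g y) (M : ℕ) :
    (2 : ℤ_[2]) ^ (M + 1) ∣ ∑ y ∈ range (2 ^ M), g y - 2 ^ M * g 0 := by
  induction M with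
  | zero => simp
  | succ M ih =>
    rw [sum_double, show 2 * ∑ y ∈ range (2 ^ M), g y + ∑ y ∈ range (2 ^ M), (g (y + 2 ^ M) - g y)
      - 2 ^ (M + 1) * g 0 = 2 * (∑ y ∈ range (2 ^ M), g y - 2 ^ M * g 0) +
      ∑ y ∈ range (2 ^ M), (g (y + 2 ^ M) - g y) by ring]
    refine dvd_add ?_ (Finset.dvd_sum fun y _ => ?_)
    · rw [pow_succ _ (M + 1), mul_comm _ (2 : ℤ_[2])]
      exact mul_dvd_mul_left _ ih
    · have := hg y (2 ^ M)
      push_cast at this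
      rw [show (2 : ℤ_[2]) ^ (M + 1 + 1) = 4 * 2 ^ M by ring]
      exact this

theorem avg1 (g : ℕ → ℤ_[2]) (hg : ∀ y h : ℕ, (h : ℤ_[2]) ∣ g (y + h) - g y) (M : ℕ) :
    (2 : ℤ_[2]) ^ M ∣ 2 * ∑ y ∈ range (2 ^ M), g y := by
  rw [Finset.mul_sum]
  apply avg2
  intro y h
  rw [← mul_sub]
  exact mul_dvd_mul_left _ (hg y h)

theorem T2.step {f : ℕ → ℤ_[2]⟦X⟧} (hf : T2 f) (i M : ℕ) :
    (2 : ℤ_[2]) ^ (2 * M) ∣ 2 * (∑ y ∈ range (2 ^ (M + 1)), coeff i (f y) -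
      2 * ∑ y ∈ range (2 ^ M), coeff i (f y)) := by
  rw [sum_double, add_sub_cancel_left]
  have h1 : ∑ y ∈ range (2 ^ M), (coeff i (f (y + 2 ^ M)) - coeff i (f y)) =
      ∑ y ∈ range (2 ^ M), (coeff i (f (y + 2 ^ M)) - coeff i (f y)
        - ((2 ^ M : ℕ) : ℤ_[2]) * (coeff (i + 1) (f y) * (i + 1))) +
      2 ^ M * (∑ y ∈ range (2 ^ M), coeff (i + 1) (f y)) * (i + 1) := by
    rw [Finset.sum_sub_distrib (f := fun y => coeff i (f (y + 2 ^ M)) - coeff i (f y)),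
      ← Finset.mul_sum, ← Finset.sum_mul]
    push_cast
    ring
  rw [h1, mul_add]
  refine dvd_add (Dvd.dvd.mul_left (Finset.dvd_sum fun y _ => ?_) _) ?_
  · have := hf.coeff_quad i y (2 ^ M)
    rw [mul_comm 2 M, pow_mul]
    rw [show ((2 : ℤ_[2]) ^ M) = ((2 ^ M : ℕ) : ℤ_[2]) by push_cast; rfl]
    exact this
  · obtain ⟨z, hz⟩ := avg1 (fun y => coeff (i + 1) (f y)) (fun y h => hf.coeff_lip _ y h) M
    refine ⟨z * (i + 1), ?_⟩
    rw [two_mul M, pow_add]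
    linear_combination (2 : ℤ_[2]) ^ M * (i + 1) * hz

theorem T2.tendsto {f : ℕ → ℤ_[2]⟦X⟧} (hf : T2 f) (i : ℕ) :
    ∃ S : ℚ_[2], Tendsto (fun M : ℕ => (2 ^ M : ℚ_[2])⁻¹ *
      ((∑ k ∈ range (2 ^ M), coeff i (f k) : ℤ_[2]) : ℚ_[2])) atTop (nhds S) := by
  apply cauchySeq_tendsto_of_complete
  apply cauchySeq_of_le_geometric (1/2) 4 (by norm_num)
  intro M
  obtain ⟨z, hz⟩ := hf.step i M
  set a := ∑ y ∈ range (2 ^ (M + 1)), coeff i (f y)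
  set b := ∑ y ∈ range (2 ^ M), coeff i (f y)
  have hz' : (2 : ℚ_[2]) * ((a : ℚ_[2]) - 2 * b) = 2 ^ (2 * M) * z := by
    exact_mod_cast congrArg (fun x : ℤ_[2] => (x : ℚ_[2])) hz
  rw [dist_comm, dist_eq_norm]
  have e : ((2 : ℚ_[2]) ^ (M + 1))⁻¹ * (a : ℚ_[2]) - (2 ^ M)⁻¹ * b = 2 ^ M * z / 4 := by
    have h2 : (2 : ℚ_[2]) ^ M ≠ 0 := pow_ne_zero _ two_ne_zero
    rw [two_mul M, pow_add] at hz'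
    rw [pow_succ]
    field_simp
    linear_combination 2 * hz'
  rw [e]
  have n2 : ‖(2 : ℚ_[2])‖ = 1/2 := by
    have := Padic.norm_p (p := 2)
    simpa using this
  have n4 : ‖(4 : ℚ_[2])‖ = 1/4 := by
    rw [show (4 : ℚ_[2]) = 2 * 2 by norm_num, norm_mul, n2]; norm_num
  rw [norm_div, norm_mul, norm_pow, n2, n4]
  have := PadicInt.norm_le_one z
  have hz1 : ‖(z : ℚ_[2])‖ ≤ 1 := by simpa using this
  have : (0 : ℝ) < (1/2) ^ M := by positivity
  rw [div_le_iff₀ (by norm_num)]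
  nlinarith

end Volk
namespace Volk

open PowerSeries

theorem isUnit_odd {a : ℕ} (ha : Odd a) : IsUnit (a : ℤ_[2]) := by
  by_contra h
  rw [PadicInt.not_isUnit_iff] at h
  have h2 := (PadicInt.norm_int_lt_one_iff_dvd (p := 2) (a : ℤ)).1 (by simpa using h)
  have : 2 ∣ a := by exact_mod_cast h2
  rcases ha with ⟨b, hb⟩
  omega

theorem isUnit_add_two {u z : ℤ_[2]} (hu : IsUnit u) : IsUnit (u + 2 * z) := by
  by_contra h
  rw [PadicInt.not_isUnit_iff] at h
  rw [PadicInt.isUnit_iff] at hu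
  have h2 : ‖(2 : ℤ_[2]) * z‖ < 1 := by
    have := PadicInt.norm_p (p := 2)
    rw [norm_mul]
    have h3 : ‖(2 : ℤ_[2])‖ = 1/2 := by simpa using this
    have := PadicInt.norm_le_one z
    rw [h3]; linarith
  have h4 : ‖u‖ ≤ max ‖u + 2 * z‖ ‖-(2 * z)‖ := by
    have := PadicInt.nonarchimedean (u + 2 * z) (-(2 * z))
    simpa using this
  rw [norm_neg] at h4
  have := max_lt h h2
  linarith

theorem rescale_C {R : Type} [CommRing R] (c a : R) : rescale c (C a) = C a := by
  ext i
  rw [coeff_rescale, coeff_C]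
  rcases i with _ | i <;> simp

/-- The 2-part of `(q+1)(q+2)`. -/
theorem two_part (q : ℕ) : ∃ t : ℕ, ∃ u : ℤ_[2], IsUnit u ∧ 2 ^ t ≤ q + 2 ∧
    ((q : ℤ_[2]) + 1) * (q + 2) = 2 ^ t * u := by
  rcases Nat.even_or_odd (q + 1) with h | h
  · obtain ⟨t, o, ho, e⟩ := Nat.exists_eq_two_pow_mul_odd (n := q + 1) (by omega)
    refine ⟨t, o * ((q + 2 : ℕ) : ℤ_[2]), (isUnit_odd ho).mul (isUnit_odd ?_), ?_, ?_⟩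
    · have := h.add_one; exact this
    · have : 2 ^ t ∣ q + 1 := ⟨o, e⟩
      have := Nat.le_of_dvd (by omega) this
      omega
    · have : (q : ℤ_[2]) + 1 = 2 ^ t * o := by exact_mod_cast congrArg (Nat.cast (R := ℤ_[2])) e
      rw [this]; push_cast; ring
  · obtain ⟨t, o, ho, e⟩ := Nat.exists_eq_two_pow_mul_odd (n := q + 2) (by omega)
    refine ⟨t, o * ((q + 1 : ℕ) : ℤ_[2]), (isUnit_odd ho).mul (isUnit_odd h), ?_, ?_⟩
    · have : 2 ^ t ∣ q + 2 := ⟨o, e⟩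
      exact Nat.le_of_dvd (by omega) this
    · have : (q : ℤ_[2]) + 2 = 2 ^ t * o := by exact_mod_cast congrArg (Nat.cast (R := ℤ_[2])) e
      rw [this]; push_cast; ring

theorem choose_two' (s : ℕ) : (2 : ℤ_[2]) * ((s + 2).choose 2 : ℕ) = (s + 1) * (s + 2) := by
  have h := Nat.triangle_succ (s + 1)
  have h2 : (s + 2).choose 2 * 2 = (s + 2) * (s + 1) := by
    rw [Nat.choose_two_right, Nat.div_mul_cancel]
    · rfl
    · exact (Nat.even_mul_pred_self (s + 2)).two_dvd
  have h3 := congrArg (Nat.cast (R := ℤ_[2])) h2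
  push_cast at h3
  linear_combination h3

theorem dvd_two_pow (s : ℕ) : (2 : ℤ_[2]) * ((s + 2).choose 2 : ℕ) ∣ 2 ^ (s + 2) := by
  rw [choose_two']
  obtain ⟨t, u, hu, ht, e⟩ := two_part s
  rw [e]
  have : t ≤ s + 2 := by
    have h1 : t < 2 ^ t := Nat.lt_two_pow_self
    omega
  rw [mul_comm, hu.mul_left_dvd]
  exact pow_dvd_pow _ this

theorem dvd_choose (s q : ℕ) (hq : 1 ≤ q) :
    (2 : ℤ_[2]) * ((s + 2).choose 2 : ℕ) ∣ 2 ^ q * ((s + 2).choose (q + 2) : ℕ) := by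
  obtain ⟨t, u, hu, ht, e⟩ := two_part q
  have hlt : q + 2 < 2 ^ (q + 1) := by
    clear ht e hu
    induction q, hq using Nat.le_induction with
    | base => norm_num
    | succ q hq ih => rw [pow_succ]; omega
  have htq : t ≤ q := by
    have := (Nat.pow_lt_pow_iff_right (by norm_num : 1 < 2)).1 (lt_of_le_of_lt ht hlt)
    omega
  have h1 : (s + 2).choose (q + 2) * ((q + 2) * (q + 1)) = (s + 2) * (s + 1) * s.choose q := by
    have a1 := Nat.add_one_mul_choose_eq (s + 1) (q + 1)
    have a2 := Nat.add_one_mul_choose_eq s q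
    calc (s + 2).choose (q + 2) * ((q + 2) * (q + 1))
        = ((s + 1 + 1).choose (q + 1 + 1) * (q + 1 + 1)) * (q + 1) := by ring
      _ = (s + 1 + 1) * ((s + 1).choose (q + 1) * (q + 1)) := by rw [← a1]; ring
      _ = _ := by rw [← a2]; ring
  have h2 := congrArg (Nat.cast (R := ℤ_[2])) h1
  push_cast at h2
  rw [choose_two']
  obtain ⟨v, hv⟩ := hu.exists_left_inv
  obtain ⟨d, rfl⟩ := Nat.exists_eq_add_of_le htq
  refine ⟨2 ^ d * (s.choose (t + d) : ℕ) * v, ?_⟩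
  rw [pow_add]
  push_cast at e h2 ⊢
  linear_combination (-(2 : ℤ_[2]) ^ t * 2 ^ d * ((s + 2).choose (t + d + 2) : ℕ)) * hv
    + (v * 2 ^ d) * h2 - (v * 2 ^ d * ((s + 2).choose (t + d + 2) : ℕ)) * e

theorem coeff_lin_pow (a b y N p : ℕ) :
    coeff p (lin ℤ_[2] a b y ^ N) = (N.choose p : ℕ) * ((a : ℤ_[2]) + b * y) ^ (N - p) * b ^ p := by
  have h : lin ℤ_[2] a b y ^ N = rescale (b : ℤ_[2])
      (((Polynomial.X + Polynomial.C ((a : ℤ_[2]) + b * y)) ^ N : Polynomial ℤ_[2]) : ℤ_[2]⟦X⟧) := by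
    rw [Polynomial.coe_pow, map_pow, Polynomial.coe_add, Polynomial.coe_X, Polynomial.coe_C,
      map_add, rescale_X, rescale_C, add_comm, lin]
  rw [h, coeff_rescale, Polynomial.coeff_coe, Polynomial.coeff_X_add_C_pow]
  ring

/-- Lipschitz families of power series. -/
def Lip (c : ℤ_[2]) (ψ : ℕ → ℤ_[2]⟦X⟧) : Prop :=
  ∀ y h : ℕ, C (c * (h : ℤ_[2])) ∣ ψ (y + h) - ψ y

theorem Lip.mul {c : ℤ_[2]} {f g : ℕ → ℤ_[2]⟦X⟧} (hf : Lip c f) (hg : Lip c g) :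
    Lip c (fun y => f y * g y) := by
  intro y h
  have : f (y + h) * g (y + h) - f y * g y =
    f (y + h) * (g (y + h) - g y) + (f (y + h) - f y) * g y := by ring
  simp only [this]
  exact dvd_add (Dvd.dvd.mul_left (hg y h) _) (Dvd.dvd.mul_right (hf y h) _)

theorem Lip.inv {c : ℤ_[2]} {f g : ℕ → ℤ_[2]⟦X⟧} (hf : Lip c f) (h1 : ∀ y, g y * f y = 1) :
    Lip c g := by
  intro y h
  have : g (y + h) - g y = - (f (y + h) - f y) * (g y * g (y + h)) := by
    linear_combination -g (y + h) * h1 y + g y * h1 (y + h)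
  rw [this]
  exact Dvd.dvd.mul_right ((dvd_neg).2 (hf y h)) _

theorem Lip.coeff {c : ℤ_[2]} {f : ℕ → ℤ_[2]⟦X⟧} (hf : Lip c f) (i y h : ℕ) :
    c * (h : ℤ_[2]) ∣ coeff i (f (y + h)) - coeff i (f y) := by
  obtain ⟨u, hu⟩ := hf y h
  have := congrArg (PowerSeries.coeff i) hu
  rw [map_sub, coeff_C_mul] at this
  exact ⟨_, this⟩

/-- Families `φ (c (y + X))`. -/
def EE (c : ℤ_[2]) (f : ℕ → ℤ_[2]⟦X⟧) : Prop :=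
  ∃ ψ : ℕ → ℤ_[2]⟦X⟧, Lip c ψ ∧ ∀ y, f y = rescale c (ψ y)

/-- Unit families `φ (c (y + X))`. -/
def EU (c : ℤ_[2]) (f : ℕ → ℤ_[2]⟦X⟧) : Prop :=
  ∃ ψ : ℕ → ℤ_[2]⟦X⟧, Lip c ψ ∧ (∀ y, IsUnit (ψ y)) ∧ ∀ y, f y = rescale c (ψ y)

theorem EU.toEE {c : ℤ_[2]} {f : ℕ → ℤ_[2]⟦X⟧} (hf : EU c f) : EE c f := by
  obtain ⟨ψ, h1, _, h3⟩ := hf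
  exact ⟨ψ, h1, h3⟩

theorem EE.mul {c : ℤ_[2]} {f g : ℕ → ℤ_[2]⟦X⟧} (hf : EE c f) (hg : EE c g) :
    EE c (fun y => f y * g y) := by
  obtain ⟨ψ, h1, h3⟩ := hf
  obtain ⟨φ, k1, k3⟩ := hg
  exact ⟨_, h1.mul k1, fun y => by simp only [map_mul, h3, k3]⟩

theorem EU.mul {c : ℤ_[2]} {f g : ℕ → ℤ_[2]⟦X⟧} (hf : EU c f) (hg : EU c g) :
    EU c (fun y => f y * g y) := by
  obtain ⟨ψ, h1, h2, h3⟩ := hf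
  obtain ⟨φ, k1, k2, k3⟩ := hg
  exact ⟨_, h1.mul k1, fun y => (h2 y).mul (k2 y), fun y => by simp only [map_mul, h3, k3]⟩

theorem EE.const (c a : ℤ_[2]) : EE c (fun _ => C a) :=
  ⟨fun _ => C a, fun y h => by simp, fun y => by simp [rescale_C]⟩

theorem EU.one (c : ℤ_[2]) : EU c (fun _ => 1) :=
  ⟨fun _ => 1, fun y h => by simp, fun y => isUnit_one, fun y => by simp⟩

theorem EU.pow {c : ℤ_[2]} {f : ℕ → ℤ_[2]⟦X⟧} (hf : EU c f) (n : ℕ) : EU c (fun y => f y ^ n) := by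
  induction n with
  | zero => simpa using EU.one c
  | succ n ih => simp only [pow_succ]; exact ih.mul hf

theorem EE.pow {c : ℤ_[2]} {f : ℕ → ℤ_[2]⟦X⟧} (hf : EE c f) (n : ℕ) : EE c (fun y => f y ^ n) := by
  induction n with
  | zero => simpa using (EU.one c).toEE
  | succ n ih => simp only [pow_succ]; exact ih.mul hf

theorem EU.prod {c : ℤ_[2]} {f : ℕ → ℕ → ℤ_[2]⟦X⟧} (S : Finset ℕ) (hf : ∀ i ∈ S, EU c (f i)) :
    EU c (fun y => ∏ i ∈ S, f i y) := by
  classical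
  induction S using Finset.induction_on with
  | empty => simpa using EU.one c
  | insert a S ha ih =>
    simp only [Finset.prod_insert ha]
    exact (hf a (Finset.mem_insert_self _ _)).mul
      (ih fun i hi => hf i (Finset.mem_insert_of_mem hi))

theorem EU.inv {c : ℤ_[2]} {f g : ℕ → ℤ_[2]⟦X⟧} (hf : EU c f) (h : ∀ y, g y * f y = 1) :
    EU c g := by
  obtain ⟨ψ, h1, h2, h3⟩ := hf
  choose v hv using fun y => (h2 y).exists_left_inv
  refine ⟨v, h1.inv hv, fun y => IsUnit.of_mul_eq_one _ (hv y), fun y => ?_⟩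
  have e := congrArg (rescale c) (hv y)
  rw [map_mul, map_one, ← h3] at e
  calc g y = (rescale c (v y) * f y) * g y := by rw [e, one_mul]
    _ = rescale c (v y) * (g y * f y) := by ring
    _ = _ := by rw [h, mul_one]

theorem EE_lin (c a b : ℕ) : EE (c : ℤ_[2]) (fun y => lin ℤ_[2] a (c * b) y) := by
  refine ⟨fun y => C ((a : ℤ_[2]) + (c * b : ℕ) * y) + C (b : ℤ_[2]) * X, fun y h => ?_, fun y => ?_⟩
  · refine ⟨C (b : ℤ_[2]), ?_⟩
    push_cast
    simp only [map_add, map_mul]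
    ring
  · simp only [lin, map_add (rescale _), map_mul (rescale _), rescale_C, rescale_X]
    push_cast
    simp only [map_mul]
    ring

theorem EU_lin (c a b : ℕ) (ha : Odd a) (hc : Even c) :
    EU (c : ℤ_[2]) (fun y => lin ℤ_[2] a (c * b) y) := by
  refine ⟨fun y => C ((a : ℤ_[2]) + (c * b : ℕ) * y) + C (b : ℤ_[2]) * X, fun y h => ?_,
    fun y => ?_, fun y => ?_⟩
  · refine ⟨C (b : ℤ_[2]), ?_⟩
    push_cast
    simp only [map_add, map_mul]
    ring
  · rw [isUnit_iff_constantCoeff]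
    simp only [map_add, map_mul, constantCoeff_C, constantCoeff_X, mul_zero, add_zero]
    have h1 : Odd (a + c * b * y) := ha.add_even (by simp [Nat.even_mul, hc])
    exact_mod_cast isUnit_odd h1
  · simp only [lin, map_add (rescale _), map_mul (rescale _), rescale_C, rescale_X]
    push_cast
    simp only [map_mul]
    ring

theorem sumB (s M : ℕ) (φ : ℕ → ℤ_[2]⟦X⟧) (hφ : EE 2 φ) :
    ∃ z : ℤ_[2], ∑ y ∈ range (2 ^ M), coeff s (C ((2 : ℤ_[2]) ^ (s + 2)) * φ y) =
      2 ^ (s + M) * ((s + 2).choose 2 : ℕ) * (2 * z) := by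
  obtain ⟨ψ, h1, h3⟩ := hφ
  obtain ⟨w, hw⟩ := avg2 (fun y => coeff s (ψ y)) (fun y h => h1.coeff s y h) M
  obtain ⟨d, hd⟩ := dvd_two_pow s
  refine ⟨d * w, ?_⟩
  simp only [coeff_C_mul, h3, coeff_rescale]
  rw [← Finset.mul_sum, ← Finset.mul_sum, hw, hd, pow_add]
  ring

theorem sumA (s M a : ℕ) (T : ℕ → ℤ_[2]⟦X⟧) (hT : EU 4 T) :
    ∃ u z : ℤ_[2], IsUnit u ∧ ∑ y ∈ range (2 ^ M), coeff s (lin ℤ_[2] a 2 y ^ (s + 2) * T y) =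
      2 ^ (s + M) * ((s + 2).choose 2 : ℕ) * ((a : ℤ_[2]) ^ 2 * u + 2 * z) := by
  obtain ⟨ψ, h1, h2, h3⟩ := hT
  have hlin : Lip 2 (fun y => C ((a : ℤ_[2]) + 2 * y)) := by
    intro y h
    refine ⟨1, ?_⟩
    push_cast
    simp only [map_add, map_mul]
    ring
  have hpow : ∀ q, Lip 2 (fun y => C ((a : ℤ_[2]) + 2 * y) ^ q) := by
    intro q
    induction q with
    | zero => intro y h; simp
    | succ n ih => simp only [pow_succ]; exact ih.mul hlin
  have h12 : Lip 2 ψ := by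
    intro y h
    refine dvd_trans ?_ (h1 y h)
    exact ⟨C 2, by rw [← map_mul]; congr 1; ring⟩
  have hsq : Lip 4 (fun y => C ((a : ℤ_[2]) + 2 * y) ^ 2) := by
    intro y h
    refine ⟨C ((a : ℤ_[2]) + 2 * y + h), ?_⟩
    simp only [← map_pow, ← map_sub, ← map_mul]
    push_cast
    congr 1
    ring
  have hc : ∀ y, coeff s (lin ℤ_[2] a 2 y ^ (s + 2) * T y) =
      ∑ q ∈ range (s + 1), 2 ^ s * (2 ^ q * ((s + 2).choose (q + 2) : ℕ)) *
        coeff q (C ((a : ℤ_[2]) + 2 * y) ^ (q + 2) * ψ y) := by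
    intro y
    rw [mul_comm, coeff_mul, Finset.Nat.sum_antidiagonal_eq_sum_range_succ_mk]
    refine Finset.sum_congr rfl fun q hq => ?_
    have hq' : q ≤ s := by simpa [Nat.lt_succ_iff] using hq
    obtain ⟨p, rfl⟩ := Nat.exists_eq_add_of_le hq'
    simp only []
    rw [coeff_lin_pow, h3, coeff_rescale, ← map_pow, coeff_C_mul, Nat.add_sub_cancel_left,
      show q + p + 2 - p = q + 2 by omega,
      Nat.choose_symm_of_eq_add (show q + p + 2 = p + (q + 2) by omega),
      show (4 : ℤ_[2]) = 2 * 2 by norm_num, mul_pow, pow_add]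
    push_cast
    ring
  have h0 : (2 : ℤ_[2]) ^ (M + 1) ∣
      ∑ y ∈ range (2 ^ M), coeff 0 (C ((a : ℤ_[2]) + 2 * y) ^ 2 * ψ y) -
        2 ^ M * coeff 0 (C ((a : ℤ_[2]) + 2 * (0 : ℕ)) ^ 2 * ψ 0) :=
    avg4 (fun y => coeff 0 (C ((a : ℤ_[2]) + 2 * y) ^ 2 * ψ y))
      (fun y h => (hsq.mul h1).coeff 0 y h) M
  obtain ⟨w, hw⟩ := h0
  have hq : ∀ q, ∃ z, 1 ≤ q → (2 ^ q * ((s + 2).choose (q + 2) : ℕ)) *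
      ∑ y ∈ range (2 ^ M), coeff q (C ((a : ℤ_[2]) + 2 * y) ^ (q + 2) * ψ y) =
      2 ^ M * ((s + 2).choose 2 : ℕ) * (2 * z) := by
    intro q
    by_cases h : 1 ≤ q
    · obtain ⟨d, hd⟩ := dvd_choose s q h
      obtain ⟨v, hv⟩ := avg2 (fun y => coeff q (C ((a : ℤ_[2]) + 2 * y) ^ (q + 2) * ψ y))
        (fun y h => ((hpow (q + 2)).mul h12).coeff q y h) M
      refine ⟨d * v, fun _ => ?_⟩
      rw [hd, hv]
      ring
    · exact ⟨0, fun h' => absurd h' h⟩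
  choose Z hZ using hq
  refine ⟨coeff 0 (ψ 0), w + ∑ q ∈ range s, Z (q + 1), ?_, ?_⟩
  · have := isUnit_iff_constantCoeff.1 (h2 0)
    simpa using this
  · simp only [hc]
    rw [Finset.sum_comm]
    simp only [← Finset.mul_sum]
    rw [Finset.sum_range_succ']
    have e1 : ∑ q ∈ range s, (2 : ℤ_[2]) ^ s * (2 ^ (q + 1) * ((s + 2).choose (q + 1 + 2) : ℕ)) *
        ∑ y ∈ range (2 ^ M), coeff (q + 1) (C ((a : ℤ_[2]) + 2 * y) ^ (q + 1 + 2) * ψ y) =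
        2 ^ s * (2 ^ M * ((s + 2).choose 2 : ℕ) * (2 * ∑ q ∈ range s, Z (q + 1))) := by
      simp only [Finset.mul_sum (range s)]
      refine Finset.sum_congr rfl fun q _ => ?_
      have := hZ (q + 1) (by omega)
      rw [← this, mul_assoc]
    rw [e1]
    have e2 : coeff 0 (C ((a : ℤ_[2]) + 2 * (0 : ℕ)) ^ 2 * ψ 0) = (a : ℤ_[2]) ^ 2 * coeff 0 (ψ 0) := by
      rw [← map_pow, coeff_C_mul]
      simp
    rw [e2] at hw
    simp only [zero_add, pow_zero, one_mul]
    rw [pow_add]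
    linear_combination (2 : ℤ_[2]) ^ s * ((s + 2).choose 2 : ℕ) * hw

end Volk
namespace Volk

open PowerSeries

theorem rescale_lin (m a b j y : ℕ) :
    rescale ((2 : ℤ_[2]) ^ m) (lin ℤ_[2] a b (j + 2 ^ m * y)) =
      lin ℤ_[2] (a + b * j) (b * 2 ^ m) y := by
  simp only [lin, map_add (rescale _), map_mul (rescale _), rescale_C, rescale_X]
  push_cast
  simp only [map_mul, map_add, map_pow]
  ring

theorem lin_smul (d a b y : ℕ) : lin ℤ_[2] (d * a) (d * b) y = C (d : ℤ_[2]) * lin ℤ_[2] a b y := by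
  simp only [lin]
  push_cast
  simp only [map_mul, map_add]
  ring

theorem fac (m r ε : ℕ) (h1 : 1 ≤ r) (h2 : r < 2 ^ m) :
    ∃ f : ℕ → ℤ_[2]⟦X⟧, EU 2 f ∧ (r ≠ 2 ^ (m - 1) → EU 4 f) ∧
      ∀ y, lin ℤ_[2] (r + 2 ^ m * ε) (2 ^ m) y = C ((2 : ℤ_[2]) ^ padicValNat 2 r) * f y := by
  obtain ⟨t, o, ho, e⟩ := Nat.exists_eq_two_pow_mul_odd (n := r) (by omega)
  have ho1 : 1 ≤ o := ho.pos
  have hv : padicValNat 2 r = t := by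
    rw [e, padicValNat.mul (by positivity) (by omega), padicValNat.prime_pow,
      padicValNat.eq_zero_of_not_dvd, add_zero]
    have := ho.not_two_dvd_nat
    exact this
  have htm : t < m := by
    have h3 : 2 ^ t ≤ r := by rw [e]; exact Nat.le_mul_of_pos_right _ ho1
    exact (Nat.pow_lt_pow_iff_right (by norm_num : 1 < 2)).1 (lt_of_le_of_lt h3 h2)
  obtain ⟨d, rfl⟩ := Nat.exists_eq_add_of_le htm
  have hodd : ∀ x, Odd (o + 2 * x) := fun x => ho.add_even (even_two_mul x)
  refine ⟨fun y => lin ℤ_[2] (o + 2 * (2 ^ d * ε)) (2 * 2 ^ d) y, ?_, ?_, ?_⟩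
  · exact_mod_cast EU_lin 2 _ _ (hodd _) even_two
  · intro hr
    have hd : 1 ≤ d := by
      by_contra hd
      have hd0 : d = 0 := by omega
      subst hd0
      apply hr
      have : o < 2 := by
        rw [e] at h2
        have h4 : 2 ^ (t.succ + 0) = 2 ^ t * 2 := by rw [add_zero, pow_succ]
        rw [h4] at h2
        exact lt_of_mul_lt_mul_left h2 (by positivity)
      have : o = 1 := by omega
      rw [e, this]
      simp
    obtain ⟨d', rfl⟩ := Nat.exists_eq_add_of_le hd
    have := EU_lin 4 (o + 2 * (2 ^ (1 + d') * ε)) (2 ^ d') (hodd _) (by decide)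
    rw [show 2 * 2 ^ (1 + d') = 4 * 2 ^ d' by rw [pow_add]; ring]
    exact_mod_cast this
  · intro y
    have e1 : r + 2 ^ (t.succ + d) * ε = 2 ^ t * (o + 2 * (2 ^ d * ε)) := by
      rw [e, Nat.succ_eq_add_one, pow_add, pow_add]; ring
    have e2 : 2 ^ (t.succ + d) = 2 ^ t * (2 * 2 ^ d) := by
      rw [Nat.succ_eq_add_one, pow_add, pow_add]; ring
    rw [e1, e2, lin_smul, hv]
    push_cast
    rfl

/-- Total 2-adic valuation. -/
def ee (m : ℕ) : ℕ := ∑ r ∈ Ico 1 (2 ^ m), padicValNat 2 r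

theorem sum_val (N : ℕ) : ∑ r ∈ Ico 1 (N + 1), padicValNat 2 r = padicValNat 2 N.factorial := by
  induction N with
  | zero => simp
  | succ N ih =>
    rw [Finset.sum_Ico_succ_top (by omega), ih, Nat.factorial_succ,
      padicValNat.mul (by omega) (Nat.factorial_ne_zero _), add_comm]

theorem val_fact (m : ℕ) : padicValNat 2 (2 ^ m).factorial + 1 = 2 ^ m := by
  induction m with
  | zero => simp
  | succ m ih =>
    have e : 2 ^ (m + 1) = 2 * 2 ^ m := by ring
    rw [e, padicValNat_factorial_mul]
    omega

theorem ee_eq (m : ℕ) : ee m + m = 2 ^ m - 1 := by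
  have h := sum_val (2 ^ m - 1)
  have h1 := Nat.one_le_two_pow (n := m)
  rw [Nat.sub_add_cancel h1] at h
  have h2 := val_fact m
  have h3 : (2 ^ m).factorial = 2 ^ m * (2 ^ m - 1).factorial :=
    (Nat.mul_factorial_pred (by omega)).symm
  rw [h3, padicValNat.mul (by omega) (Nat.factorial_ne_zero _), padicValNat.prime_pow] at h2
  unfold ee
  omega

theorem reindex {α : Type} [CommMonoid α] (g : ℕ → α) (N j : ℕ) (hj : 1 ≤ j) (hjN : j < N) :
    ∏ i ∈ range (N - 1), g (1 + i + j) =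
      g N * ∏ r ∈ (Ico 1 N).erase j, g (r + N * (if r < j then 1 else 0)) := by
  have h1 : ∏ i ∈ range (N - 1), g (1 + i + j) = ∏ i ∈ Ico (1 + j) (N + j), g i := by
    rw [Finset.prod_Ico_eq_prod_range, show N + j - (1 + j) = N - 1 by omega]
    refine Finset.prod_congr rfl fun i _ => ?_
    congr 1; omega
  have h2 : ∏ i ∈ Ico N (N + j), g i = g N * ∏ r ∈ Ico 1 j, g (r + N) := by
    rw [Finset.prod_Ico_eq_prod_range, Nat.add_sub_cancel_left, Finset.range_eq_Ico,
      Finset.prod_eq_prod_Ico_succ_bot (by omega)]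
    simp [add_comm N]
  have h3 : (Ico 1 N).erase j = Ico 1 j ∪ Ico (1 + j) N := by
    ext x
    simp only [Finset.mem_erase, Finset.mem_Ico, Finset.mem_union]
    omega
  have h4 : Disjoint (Ico 1 j) (Ico (1 + j) N) := by
    rw [Finset.disjoint_left]
    intro x
    simp only [Finset.mem_Ico]
    omega
  rw [h1, ← Finset.prod_Ico_consecutive g (show 1 + j ≤ N by omega) (by omega), h2, h3,
    Finset.prod_union h4]
  have h5 : ∏ r ∈ Ico 1 j, g (r + N * (if r < j then 1 else 0)) = ∏ r ∈ Ico 1 j, g (r + N) := by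
    refine Finset.prod_congr rfl fun r hr => ?_
    rw [if_pos (Finset.mem_Ico.1 hr).2, mul_one]
  have h6 : ∏ r ∈ Ico (1 + j) N, g (r + N * (if r < j then 1 else 0)) =
      ∏ r ∈ Ico (1 + j) N, g r := by
    refine Finset.prod_congr rfl fun r hr => ?_
    rw [if_neg (by have := (Finset.mem_Ico.1 hr).1; omega), mul_zero, add_zero]
  rw [h5, h6]
  rw [mul_comm, mul_assoc]

/-- Product of factors over a set of residues. -/
theorem fac_prod (m : ℕ) (ε : ℕ → ℕ) (S : Finset ℕ) (hS : S ⊆ Ico 1 (2 ^ m)) :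
    ∃ f : ℕ → ℤ_[2]⟦X⟧, EU 2 f ∧ (2 ^ (m - 1) ∉ S → EU 4 f) ∧
      ∀ y, ∏ r ∈ S, lin ℤ_[2] (r + 2 ^ m * ε r) (2 ^ m) y =
        C ((2 : ℤ_[2]) ^ ∑ r ∈ S, padicValNat 2 r) * f y := by
  have hex : ∀ r, ∃ f : ℕ → ℤ_[2]⟦X⟧, r ∈ S → EU 2 f ∧ (r ≠ 2 ^ (m - 1) → EU 4 f) ∧
      ∀ y, lin ℤ_[2] (r + 2 ^ m * ε r) (2 ^ m) y = C ((2 : ℤ_[2]) ^ padicValNat 2 r) * f y := by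
    intro r
    by_cases hr : r ∈ S
    · have := Finset.mem_Ico.1 (hS hr)
      obtain ⟨f, hf⟩ := fac m r (ε r) this.1 this.2
      exact ⟨f, fun _ => hf⟩
    · exact ⟨fun _ => 0, fun h => absurd h hr⟩
  choose f hf using hex
  refine ⟨fun y => ∏ r ∈ S, f r y, EU.prod S fun r hr => (hf r hr).1, fun h =>
    EU.prod S fun r hr => (hf r hr).2.1 (fun h' => h (h' ▸ hr)), fun y => ?_⟩
  rw [Finset.prod_congr rfl fun r hr => (hf r hr).2.2 y, Finset.prod_mul_distrib,
    ← map_prod, Finset.prod_pow_eq_pow_sum]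

theorem val_half (m : ℕ) (hm : 2 ≤ m) : 2 ^ (m - 1) ∈ Ico 1 (2 ^ m) := by
  rw [Finset.mem_Ico]
  exact ⟨Nat.one_le_two_pow, Nat.pow_lt_pow_right (by norm_num) (by omega)⟩

theorem Q_zero (m : ℕ) (hm : 2 ≤ m) : ∃ T : ℕ → ℤ_[2]⟦X⟧, EU 4 T ∧
    ∀ y, ∏ i ∈ range (2 ^ m - 1), lin ℤ_[2] (1 + i) (2 ^ m) y =
      C ((2 : ℤ_[2]) ^ ee m) * (lin ℤ_[2] 1 2 y * T y) := by
  have hh := val_half m hm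
  obtain ⟨f, -, h4, hf⟩ := fac_prod m (fun _ => 0) ((Ico 1 (2 ^ m)).erase (2 ^ (m - 1)))
    (Finset.erase_subset _ _)
  refine ⟨f, h4 (Finset.notMem_erase _ _), fun y => ?_⟩
  have h1 : ∏ i ∈ range (2 ^ m - 1), lin ℤ_[2] (1 + i) (2 ^ m) y =
      ∏ r ∈ Ico 1 (2 ^ m), lin ℤ_[2] r (2 ^ m) y := by
    rw [Finset.prod_Ico_eq_prod_range]
  have h2 := hf y
  simp only [mul_zero, add_zero] at h2
  rw [h1, ← Finset.mul_prod_erase _ _ hh, h2, ee, ← Finset.add_sum_erase _ _ hh,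
    padicValNat.prime_pow]
  have e : 2 ^ m = 2 ^ (m - 1) * 2 := by rw [← pow_succ]; congr 1; omega
  have h3 := lin_smul (2 ^ (m - 1)) 1 2 y
  rw [mul_one, ← e] at h3
  rw [h3, pow_add, map_mul]
  push_cast
  ring

theorem Q_half (m : ℕ) (hm : 2 ≤ m) : ∃ T : ℕ → ℤ_[2]⟦X⟧, EU 4 T ∧
    ∀ y, ∏ i ∈ range (2 ^ m - 1), lin ℤ_[2] (1 + i + 2 ^ (m - 1)) (2 ^ m) y =
      C ((2 : ℤ_[2]) ^ ee m) * (lin ℤ_[2] 2 2 y * T y) := by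
  have hh := val_half m hm
  obtain ⟨f, -, h4, hf⟩ := fac_prod m (fun r => if r < 2 ^ (m - 1) then 1 else 0)
    ((Ico 1 (2 ^ m)).erase (2 ^ (m - 1))) (Finset.erase_subset _ _)
  refine ⟨f, h4 (Finset.notMem_erase _ _), fun y => ?_⟩
  have hh' := Finset.mem_Ico.1 hh
  rw [reindex (fun r => lin ℤ_[2] r (2 ^ m) y) (2 ^ m) (2 ^ (m - 1)) hh'.1 hh'.2, hf y, ee,
    ← Finset.add_sum_erase _ _ hh, padicValNat.prime_pow]
  have e : 2 ^ m = 2 ^ (m - 1) * 2 := by rw [← pow_succ]; congr 1; omega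
  have h3 := lin_smul (2 ^ (m - 1)) 2 2 y
  rw [← e] at h3
  rw [h3, pow_add, map_mul]
  push_cast
  ring

theorem Q_other (m j : ℕ) (hj1 : 1 ≤ j) (hj2 : j < 2 ^ m) (hj3 : j ≠ 2 ^ (m - 1)) :
    ∃ T : ℕ → ℤ_[2]⟦X⟧, EE 2 T ∧
    ∀ y, ∏ i ∈ range (2 ^ m - 1), lin ℤ_[2] (1 + i + j) (2 ^ m) y =
      C ((2 : ℤ_[2]) ^ ee m) * (C 2 * T y) := by
  have hh : j ∈ Ico 1 (2 ^ m) := Finset.mem_Ico.2 ⟨hj1, hj2⟩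
  obtain ⟨f, h2, -, hf⟩ := fac_prod m (fun r => if r < j then 1 else 0)
    ((Ico 1 (2 ^ m)).erase j) (Finset.erase_subset _ _)
  have hv : padicValNat 2 j + 2 ≤ m := by
    have hd : 2 ^ padicValNat 2 j ∣ j := pow_padicValNat_dvd
    have hle := Nat.le_of_dvd hj1 hd
    have hlt := (Nat.pow_lt_pow_iff_right (by norm_num : 1 < 2)).1 (lt_of_le_of_lt hle hj2)
    by_contra hc
    have hm1 : padicValNat 2 j = m - 1 := by omega
    rw [hm1] at hd
    obtain ⟨c, hc⟩ := hd
    have e : 2 ^ m = 2 ^ (m - 1) * 2 := by rw [← pow_succ]; congr 1; omega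
    have hc2 : c < 2 := by
      rw [hc, e] at hj2
      exact lt_of_mul_lt_mul_left hj2 (by positivity)
    interval_cases c
    · omega
    · simp at hc; exact hj3 hc
  obtain ⟨d, hd⟩ := Nat.exists_eq_add_of_le hv
  refine ⟨fun y => (C ((2 : ℤ_[2]) ^ d) * lin ℤ_[2] 2 2 y) * f y,
    ((EE.const _ _).mul ?_).mul h2.toEE, fun y => ?_⟩
  · exact_mod_cast EE_lin 2 2 1
  rw [reindex (fun r => lin ℤ_[2] r (2 ^ m) y) (2 ^ m) j hj1 hj2, hf y, ee,
    ← Finset.add_sum_erase _ _ hh]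
  have h3 := lin_smul (2 ^ (padicValNat 2 j + 1 + d)) 2 2 y
  rw [show 2 ^ (padicValNat 2 j + 1 + d) * 2 = 2 ^ m by rw [← pow_succ]; congr 1; omega] at h3
  rw [h3]
  push_cast
  simp only [pow_add, map_mul, pow_one]
  ring

end Volk
namespace Volk

open PowerSeries

theorem exists_D (n : ℕ) : ∃ D : ℕ → ℤ_[2]⟦X⟧, ∀ k, D k * denS ℤ_[2] n k = 1 := by
  have h : ∀ k, ∃ d, d * denS ℤ_[2] n k = 1 := by
    intro k
    apply IsUnit.exists_left_inv
    rw [isUnit_iff_constantCoeff, denS, map_prod]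
    apply Finset.prod_induction _ IsUnit (fun _ _ => IsUnit.mul) isUnit_one
    intro i _
    simp only [lin, map_add, map_mul, constantCoeff_C, constantCoeff_X, mul_zero, add_zero]
    have h1 : Odd (1 + 4 * i + 4 * k) := ⟨2 * i + 2 * k, by ring⟩
    exact_mod_cast isUnit_odd h1
  choose D hD using h
  exact ⟨D, hD⟩

theorem T2_H (s δ n : ℕ) (D : ℕ → ℤ_[2]⟦X⟧) (hD : ∀ k, D k * denS ℤ_[2] n k = 1) :
    T2 (fun k => numS ℤ_[2] s δ n k * D k ^ (2 * s + 4)) := by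
  have hden : T2 (fun k => denS ℤ_[2] n k) := T2.prod (fun i => T2_lin (1 + 4 * i) 4) (n + 1)
  refine T2.mul ?_ ((hden.inv hD).pow _)
  exact (((T2_lin _ _).pow _).mul ((T2.prod (fun i => T2_lin (1 + 2 * i) 2) n).pow _)).mul
    ((T2.prod (fun i => T2_lin (1 + i) 1) n).pow _)

theorem decomp (s δ m n j : ℕ) (hm : 2 ≤ m) (D : ℕ → ℤ_[2]⟦X⟧)
    (hD : ∀ k, D k * denS ℤ_[2] n k = 1) :
    ∃ W : ℕ → ℤ_[2]⟦X⟧, EU 4 W ∧ ∀ y,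
      rescale ((2 : ℤ_[2]) ^ m)
        (numS ℤ_[2] s δ n (j + 2 ^ m * y) * D (j + 2 ^ m * y) ^ (2 * s + 4)) =
      (∏ i ∈ range n, lin ℤ_[2] (1 + i + j) (2 ^ m) y) ^ (s + 2) * W y := by
  have e4 : ∀ a, Odd a → EU 4 (fun y => lin ℤ_[2] a (4 * 2 ^ m) y) := fun a ha => by
    exact_mod_cast EU_lin 4 a (2 ^ m) ha (by decide)
  have e2 : ∀ a, Odd a → EU 4 (fun y => lin ℤ_[2] a (2 * 2 ^ m) y) := fun a ha => by
    have e : 2 * 2 ^ m = 4 * 2 ^ (m - 1) := by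
      obtain ⟨d, rfl⟩ := Nat.exists_eq_add_of_le hm
      rw [show 2 + d - 1 = 1 + d by omega, pow_add, pow_add]; ring
    rw [e]
    exact_mod_cast EU_lin 4 a (2 ^ (m - 1)) ha (by decide)
  have hden : EU 4 (fun y => rescale ((2 : ℤ_[2]) ^ m) (denS ℤ_[2] n (j + 2 ^ m * y))) := by
    simp only [denS, map_prod, rescale_lin]
    exact EU.prod _ fun i _ => e4 _ ⟨2 * i + 2 * j, by ring⟩
  have hDr : EU 4 (fun y => rescale ((2 : ℤ_[2]) ^ m) (D (j + 2 ^ m * y))) := by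
    refine hden.inv fun y => ?_
    rw [← map_mul, hD, map_one]
  refine ⟨fun y => (lin ℤ_[2] (1 + 2 * n + 4 * j) (4 * 2 ^ m) y ^ δ *
    (∏ i ∈ range n, lin ℤ_[2] (1 + 2 * i + 2 * j) (2 * 2 ^ m) y) ^ (s + 2)) *
    rescale ((2 : ℤ_[2]) ^ m) (D (j + 2 ^ m * y)) ^ (2 * s + 4), ?_, fun y => ?_⟩
  · refine (((e4 _ ⟨n + 2 * j, by ring⟩).pow _).mul
      ((EU.prod _ fun i _ => e2 _ ⟨i + j, by ring⟩).pow _)).mul (hDr.pow _)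
  · simp only [numS, map_mul (rescale _), map_pow (rescale _), map_prod (rescale _), rescale_lin,
      one_mul]
    ring

theorem perj (s δ m M j : ℕ) (hm : 2 ≤ m) (hj : j < 2 ^ m) (D : ℕ → ℤ_[2]⟦X⟧)
    (hD : ∀ k, D k * denS ℤ_[2] (2 ^ m - 1) k = 1) :
    ∃ u : ℤ_[2], (j = 0 → IsUnit u) ∧ (j ≠ 0 → 2 ∣ u) ∧
      ∑ y ∈ range (2 ^ M), coeff s (rescale ((2 : ℤ_[2]) ^ m)
        (numS ℤ_[2] s δ (2 ^ m - 1) (j + 2 ^ m * y) * D (j + 2 ^ m * y) ^ (2 * s + 4))) =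
      2 ^ (ee m * (s + 2)) * (2 ^ (s + M) * ((s + 2).choose 2 : ℕ) * u) := by
  obtain ⟨W, hW, hWe⟩ := decomp s δ m (2 ^ m - 1) j hm D hD
  simp only [hWe]
  rcases Nat.eq_zero_or_pos j with rfl | hj0
  · obtain ⟨T, hT, hTe⟩ := Q_zero m hm
    obtain ⟨u, z, hu, hz⟩ := sumA s M 1 _ ((hT.pow (s + 2)).mul hW)
    refine ⟨((1 : ℕ) : ℤ_[2]) ^ 2 * u + 2 * z, fun _ => ?_, fun h => absurd rfl h, ?_⟩
    · exact isUnit_add_two (by simpa using hu)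
    · rw [← hz, Finset.mul_sum]
      refine Finset.sum_congr rfl fun y _ => ?_
      simp only [add_zero]
      rw [hTe, ← coeff_C_mul, pow_mul]
      congr 1
      simp only [map_pow]
      ring
  · by_cases hj2 : j = 2 ^ (m - 1)
    · subst hj2
      obtain ⟨T, hT, hTe⟩ := Q_half m hm
      obtain ⟨u, z, hu, hz⟩ := sumA s M 2 _ ((hT.pow (s + 2)).mul hW)
      refine ⟨((2 : ℕ) : ℤ_[2]) ^ 2 * u + 2 * z, fun h => by omega,
        fun _ => ⟨2 * u + z, by push_cast; ring⟩, ?_⟩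
      rw [← hz, Finset.mul_sum]
      refine Finset.sum_congr rfl fun y _ => ?_
      rw [hTe, ← coeff_C_mul, pow_mul]
      congr 1
      simp only [map_pow]
      ring
    · obtain ⟨T, hT, hTe⟩ := Q_other m j hj0 hj hj2
      have hW2 : EE 2 W := by
        obtain ⟨ψ, k1, _, k3⟩ := hW
        refine ⟨fun y => rescale 2 (ψ y), fun y h => ?_, fun y => ?_⟩
        · obtain ⟨v, hv⟩ := k1 y h
          refine ⟨C 2 * rescale 2 v, ?_⟩
          rw [← map_sub, hv, map_mul, rescale_C, ← mul_assoc, ← map_mul]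
          congr 2
          ring
        · rw [k3]
          ext i
          simp only [coeff_rescale]
          rw [← mul_assoc, ← mul_pow]
          norm_num
      obtain ⟨z, hz⟩ := sumB s M _ ((hT.pow (s + 2)).mul hW2)
      refine ⟨2 * z, fun h => by omega, fun _ => ⟨z, rfl⟩, ?_⟩
      rw [← hz, Finset.mul_sum]
      refine Finset.sum_congr rfl fun y _ => ?_
      rw [hTe, ← coeff_C_mul _ _ ((2 : ℤ_[2]) ^ (ee m * (s + 2))), pow_mul]
      congr 1
      simp only [map_pow]
      ring

theorem sum_range_mul' (g : ℕ → ℤ_[2]) (a b : ℕ) :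
    ∑ k ∈ range (a * b), g k = ∑ j ∈ range a, ∑ y ∈ range b, g (j + a * y) := by
  rw [Finset.sum_comm]
  induction b with
  | zero => simp
  | succ b ih =>
    rw [Nat.mul_succ, Finset.sum_range_add, ih, Finset.sum_range_succ]
    simp only [add_comm (a * b)]

theorem total (s δ m M : ℕ) (hm : 2 ≤ m) (D : ℕ → ℤ_[2]⟦X⟧)
    (hD : ∀ k, D k * denS ℤ_[2] (2 ^ m - 1) k = 1) :
    ∃ u : ℤ_[2], IsUnit u ∧
      2 ^ (m * s) * ∑ k ∈ range (2 ^ (m + M)),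
        coeff s (numS ℤ_[2] s δ (2 ^ m - 1) k * D k ^ (2 * s + 4)) =
      2 ^ (ee m * (s + 2)) * (2 ^ (s + M) * ((s + 2).choose 2 : ℕ) * u) := by
  have hex : ∀ j, ∃ u : ℤ_[2], j < 2 ^ m → (j = 0 → IsUnit u) ∧ (j ≠ 0 → 2 ∣ u) ∧
      ∑ y ∈ range (2 ^ M), coeff s (rescale ((2 : ℤ_[2]) ^ m)
        (numS ℤ_[2] s δ (2 ^ m - 1) (j + 2 ^ m * y) * D (j + 2 ^ m * y) ^ (2 * s + 4))) =
      2 ^ (ee m * (s + 2)) * (2 ^ (s + M) * ((s + 2).choose 2 : ℕ) * u) := by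
    intro j
    by_cases hj : j < 2 ^ m
    · obtain ⟨u, hu⟩ := perj s δ m M j hm hj D hD
      exact ⟨u, fun _ => hu⟩
    · exact ⟨0, fun h => absurd h hj⟩
  choose u hu using hex
  refine ⟨∑ j ∈ range (2 ^ m), u j, ?_, ?_⟩
  · have h1 : 2 ^ m = (2 ^ m - 1) + 1 := (Nat.sub_add_cancel Nat.one_le_two_pow).symm
    rw [h1, Finset.sum_range_succ']
    have h2 : (2 : ℤ_[2]) ∣ ∑ j ∈ range (2 ^ m - 1), u (j + 1) := by
      refine Finset.dvd_sum fun j hj => (hu (j + 1) ?_).2.1 (by omega)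
      have := Finset.mem_range.1 hj
      omega
    obtain ⟨z, hz⟩ := h2
    rw [hz, add_comm]
    exact isUnit_add_two ((hu 0 (by positivity)).1 rfl)
  · rw [pow_add 2 m M, sum_range_mul', Finset.mul_sum, Finset.mul_sum, Finset.mul_sum]
    refine Finset.sum_congr rfl fun j hj => ?_
    rw [← (hu j (Finset.mem_range.1 hj)).2.2, Finset.mul_sum]
    refine Finset.sum_congr rfl fun y _ => ?_
    rw [coeff_rescale, pow_mul]

theorem val_two_pow (a : ℕ) : ((2 : ℚ_[2]) ^ a).valuation = a := by
  rw [Padic.valuation_pow]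
  have := Padic.valuation_p (p := 2)
  have h : (2 : ℚ_[2]).valuation = 1 := by exact_mod_cast this
  rw [h, mul_one]

theorem val_unit {u : ℤ_[2]} (hu : IsUnit u) : (u : ℚ_[2]) ≠ 0 ∧ (u : ℚ_[2]).valuation = 0 := by
  have h1 := PadicInt.isUnit_iff.1 hu
  have h0 : (u : ℚ_[2]) ≠ 0 := by
    intro h
    have : u = 0 := PadicInt.ext h
    rw [this] at h1
    simp at h1
  refine ⟨h0, ?_⟩
  have h2 : ‖(u : ℚ_[2])‖ = 1 := by simpa using h1
  rw [Padic.norm_eq_zpow_neg_valuation h0] at h2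
  have := zpow_right_injective₀ (a := (2 : ℝ)) (by norm_num) (by norm_num)
    (show (2 : ℝ) ^ (-(u : ℚ_[2]).valuation) = 2 ^ (0 : ℤ) by simpa using h2)
  simpa using this

theorem val_limit (u : ℕ → ℚ_[2]) (S : ℚ_[2]) (v : ℤ) (m : ℕ)
    (hS : Tendsto u atTop (nhds S)) (h : ∀ M, u (m + M) ≠ 0 ∧ (u (m + M)).valuation = v) :
    S ≠ 0 ∧ S.valuation = v := by
  have h1 : Tendsto (fun M => ‖u M‖) atTop (nhds ‖S‖) := hS.norm
  have h2 : Tendsto (fun M => ‖u M‖) atTop (nhds ((2 : ℝ) ^ (-v))) := by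
    refine tendsto_const_nhds.congr' ?_
    filter_upwards [eventually_ge_atTop m] with M hM
    obtain ⟨d, rfl⟩ := Nat.exists_eq_add_of_le hM
    rw [Padic.norm_eq_zpow_neg_valuation (h d).1, (h d).2]
    norm_num
  have h3 := tendsto_nhds_unique h1 h2
  have h0 : S ≠ 0 := by
    intro h
    rw [h, norm_zero] at h3
    have : (0 : ℝ) < 2 ^ (-v) := by positivity
    linarith
  refine ⟨h0, ?_⟩
  rw [Padic.norm_eq_zpow_neg_valuation h0] at h3
  have := zpow_right_injective₀ (a := (2 : ℝ)) (by norm_num) (by norm_num)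
    (show (2 : ℝ) ^ (-S.valuation) = 2 ^ (-v) by simpa using h3)
  simpa using this

theorem Phi_odd (n : ℕ) (hn : 1 ≤ n) : Odd (Phi n) := by
  classical
  unfold Phi
  apply Finset.prod_induction _ Odd (fun _ _ => Odd.mul) odd_one
  intro q _
  split_ifs with h
  · apply h.1.odd_of_ne_two
    rintro rfl
    have h2 := h.2.1
    rw [Real.sqrt_lt' (by norm_num)] at h2
    have : (1 : ℝ) ≤ n := by exact_mod_cast hn
    norm_num at h2
    linarith
  · exact odd_one

theorem dlcm_val (m : ℕ) (hm : 2 ≤ m) :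
    dlcm (2 ^ m - 1) ≠ 0 ∧ padicValNat 2 (dlcm (2 ^ m - 1)) = m - 1 := by
  have hpos : 0 < ∏ i ∈ Icc 1 (2 ^ m - 1), ordCompl[2] i := by
    apply Finset.prod_pos
    intro i hi
    exact Nat.ordCompl_pos 2 (by have := (Finset.mem_Icc.1 hi).1; omega)
  have h1 : dlcm (2 ^ m - 1) ∣ 2 ^ (m - 1) * ∏ i ∈ Icc 1 (2 ^ m - 1), ordCompl[2] i := by
    refine Finset.lcm_dvd fun i hi => ?_
    have hi' := Finset.mem_Icc.1 hi
    have e := Nat.ordProj_mul_ordCompl_eq_self i 2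
    rw [id, ← e]
    refine mul_dvd_mul (pow_dvd_pow _ ?_) ?_
    · have hle : 2 ^ i.factorization 2 ≤ i := Nat.ordProj_le 2 (by omega)
      have hlt : 2 ^ i.factorization 2 < 2 ^ m := by
        have := Nat.one_le_two_pow (n := m); omega
      have := (Nat.pow_lt_pow_iff_right (by norm_num : 1 < 2)).1 hlt
      omega
    · show _ ∣ _
      exact Finset.dvd_prod_of_mem (fun i => ordCompl[2] i) hi
  have hprod_odd : ¬ 2 ∣ ∏ i ∈ Icc 1 (2 ^ m - 1), ordCompl[2] i := by
    intro h
    rw [Prime.dvd_finsetProd_iff Nat.prime_two.prime] at h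
    obtain ⟨i, hi, h⟩ := h
    exact Nat.not_dvd_ordCompl Nat.prime_two
      (by have := (Finset.mem_Icc.1 hi).1; omega) h
  have hne : dlcm (2 ^ m - 1) ≠ 0 := by
    intro h
    rw [h, zero_dvd_iff] at h1
    have : 0 < 2 ^ (m - 1) * ∏ i ∈ Icc 1 (2 ^ m - 1), ordCompl[2] i := by positivity
    omega
  refine ⟨hne, le_antisymm ?_ ?_⟩
  · have h2 : 2 ^ padicValNat 2 (dlcm (2 ^ m - 1)) ∣
        2 ^ (m - 1) * ∏ i ∈ Icc 1 (2 ^ m - 1), ordCompl[2] i := pow_padicValNat_dvd.trans h1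
    have h3 : Nat.Coprime (2 ^ padicValNat 2 (dlcm (2 ^ m - 1)))
        (∏ i ∈ Icc 1 (2 ^ m - 1), ordCompl[2] i) :=
      Nat.Coprime.pow_left _ ((Nat.Prime.coprime_iff_not_dvd Nat.prime_two).2 hprod_odd)
    have h4 := h3.dvd_of_dvd_mul_right h2
    exact (Nat.pow_dvd_pow_iff_le_right (by norm_num)).1 h4
  · rw [← padicValNat_dvd_iff_le hne]
    have : 2 ^ (m - 1) ∈ Icc 1 (2 ^ m - 1) := by
      have := Finset.mem_Ico.1 (val_half m hm)
      rw [Finset.mem_Icc]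
      omega
    exact Finset.dvd_lcm (f := id) this

theorem cast_side (s δ n k i : ℕ) (D : ℕ → ℤ_[2]⟦X⟧) (hD : ∀ k, D k * denS ℤ_[2] n k = 1) :
    ((coeff i (GQ s δ n k) : ℚ) : ℚ_[2]) =
      ((coeff i (numS ℤ_[2] s δ n k * D k ^ (2 * s + 4)) : ℤ_[2]) : ℚ_[2]) := by
  have h1 : (numS ℤ_[2] s δ n k * D k ^ (2 * s + 4)) * denS ℤ_[2] n k ^ (2 * s + 4) =
      numS ℤ_[2] s δ n k := by
    rw [mul_assoc, ← mul_pow, hD, one_pow, mul_one]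
  have h2 := congrArg (PowerSeries.map (PadicInt.Coe.ringHom (p := 2))) h1
  rw [map_mul, map_pow, map_denS, map_numS] at h2
  have h3 := congrArg (coeff i) (GQ_map (Rat.castHom ℚ_[2]) s δ n k _ h2)
  rw [coeff_map, coeff_map] at h3
  exact h3

theorem val_fact_choose (s : ℕ) :
    padicValNat 2 (s + 2).factorial =
      padicValNat 2 s.factorial + padicValNat 2 ((s + 2).choose 2) + 1 := by
  have h := Nat.choose_mul_factorial_mul_factorial (show 2 ≤ s + 2 by omega)
  rw [Nat.add_sub_cancel, Nat.factorial_two] at h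
  have hc : (s + 2).choose 2 ≠ 0 := (Nat.choose_pos (by omega)).ne'
  rw [← h, padicValNat.mul (by positivity) (Nat.factorial_ne_zero _),
    padicValNat.mul hc (by norm_num), padicValNat.self (by norm_num)]
  ring

theorem val_I (s δ m M : ℕ) (hm : 2 ≤ m) (D : ℕ → ℤ_[2]⟦X⟧)
    (hD : ∀ k, D k * denS ℤ_[2] (2 ^ m - 1) k = 1) (x : ℚ_[2])
    (hx : x = (2 ^ (m + M) : ℚ_[2])⁻¹ *
      ((∑ k ∈ range (2 ^ (m + M)),
        coeff s (numS ℤ_[2] s δ (2 ^ m - 1) k * D k ^ (2 * s + 4)) : ℤ_[2]) : ℚ_[2])) :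
    x ≠ 0 ∧ x.valuation = (ee m * (s + 2) : ℤ) + s + padicValNat 2 ((s + 2).choose 2)
      - m - m * s := by
  obtain ⟨u, hu, e⟩ := total s δ m M hm D hD
  set A := ∑ k ∈ range (2 ^ (m + M)),
    coeff s (numS ℤ_[2] s δ (2 ^ m - 1) k * D k ^ (2 * s + 4))
  have e' : (2 : ℚ_[2]) ^ (m * s) * (A : ℚ_[2]) =
      2 ^ (ee m * (s + 2)) * (2 ^ (s + M) * ((s + 2).choose 2 : ℕ) * u) := by
    exact_mod_cast congrArg (fun x : ℤ_[2] => (x : ℚ_[2])) e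
  have p2 : ∀ a : ℕ, (2 : ℚ_[2]) ^ a ≠ 0 := fun a => pow_ne_zero _ two_ne_zero
  have hc : (((s + 2).choose 2 : ℕ) : ℚ_[2]) ≠ 0 := by
    exact_mod_cast (Nat.choose_pos (show 2 ≤ s + 2 by omega)).ne'
  obtain ⟨u0, uv⟩ := val_unit hu
  have e2 : (2 : ℚ_[2]) ^ (m * s + (m + M)) * x =
      2 ^ (ee m * (s + 2) + (s + M)) * (((s + 2).choose 2 : ℕ) * u) := by
    rw [hx, pow_add, mul_assoc, mul_inv_cancel_left₀ (p2 _), e', pow_add]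
    ring
  have hx0 : x ≠ 0 := by
    rintro rfl
    rw [mul_zero] at e2
    exact (mul_ne_zero (p2 _) (mul_ne_zero hc u0)) e2.symm
  refine ⟨hx0, ?_⟩
  have e3 := congrArg Padic.valuation e2
  rw [Padic.valuation_mul (p2 _) hx0, Padic.valuation_mul (p2 _) (mul_ne_zero hc u0),
    Padic.valuation_mul hc u0, val_two_pow, val_two_pow, uv, Padic.valuation_natCast] at e3
  generalize padicValNat 2 ((s + 2).choose 2) = w at e3 ⊢
  push_cast at e3
  linarith

end Volk

/-- For `n = 2^m - 1`, `m ≥ 2`: the values of the `s`-th derivative of `A_n` at the points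
`k + 1/4` are rational, the Volkenborn integral `S_n` of `A_n^{(s)}(t + 1/4)` exists in
`ℚ₂`, is nonzero, and
`v₂(Φ_n^{-(s+2)} d_n^{3s+5} S_n) = (10s+20)n + (s+2)m + 2s + v₂((s+2)!) + 2`;
equivalently `v₂(S_n) = (10s+20)n - (2s+3)m + 5s + v₂((s+2)!) + 7`. -/
theorem volkenborn_integral_Sn_valuation (s δ : ℕ) (hδ : δ ≤ 1)
    (m : ℕ) (hm : 2 ≤ m) (n : ℕ) (hn : n = 2 ^ m - 1) :
    ∃ (F : ℕ → ℚ) (S : ℚ_[2]),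
      (∀ k : ℕ, (F k : ℝ) = iteratedDeriv s (ARealfun s δ n) ((k : ℝ) + 1/4)) ∧
      Filter.Tendsto
        (fun M : ℕ => (2 ^ M : ℚ_[2])⁻¹ * ∑ k ∈ Finset.range (2 ^ M), ((F k : ℚ_[2])))
        Filter.atTop (nhds S) ∧
      S ≠ 0 ∧
      (((Phi n : ℚ_[2]) ^ (s + 2))⁻¹ * (dlcm n : ℚ_[2]) ^ (3 * s + 5) * S).valuation =
        ((10 * s + 20) * n + (s + 2) * m + 2 * s +
          padicValNat 2 (Nat.factorial (s + 2)) + 2 : ℕ) ∧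
      S.valuation = ((10 * s + 20) * n : ℤ) - (2 * s + 3) * m + 5 * s +
        padicValNat 2 (Nat.factorial (s + 2)) + 7 := by
  subst hn
  have hn1 : 1 ≤ 2 ^ m - 1 := by
    have : 2 ^ 1 ≤ 2 ^ m := Nat.pow_le_pow_right (by norm_num) (by omega)
    omega
  obtain ⟨D, hD⟩ := Volk.exists_D (2 ^ m - 1)
  obtain ⟨S₀, hS₀⟩ := (Volk.T2_H s δ (2 ^ m - 1) D hD).tendsto s
  have hval := Volk.val_limit _ S₀ _ m hS₀
    (fun M => Volk.val_I s δ m M hm D hD _ rfl)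
  have hc0 : (s.factorial : ℚ_[2]) ≠ 0 := by exact_mod_cast Nat.factorial_ne_zero s
  have p2 : ∀ a : ℕ, (2 : ℚ_[2]) ^ a ≠ 0 := fun a => pow_ne_zero _ two_ne_zero
  set c : ℚ_[2] := s.factorial * 2 ^ ((s + 2) * (9 * (2 ^ m - 1) + 4)) with hc
  have hcne : c ≠ 0 := mul_ne_zero hc0 (p2 _)
  have hS0 : c * S₀ ≠ 0 := mul_ne_zero hcne hval.1
  have hee := Volk.ee_eq m
  have hSv : (c * S₀).valuation = ((10 * s + 20) * (2 ^ m - 1 : ℕ) : ℤ) - (2 * s + 3) * m + 5 * s +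
        padicValNat 2 (Nat.factorial (s + 2)) + 7 := by
    rw [Padic.valuation_mul hcne hval.1, hval.2, hc, Padic.valuation_mul hc0 (p2 _),
      Volk.val_two_pow, Padic.valuation_natCast, Volk.val_fact_choose, ← hee]
    push_cast
    ring
  refine ⟨fun k => s.factorial * 2 ^ ((s + 2) * (9 * (2 ^ m - 1) + 4)) *
    PowerSeries.coeff s (Volk.GQ s δ (2 ^ m - 1) k), c * S₀, ?_, ?_, hS0, ?_, ?_⟩
  · intro k
    exact (Volk.real_side s δ (2 ^ m - 1) k s).symm
  · refine (hS₀.const_mul c).congr fun M => ?_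
    have h : ∀ k, (((s.factorial * 2 ^ ((s + 2) * (9 * (2 ^ m - 1) + 4)) *
        PowerSeries.coeff s (Volk.GQ s δ (2 ^ m - 1) k) : ℚ)) : ℚ_[2]) =
        c * ((PowerSeries.coeff s (Volk.numS ℤ_[2] s δ (2 ^ m - 1) k *
          D k ^ (2 * s + 4)) : ℤ_[2]) : ℚ_[2]) := by
      intro k
      rw [Rat.cast_mul, Volk.cast_side s δ _ k s D hD, hc]
      push_cast
      rfl
    simp only [h]
    rw [← Finset.mul_sum, PadicInt.coe_sum]
    ring
  · have hodd := Volk.Phi_odd _ hn1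
    have hP0 : (Phi (2 ^ m - 1) : ℚ_[2]) ≠ 0 := by
      exact_mod_cast hodd.pos.ne'
    have hPv : (Phi (2 ^ m - 1) : ℚ_[2]).valuation = 0 := by
      rw [Padic.valuation_natCast, padicValNat.eq_zero_of_not_dvd hodd.not_two_dvd_nat]
      rfl
    obtain ⟨hd0, hdv⟩ := Volk.dlcm_val m hm
    have hd0' : (dlcm (2 ^ m - 1) : ℚ_[2]) ≠ 0 := by exact_mod_cast hd0
    have hi : ((Phi (2 ^ m - 1) : ℚ_[2]) ^ (s + 2))⁻¹ ≠ 0 := inv_ne_zero (pow_ne_zero _ hP0)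
    rw [Padic.valuation_mul (mul_ne_zero hi (pow_ne_zero _ hd0')) hS0,
      Padic.valuation_mul hi (pow_ne_zero _ hd0'), Padic.valuation_inv, Padic.valuation_pow,
      Padic.valuation_pow, hPv, Padic.valuation_natCast, hdv, hSv]
    have hm1 : ((m - 1 : ℕ) : ℤ) = m - 1 := by push_cast [show 1 ≤ m by omega]; ring
    rw [hm1]
    generalize 2 ^ m - 1 = n
    push_cast
    ring
  · exact hSv
end
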